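/- For every complex number λ with |λ| = 1, the limit c(λ) := lim_{N→∞} (1/N)∑_{k=1}^N Λ'(k) λ^k exists; moreover lim_{N→∞} (1/N)∑_{k=1}^N Λ(k) λ^k exists and equals c(λ), and c(λ) = 0 whenever λ is not a root of unity. In particular, both (Λ(n)) and (Λ'(n)) are Hartman sequences with the same Fourier–Bohr coefficients. -/

import Mathlib

open Filter Finset

/-- The modified von Mangoldt function `Λ'(n) = log n` if `n` is prime, `0` otherwise. -/
noncomputable def LambdaPrime (n : ℕ) : ℝ := if n.Prime then Real.log n else 0


section PartA
open ArithmeticFunction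
open scoped ArithmeticFunction.Moebius ArithmeticFunction.zeta

theorem vk_swap {M : Type*} [AddCommMonoid M] (f : ℕ → ℕ → M) (N : ℕ) :
    ∑ n ∈ Ioc 0 N, ∑ p ∈ n.divisorsAntidiagonal, f p.1 p.2 =
      ∑ d ∈ Ioc 0 N, ∑ m ∈ Ioc 0 (N / d), f d m := by
  rw [sum_sigma', sum_sigma']
  refine sum_bij' (fun x _ => ⟨x.2.1, x.2.2⟩) (fun y _ => ⟨y.1 * y.2, (y.1, y.2)⟩) ?_ ?_ ?_ ?_ ?_
  · rintro ⟨n, a, b⟩ h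
    simp only [mem_sigma, mem_Ioc, Nat.mem_divisorsAntidiagonal] at h ⊢
    obtain ⟨⟨h1, h2⟩, rfl, h3⟩ := h
    have ha : 0 < a := Nat.pos_of_ne_zero (by rintro rfl; simp at h3)
    have hb : 0 < b := Nat.pos_of_ne_zero (by rintro rfl; simp at h3)
    refine ⟨⟨ha, le_trans (Nat.le_mul_of_pos_right _ hb) h2⟩, hb, ?_⟩
    rw [Nat.le_div_iff_mul_le ha, mul_comm]; exact h2
  · rintro ⟨a, b⟩ h
    simp only [mem_sigma, mem_Ioc, Nat.mem_divisorsAntidiagonal] at h ⊢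
    obtain ⟨⟨h1, h2⟩, h3, h4⟩ := h
    rw [Nat.le_div_iff_mul_le h1, mul_comm] at h4
    have := Nat.mul_pos h1 h3
    exact ⟨⟨this, h4⟩, trivial, this.ne'⟩
  · rintro ⟨n, a, b⟩ h
    simp only [mem_sigma, mem_Ioc, Nat.mem_divisorsAntidiagonal] at h ⊢
    obtain ⟨_, rfl, _⟩ := h
    rfl
  · rintro ⟨a, b⟩ h
    rfl
  · rintro ⟨n, a, b⟩ h
    rfl

theorem vk_selberg_id (n : ℕ) :
    ∑ p ∈ n.divisorsAntidiagonal, (μ p.1 : ℝ) * Real.log p.1 ^ 2 =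
      ∑ p ∈ n.divisorsAntidiagonal, Λ p.1 * Λ p.2 - Λ n * Real.log n := by
  set D : ArithmeticFunction ℝ → ArithmeticFunction ℝ := fun f => f.pmul ArithmeticFunction.log with hD
  have hder : ∀ f g : ArithmeticFunction ℝ, D (f * g) = D f * g + f * D g := by
    intro f g
    ext n
    simp only [hD, pmul_apply, mul_apply, ArithmeticFunction.add_apply, sum_mul, ← sum_add_distrib]
    refine sum_congr rfl ?_
    rintro ⟨a, b⟩ h
    rw [Nat.mem_divisorsAntidiagonal] at h
    obtain ⟨h1, h2⟩ := h
    simp only at h1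
    subst h1
    have ha : (a : ℝ) ≠ 0 := by rintro h; simp at h; simp [h] at h2
    have hb : (b : ℝ) ≠ 0 := by rintro h; simp at h; simp [h] at h2
    simp only [log_apply, Nat.cast_mul, Real.log_mul ha hb]
    ring
  have hμ : D (μ : ArithmeticFunction ℝ) = - (Λ * (μ : ArithmeticFunction ℝ)) := by
    have h1 : D (μ : ArithmeticFunction ℝ) * (ζ : ArithmeticFunction ℝ) = - Λ := by
      ext n
      rw [coe_mul_zeta_apply, ArithmeticFunction.neg_apply, ← sum_moebius_mul_log_eq]
      simp [hD]
    calc D (μ : ArithmeticFunction ℝ) = D (μ : ArithmeticFunction ℝ) * ((ζ : ArithmeticFunction ℝ) * (μ : ArithmeticFunction ℝ)) := by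
            rw [coe_zeta_mul_coe_moebius, mul_one]
      _ = _ := by rw [← mul_assoc, h1]; ring
  have h2 : D (D (μ : ArithmeticFunction ℝ)) * (ζ : ArithmeticFunction ℝ) + D Λ = Λ * Λ := by
    have hneg : D (- (Λ * (μ : ArithmeticFunction ℝ))) = - D (Λ * (μ : ArithmeticFunction ℝ)) := by
      ext n; simp [hD]
    rw [hμ, hneg, hder, hμ]
    have hz : (μ : ArithmeticFunction ℝ) * (ζ : ArithmeticFunction ℝ) = 1 := coe_moebius_mul_coe_zeta
    linear_combination (Λ * Λ - D Λ) * hz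
  have h3 := congrArg (fun f : ArithmeticFunction ℝ => f n) h2
  simp only [ArithmeticFunction.add_apply, mul_apply] at h3
  simp only [hD, pmul_apply, log_apply] at h3
  rw [← h3, add_sub_cancel_right]
  refine sum_congr rfl ?_
  rintro ⟨a, b⟩ h
  rw [Nat.mem_divisorsAntidiagonal] at h
  have hb : b ≠ 0 := by rintro rfl; simp at h; omega
  simp [natCoe_apply, zeta_apply, hb]
  ring

noncomputable def vkTheta (c : ℝ) (n : ℕ) : ℝ :=
  ∑ p ∈ n.divisorsAntidiagonal, (μ p.1 : ℝ) * (c - Real.log p.1) ^ 2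

theorem vkTheta_eq (c : ℝ) (n : ℕ) : vkTheta c n =
    (if n = 1 then c ^ 2 else 0) + Λ n * (2 * c - Real.log n) +
      ∑ p ∈ n.divisorsAntidiagonal, Λ p.1 * Λ p.2 := by
  have h0 : ∑ p ∈ n.divisorsAntidiagonal, (μ p.1 : ℝ) = if n = 1 then 1 else 0 := by
    rw [Nat.sum_divisorsAntidiagonal (fun a _ => (μ a : ℝ))]
    have := congrArg (fun f : ArithmeticFunction ℝ => f n) (coe_moebius_mul_coe_zeta (R := ℝ))
    simp only [coe_mul_zeta_apply, one_apply] at this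
    simpa using this
  have h1 : ∑ p ∈ n.divisorsAntidiagonal, (μ p.1 : ℝ) * Real.log p.1 = - Λ n := by
    rw [Nat.sum_divisorsAntidiagonal (fun a _ => (μ a : ℝ) * Real.log a)]
    rw [← sum_moebius_mul_log_eq]; rfl
  have h2 := vk_selberg_id n
  have : vkTheta c n = c ^ 2 * ∑ p ∈ n.divisorsAntidiagonal, (μ p.1 : ℝ)
      - 2 * c * ∑ p ∈ n.divisorsAntidiagonal, (μ p.1 : ℝ) * Real.log p.1
      + ∑ p ∈ n.divisorsAntidiagonal, (μ p.1 : ℝ) * Real.log p.1 ^ 2 := by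
    simp only [vkTheta, mul_sum, ← sum_sub_distrib, ← sum_add_distrib]
    exact sum_congr rfl fun _ _ => by ring
  rw [this, h0, h1, h2]
  split_ifs <;> ring

theorem vkTheta_ge (c : ℝ) (n : ℕ) (hc : Real.log n ≤ c) : Λ n * c ≤ vkTheta c n := by
  rw [vkTheta_eq c n]
  have h1 : 0 ≤ ∑ p ∈ n.divisorsAntidiagonal, Λ p.1 * Λ p.2 :=
    sum_nonneg fun _ _ => mul_nonneg vonMangoldt_nonneg vonMangoldt_nonneg
  have h2 : (0 : ℝ) ≤ if n = 1 then c ^ 2 else 0 := by split_ifs <;> positivity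
  have h3 : Λ n * c ≤ Λ n * (2 * c - Real.log n) :=
    mul_le_mul_of_nonneg_left (by linarith) vonMangoldt_nonneg
  linarith
end PartA

section PartA2
open ArithmeticFunction
open scoped ArithmeticFunction.Moebius ArithmeticFunction.zeta

theorem vk_psi (N : ℕ) : ∑ n ∈ Ioc 0 N, Λ n ≤ 6 * N := by
  have h := Chebyshev.psi_le_const_mul_self (x := N) (by positivity)
  rw [Chebyshev.psi, Nat.floor_natCast] at h
  have h4 : Real.log 4 ≤ 2 := by
    rw [show (4 : ℝ) = 2 ^ 2 by norm_num, Real.log_pow]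
    have := Real.log_two_lt_d9
    push_cast; linarith
  have : (0 : ℝ) ≤ N := by positivity
  nlinarith

theorem vk_harm (N : ℕ) (hN : 1 ≤ N) : ∑ n ∈ Ioc 0 N, (1 : ℝ) / n ≤ 1 + Real.log N := by
  have h := harmonic_le_one_add_log N
  rw [harmonic_eq_sum_Icc] at h
  push_cast at h
  simpa [one_div, ← Icc_add_one_left_eq_Ioc] using h

theorem vk_mertens (N : ℕ) (hN : 1 ≤ N) : ∑ n ∈ Ioc 0 N, Λ n / n ≤ Real.log N + 6 := by
  have hN0 : (0 : ℝ) < N := by exact_mod_cast hN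
  have h1 : ∑ d ∈ Ioc 0 N, Λ d * ((N / d : ℕ) : ℝ) = ∑ n ∈ Ioc 0 N, Real.log n := by
    have := vk_swap (fun d _ => Λ d) N
    simp only [sum_const, Nat.card_Ioc, nsmul_eq_mul, tsub_zero] at this
    rw [sum_congr rfl (fun d _ => mul_comm _ _), ← this]
    refine sum_congr rfl fun n hn => ?_
    rw [Nat.sum_divisorsAntidiagonal (fun a _ => Λ a), vonMangoldt_sum]
  have h2 : ∑ n ∈ Ioc 0 N, Real.log n ≤ N * Real.log N := by
    calc _ ≤ ∑ n ∈ Ioc 0 N, Real.log N := by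
          refine sum_le_sum fun n hn => ?_
          rw [mem_Ioc] at hn
          exact Real.log_le_log (by exact_mod_cast hn.1) (by exact_mod_cast hn.2)
      _ = _ := by simp
  have h3 : N * ∑ n ∈ Ioc 0 N, Λ n / n ≤ ∑ d ∈ Ioc 0 N, Λ d * ((N / d : ℕ) : ℝ) + ∑ d ∈ Ioc 0 N, Λ d := by
    rw [mul_sum, ← sum_add_distrib]
    refine sum_le_sum fun n hn => ?_
    rw [mem_Ioc] at hn
    have : (N : ℝ) / n ≤ ((N / n : ℕ) : ℝ) + 1 := by
      rw [← Nat.floor_div_eq_div (K := ℝ)]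
      exact (Nat.lt_floor_add_one _).le
    calc (N : ℝ) * (Λ n / n) = Λ n * (N / n) := by ring
      _ ≤ Λ n * (((N / n : ℕ) : ℝ) + 1) := mul_le_mul_of_nonneg_left this vonMangoldt_nonneg
      _ = _ := by ring
  have h4 := vk_psi N
  have : N * ∑ n ∈ Ioc 0 N, Λ n / n ≤ N * (Real.log N + 6) := by linarith
  exact le_of_mul_le_mul_left this hN0

theorem vk_logsq {u : ℝ} (hu : 1 ≤ u) : Real.log u ^ 2 ≤ 16 * Real.sqrt u := by
  have h1 := Real.log_le_rpow_div (x := u) (ε := 1/4) (by linarith) (by norm_num)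
  have h0 := Real.log_nonneg hu
  have h2 : (u ^ (1/4 : ℝ)) ^ 2 = Real.sqrt u := by
    rw [Real.sqrt_eq_rpow, ← Real.rpow_natCast, ← Real.rpow_mul (by linarith)]; norm_num
  calc Real.log u ^ 2 ≤ (u ^ (1/4 : ℝ) / (1/4)) ^ 2 := by gcongr
    _ = 16 * (u ^ (1/4 : ℝ)) ^ 2 := by ring
    _ = _ := by rw [h2]

theorem vk_sum_inv_sqrt (N : ℕ) : ∑ d ∈ Ioc 0 N, 1 / Real.sqrt d ≤ 2 * Real.sqrt N := by
  induction N with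
  | zero => simp
  | succ n ih =>
    rw [sum_Ioc_succ_top (by omega)]
    have h1 : 0 < Real.sqrt ((n + 1 : ℕ) : ℝ) := Real.sqrt_pos.mpr (by positivity)
    have h2 := Real.sqrt_nonneg (n : ℝ)
    have e1 : Real.sqrt ((n + 1 : ℕ) : ℝ) ^ 2 = n + 1 := by
      rw [Real.sq_sqrt (by positivity)]; push_cast; ring
    have e2 : Real.sqrt (n : ℝ) ^ 2 = n := Real.sq_sqrt (by positivity)
    set a := Real.sqrt ((n + 1 : ℕ) : ℝ)
    set b := Real.sqrt (n : ℝ)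
    have : 1 / a ≤ 2 * a - 2 * b := by
      rw [div_le_iff₀ h1]
      nlinarith [sq_nonneg (a - b)]
    linarith

theorem vk_sum_logsq {t : ℝ} (ht : 1 ≤ t) :
    ∑ d ∈ Ioc 0 ⌊t⌋₊, Real.log (t / d) ^ 2 ≤ 32 * t := by
  have hN : (⌊t⌋₊ : ℝ) ≤ t := Nat.floor_le (by linarith)
  calc _ ≤ ∑ d ∈ Ioc 0 ⌊t⌋₊, 16 * Real.sqrt t * (1 / Real.sqrt d) := by
        refine sum_le_sum fun d hd => ?_
        rw [mem_Ioc] at hd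
        have hd0 : (0 : ℝ) < d := by exact_mod_cast hd.1
        have hdt : (d : ℝ) ≤ t := le_trans (by exact_mod_cast hd.2) hN
        have h1 : 1 ≤ t / d := by rw [le_div_iff₀ hd0]; linarith
        have := vk_logsq h1
        rw [Real.sqrt_div (by linarith)] at this
        calc _ ≤ _ := this
          _ = _ := by ring
    _ ≤ 16 * Real.sqrt t * (2 * Real.sqrt t) := by
        rw [← mul_sum]
        gcongr
        exact (vk_sum_inv_sqrt _).trans (by gcongr)
    _ = 32 * t := by
        have := Real.mul_self_sqrt (show 0 ≤ t by linarith)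
        linear_combination 32 * this

noncomputable def vkM2 (t : ℝ) : ℝ := ∑ d ∈ Ioc 0 ⌊t⌋₊, (μ d : ℝ) / d * Real.log (t / d) ^ 2

theorem vk_abs_moebius (d : ℕ) : |(μ d : ℝ)| ≤ 1 := by
  have := abs_moebius_le_one (n := d)
  exact_mod_cast this

theorem vk_M2 {t : ℝ} (ht : 1 ≤ t) : |vkM2 t| ≤ 84 * (1 + Real.log t) := by
  have ht0 : 0 < t := by linarith
  set N := ⌊t⌋₊ with hNdef
  have hN : (N : ℝ) ≤ t := Nat.floor_le (by linarith)
  have hN1 : 1 ≤ N := by rw [hNdef, Nat.one_le_floor_iff]; exact ht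
  set c := Real.log t with hc
  have hc0 : 0 ≤ c := Real.log_nonneg ht
  have hlogN : Real.log N ≤ c := Real.log_le_log (by exact_mod_cast hN1) hN
  have hsum : ∑ n ∈ Ioc 0 N, vkTheta c n = ∑ d ∈ Ioc 0 N, (μ d : ℝ) * Real.log (t / d) ^ 2 * ((N / d : ℕ) : ℝ) := by
    simp only [vkTheta]
    rw [vk_swap (fun d _ => (μ d : ℝ) * (c - Real.log d) ^ 2)]
    refine sum_congr rfl fun d hd => ?_
    rw [mem_Ioc] at hd
    have hd0 : (d : ℝ) ≠ 0 := by have := hd.1; positivity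
    rw [Real.log_div ht0.ne' hd0, ← hc, sum_const, Nat.card_Ioc, nsmul_eq_mul, tsub_zero, mul_comm]
  have hlow : 0 ≤ ∑ n ∈ Ioc 0 N, vkTheta c n := by
    refine sum_nonneg fun n hn => ?_
    rw [mem_Ioc] at hn
    refine le_trans ?_ (vkTheta_ge c n ?_)
    · exact mul_nonneg vonMangoldt_nonneg hc0
    · exact (Real.log_le_log (by exact_mod_cast hn.1) (by exact_mod_cast hn.2)).trans hlogN
  have hup : ∑ n ∈ Ioc 0 N, vkTheta c n ≤ c ^ 2 + 12 * c * t + 6 * t * (c + 6) := by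
    have e1 : ∑ n ∈ Ioc 0 N, (if n = 1 then c ^ 2 else 0) ≤ c ^ 2 := by
      rw [sum_ite_eq']; split_ifs
      · exact le_rfl
      · positivity
    have e2 : ∑ n ∈ Ioc 0 N, Λ n * (2 * c - Real.log n) ≤ 12 * c * t := by
      calc _ ≤ ∑ n ∈ Ioc 0 N, Λ n * (2 * c) := by
            refine sum_le_sum fun n hn => mul_le_mul_of_nonneg_left ?_ vonMangoldt_nonneg
            have := Real.log_natCast_nonneg n
            linarith
        _ = (∑ n ∈ Ioc 0 N, Λ n) * (2 * c) := by rw [sum_mul]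
        _ ≤ (6 * t) * (2 * c) := by
            gcongr
            exact (vk_psi N).trans (by gcongr)
        _ = _ := by ring
    have e3 : ∑ n ∈ Ioc 0 N, ∑ p ∈ n.divisorsAntidiagonal, Λ p.1 * Λ p.2 ≤ 6 * t * (c + 6) := by
      rw [vk_swap (fun a b => Λ a * Λ b)]
      calc _ ≤ ∑ d ∈ Ioc 0 N, 6 * t * (Λ d / d) := by
            refine sum_le_sum fun d hd => ?_
            rw [mem_Ioc] at hd
            have hd0 : (0 : ℝ) < d := by exact_mod_cast hd.1
            rw [← mul_sum]
            calc Λ d * ∑ i ∈ Ioc 0 (N / d), Λ i ≤ Λ d * (6 * (t / d)) := by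
                  refine mul_le_mul_of_nonneg_left ((vk_psi _).trans ?_) vonMangoldt_nonneg
                  gcongr
                  exact (Nat.cast_div_le).trans (by gcongr)
              _ = _ := by ring
        _ ≤ _ := by
            rw [← mul_sum]
            gcongr
            exact (vk_mertens N hN1).trans (by linarith)
    simp only [vkTheta_eq, sum_add_distrib]
    linarith
  have hdiff : |∑ n ∈ Ioc 0 N, vkTheta c n - t * vkM2 t| ≤ 32 * t := by
    rw [hsum, vkM2, mul_sum, ← sum_sub_distrib]
    refine (Finset.abs_sum_le_sum_abs _ _).trans ((sum_le_sum ?_).trans (vk_sum_logsq ht))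
    intro d hd
    rw [mem_Ioc] at hd
    have hd0 : (0 : ℝ) < d := by exact_mod_cast hd.1
    have hfl : ((N / d : ℕ) : ℝ) = (⌊t / d⌋₊ : ℝ) := by rw [Nat.floor_div_natCast]
    have h1 : |((N / d : ℕ) : ℝ) - t / d| ≤ 1 := by
      rw [hfl, abs_le]
      have a1 := Nat.floor_le (show 0 ≤ t / d by positivity)
      have a2 := Nat.lt_floor_add_one (t / d)
      constructor <;> linarith
    have : (μ d : ℝ) * Real.log (t / d) ^ 2 * ((N / d : ℕ) : ℝ) - t * ((μ d : ℝ) / d * Real.log (t / d) ^ 2)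
        = (μ d : ℝ) * Real.log (t / d) ^ 2 * (((N / d : ℕ) : ℝ) - t / d) := by ring
    rw [this, abs_mul, abs_mul, abs_of_nonneg (sq_nonneg (Real.log (t / d)))]
    calc _ ≤ 1 * Real.log (t / d) ^ 2 * 1 := by
          gcongr
          exact vk_abs_moebius d
      _ = _ := by ring
  have hc2 : c ^ 2 ≤ 16 * t := by
    refine (vk_logsq ht).trans ?_
    gcongr
    rw [Real.sqrt_le_left (by linarith)]
    nlinarith
  have key : |t * vkM2 t| ≤ t * (84 * (1 + c)) := by
    rw [abs_le] at hdiff ⊢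
    constructor
    · nlinarith
    · nlinarith
  rw [abs_mul, abs_of_pos ht0] at key
  exact le_of_mul_le_mul_left key ht0
end PartA2

section PartA3
open ArithmeticFunction
open scoped ArithmeticFunction.Moebius ArithmeticFunction.zeta

noncomputable def vkMS (S : Finset ℕ) (t : ℝ) : ℝ :=
  ∑ d ∈ (Ioc 0 ⌊t⌋₊).filter (fun d => ∀ p ∈ S, ¬ p ∣ d), (μ d : ℝ) / d * Real.log (t / d) ^ 2

theorem vkMS_small (S : Finset ℕ) {t : ℝ} (ht : t < 1) : vkMS S t = 0 := by
  rw [vkMS, Nat.floor_eq_zero.mpr ht]; simp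

theorem vk_moebius_mul {p e : ℕ} (hp : p.Prime) : μ (p * e) = if p ∣ e then 0 else - μ e := by
  split_ifs with h
  · obtain ⟨f, rfl⟩ := h
    apply moebius_eq_zero_of_not_squarefree
    intro hs
    have := hs p ⟨f, by ring⟩
    exact hp.one_lt.ne' (Nat.isUnit_iff.mp this)
  · rw [isMultiplicative_moebius.map_mul_of_coprime ((Nat.Prime.coprime_iff_not_dvd hp).mpr h), moebius_apply_prime hp]
    ring

theorem vkMS_rec (S : Finset ℕ) (hS : ∀ r ∈ S, r.Prime) {p : ℕ} (hp : p.Prime) (hpS : p ∉ S) (t : ℝ) :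
    vkMS S t = vkMS (insert p S) t - (p : ℝ)⁻¹ * vkMS (insert p S) (t / p) := by
  have hp0 : (0 : ℝ) < p := by exact_mod_cast hp.pos
  have h1 : vkMS S t = vkMS (insert p S) t +
      ∑ d ∈ ((Ioc 0 ⌊t⌋₊).filter (fun d => ∀ p ∈ S, ¬ p ∣ d)).filter (fun d => p ∣ d), (μ d : ℝ) / d * Real.log (t / d) ^ 2 := by
    rw [vkMS, ← sum_filter_not_add_sum_filter _ (fun d => p ∣ d), vkMS]
    congr 1
    refine sum_congr ?_ fun _ _ => rfl
    ext d
    simp only [mem_filter, Finset.forall_mem_insert]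
    tauto
  rw [h1, sub_eq_add_neg]
  congr 1
  set f : ℕ → ℝ := fun d => (μ d : ℝ) / d * Real.log (t / d) ^ 2 with hf
  have h2 : ((Ioc 0 ⌊t⌋₊).filter (fun d => ∀ p ∈ S, ¬ p ∣ d)).filter (fun d => p ∣ d)
      = ((Ioc 0 ⌊t / p⌋₊).filter (fun d => ∀ p ∈ S, ¬ p ∣ d)).image (fun e => p * e) := by
    ext d
    simp only [mem_filter, mem_image, mem_Ioc]
    rw [Nat.floor_div_natCast]
    have key : ∀ e, (∀ r ∈ S, ¬ r ∣ p * e) ↔ ∀ r ∈ S, ¬ r ∣ e := by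
      intro e
      refine forall₂_congr fun r hr => ?_
      rw [(hS r hr).dvd_mul, Nat.prime_dvd_prime_iff_eq (hS r hr) hp]
      have : r ≠ p := by rintro rfl; exact hpS hr
      tauto
    constructor
    · rintro ⟨⟨⟨h1, h2⟩, h3⟩, e, rfl⟩
      refine ⟨e, ⟨⟨Nat.pos_of_mul_pos_left h1 , ?_⟩, (key e).mp h3⟩, rfl⟩
      rw [Nat.le_div_iff_mul_le hp.pos, mul_comm]; exact h2
    · rintro ⟨e, ⟨⟨h1, h2⟩, h3⟩, rfl⟩
      rw [Nat.le_div_iff_mul_le hp.pos, mul_comm] at h2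
      exact ⟨⟨⟨Nat.mul_pos hp.pos h1, h2⟩, (key e).mpr h3⟩, dvd_mul_right _ _⟩
  rw [h2, sum_image (by intro a _ b _ h; exact Nat.eq_of_mul_eq_mul_left hp.pos h), vkMS, mul_sum, ← sum_neg_distrib]
  have h3 : ((Ioc 0 ⌊t / p⌋₊).filter (fun d => ∀ r ∈ insert p S, ¬ r ∣ d))
     = ((Ioc 0 ⌊t / p⌋₊).filter (fun d => ∀ p ∈ S, ¬ p ∣ d)).filter (fun d => ¬ p ∣ d) := by
    ext d; simp only [mem_filter, Finset.forall_mem_insert]; tauto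
  rw [h3, sum_filter (fun d => ¬ p ∣ d)]
  refine sum_congr rfl fun e he => ?_
  have he0 : (0 : ℝ) < e := by
    simp only [mem_filter, mem_Ioc] at he
    exact_mod_cast he.1.1
  rw [vk_moebius_mul hp]
  have : t / ((p * e : ℕ) : ℝ) = t / p / e := by push_cast; rw [div_div]
  rw [this]
  split_ifs with h
  · simp
  · push_cast; field_simp

theorem vkMS_bound (S : Finset ℕ) (hS : ∀ r ∈ S, r.Prime) {T : ℝ} (hT : 1 ≤ T) :
    ∀ t : ℝ, t ≤ T → |vkMS S t| ≤ 84 * (1 + Real.log T) * ∏ p ∈ S, (1 - (p : ℝ)⁻¹)⁻¹ := by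
  have hlT := Real.log_nonneg hT
  induction S using Finset.induction_on with
  | empty =>
    intro t ht
    rcases lt_or_ge t 1 with h | h
    · rw [vkMS_small _ h]; simp; positivity
    · have := vk_M2 h
      have e : vkMS ∅ t = vkM2 t := by simp [vkMS, vkM2]
      rw [e]
      refine this.trans ?_
      simp only [Finset.prod_empty, mul_one]
      gcongr
  | insert p S hpS ih =>
    have hp : p.Prime := hS p (by simp)
    have hS' : ∀ r ∈ S, r.Prime := fun r hr => hS r (by simp [hr])
    have ih := ih hS'
    set K := 84 * (1 + Real.log T) * ∏ p ∈ S, (1 - (p : ℝ)⁻¹)⁻¹ with hK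
    have hp2 : (2 : ℝ) ≤ p := by exact_mod_cast hp.two_le
    have hpi : (p : ℝ)⁻¹ ≤ 1 / 2 := by rw [inv_le_comm₀ (by linarith) (by norm_num)]; rw [one_div, inv_inv]; exact hp2
    have hpi0 : 0 < (p : ℝ)⁻¹ := by positivity
    rw [Finset.prod_insert hpS]
    have hK' : 84 * (1 + Real.log T) * ((1 - (p : ℝ)⁻¹)⁻¹ * ∏ p ∈ S, (1 - (p : ℝ)⁻¹)⁻¹) = K * (1 - (p : ℝ)⁻¹)⁻¹ := by
      rw [hK]; ring
    rw [hK']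
    have hK0 : 0 ≤ K := le_trans (abs_nonneg _) (ih 0 (by linarith))
    have main : ∀ n : ℕ, ∀ t : ℝ, ⌊t⌋₊ = n → t ≤ T → |vkMS (insert p S) t| ≤ K * (1 - (p : ℝ)⁻¹)⁻¹ := by
      intro n
      induction n using Nat.strong_induction_on with
      | _ n ihn =>
        intro t htn ht
        rcases lt_or_ge t 1 with h | h
        · rw [vkMS_small _ h, abs_zero]
          have : 0 ≤ (1 - (p : ℝ)⁻¹)⁻¹ := inv_nonneg.mpr (by linarith)
          positivity
        · have hr := vkMS_rec S hS' hp hpS t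
          have h1 := ih t ht
          have hfl : ⌊t / p⌋₊ < n := by
            rw [Nat.floor_div_natCast, htn]
            refine Nat.div_lt_self ?_ hp.one_lt
            rw [← htn, Nat.floor_pos]; exact h
          have h2 := ihn _ hfl (t / p) rfl (le_trans (div_le_self (by linarith) (by linarith)) ht)
          have h3 : vkMS (insert p S) t = vkMS S t + (p : ℝ)⁻¹ * vkMS (insert p S) (t / p) := by linarith
          rw [h3]
          refine (abs_add_le _ _).trans ?_
          rw [abs_mul, abs_of_pos hpi0]
          have hne : (1 - (p : ℝ)⁻¹) ≠ 0 := by linarith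
          have e : K * (1 - (p : ℝ)⁻¹)⁻¹ = K + (p : ℝ)⁻¹ * (K * (1 - (p : ℝ)⁻¹)⁻¹) := by
            have : (1 - (p : ℝ)⁻¹) * (1 - (p : ℝ)⁻¹)⁻¹ = 1 := mul_inv_cancel₀ hne
            linear_combination K * this
          rw [e]
          gcongr
    intro t ht
    exact main _ t rfl ht

noncomputable def vkH (q : ℕ) : ℝ := ∏ p ∈ q.primeFactors, (1 - (p : ℝ)⁻¹)⁻¹

theorem vk_prod_card (S : Finset ℕ) (hS : ∀ r ∈ S, 2 ≤ r) : ∏ p ∈ S, (1 - (p : ℝ)⁻¹)⁻¹ ≤ S.card + 1 := by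
  induction S using Finset.induction_on_max with
  | empty => simp
  | insert a s hlt ih =>
    have ha : a ∉ s := fun h => lt_irrefl _ (hlt a h)
    have ih := ih (fun r hr => hS r (by simp [hr]))
    rw [Finset.prod_insert ha, card_insert_of_notMem ha]
    have ha2 : 2 ≤ a := hS a (by simp)
    have hc : s.card + 2 ≤ a := by
      have : s ⊆ Finset.Ico 2 a := by
        intro r hr
        rw [mem_Ico]
        exact ⟨hS r (by simp [hr]), hlt r hr⟩
      have := card_le_card this
      rw [Nat.card_Ico] at this
      omega
    have hc' : (s.card : ℝ) + 2 ≤ a := by exact_mod_cast hc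
    have hc0 : (0 : ℝ) ≤ s.card := by positivity
    have e : (1 - (a : ℝ)⁻¹)⁻¹ = 1 + 1 / (a - 1) := by
      have : (a : ℝ) - 1 ≠ 0 := by linarith
      have : (a : ℝ) ≠ 0 := by linarith
      field_simp
      ring
    have e2 : (1 : ℝ) / (a - 1) ≤ 1 / (s.card + 1) := one_div_le_one_div_of_le (by linarith) (by linarith)
    rw [e]
    calc _ ≤ (1 + 1 / ((s.card : ℝ) + 1)) * (s.card + 1) := by
          have : (0 : ℝ) ≤ 1 / (a - 1) := by apply one_div_nonneg.mpr; linarith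
          have h0 : 0 ≤ ∏ p ∈ s, (1 - (p : ℝ)⁻¹)⁻¹ := Finset.prod_nonneg fun p hp => by
            apply inv_nonneg.mpr
            have : (1 : ℝ) ≤ p := by exact_mod_cast (by have := hS p (by simp [hp]); omega : 1 ≤ p)
            have := inv_le_one_of_one_le₀ this
            linarith
          gcongr
      _ = _ := by push_cast; field_simp

theorem vkH_one_le (q : ℕ) : 1 ≤ vkH q := by
  rw [vkH]
  have hh : ∏ p ∈ q.primeFactors, (1 : ℝ) ≤ ∏ p ∈ q.primeFactors, (1 - (p : ℝ)⁻¹)⁻¹ := by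
   refine Finset.prod_le_prod (fun _ _ => zero_le_one) ?_
   intro p hp
   have hp2 : (2 : ℝ) ≤ p := by exact_mod_cast (Nat.prime_of_mem_primeFactors hp).two_le
   have h1 : (p : ℝ)⁻¹ ≤ 1 / 2 := by rw [inv_le_comm₀ (by linarith) (by norm_num)]; rw [one_div, inv_inv]; exact hp2
   have h2 : 0 < (p : ℝ)⁻¹ := by positivity
   rw [one_le_inv₀ (by linarith)]; linarith
  simpa using hh

theorem vkH_le {q : ℕ} (hq : q ≠ 0) : vkH q ≤ 1 + 2 * Real.log q := by
  have h1 := vk_prod_card q.primeFactors (fun r hr => (Nat.prime_of_mem_primeFactors hr).two_le)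
  have h2 : 2 ^ q.primeFactors.card ≤ q := by
    calc 2 ^ q.primeFactors.card ≤ ∏ p ∈ q.primeFactors, p :=
          Finset.pow_card_le_prod _ _ _ (fun r hr => (Nat.prime_of_mem_primeFactors hr).two_le)
      _ ≤ q := Nat.le_of_dvd (Nat.pos_of_ne_zero hq) (Nat.prod_primeFactors_dvd q)
  have h3 : (2 : ℝ) ^ q.primeFactors.card ≤ q := by exact_mod_cast h2
  have h4 := Real.log_le_log (by positivity) h3
  rw [Real.log_pow] at h4
  have := Real.log_two_gt_d9
  have : (0 : ℝ) ≤ q.primeFactors.card := by positivity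
  rw [vkH]
  nlinarith

noncomputable def vkMq (q : ℕ) (t : ℝ) : ℝ :=
  ∑ d ∈ (Ioc 0 ⌊t⌋₊).filter (fun d => d.Coprime q), (μ d : ℝ) / d * Real.log (t / d) ^ 2

theorem vk_coprime_iff {q : ℕ} (hq : q ≠ 0) (d : ℕ) : d.Coprime q ↔ ∀ p ∈ q.primeFactors, ¬ p ∣ d := by
  constructor
  · intro h p hp hpd
    have := Nat.dvd_gcd hpd (Nat.dvd_of_mem_primeFactors hp)
    rw [h] at this
    exact (Nat.prime_of_mem_primeFactors hp).one_lt.ne' (Nat.dvd_one.mp this)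
  · intro h
    apply Nat.Coprime.symm
    apply Nat.coprime_of_dvd
    intro p hp hpq hpd
    exact h p (Nat.mem_primeFactors.mpr ⟨hp, hpq, hq⟩) hpd

theorem vkMq_bound {q : ℕ} (hq : q ≠ 0) {T t : ℝ} (hT : 1 ≤ T) (ht : t ≤ T) :
    |vkMq q t| ≤ 84 * (1 + Real.log T) * vkH q := by
  have := vkMS_bound q.primeFactors (fun r hr => Nat.prime_of_mem_primeFactors hr) hT t ht
  have e : vkMq q t = vkMS q.primeFactors t := by
    simp only [vkMq, vkMS, vk_coprime_iff hq]
  rw [e]; exact this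
end PartA3

section PartA4
open ArithmeticFunction
open scoped ArithmeticFunction.Moebius ArithmeticFunction.zeta

theorem vk_harm_tail {D y : ℕ} (hD : 1 ≤ D) (hy : D ≤ y) :
    ∑ d ∈ Ioc D y, (1 : ℝ) / d ≤ Real.log (y / D) := by
  induction y, hy using Nat.le_induction with
  | base => simp
  | succ n hn ih =>
    rw [sum_Ioc_succ_top (by omega)]
    have hn0 : (0 : ℝ) < n := by exact_mod_cast (by omega : 0 < n)
    have hD0 : (0 : ℝ) < D := by exact_mod_cast (by omega : 0 < D)
    have h1 := Real.one_sub_inv_le_log_of_pos (x := ((n + 1 : ℕ) : ℝ) / n) (by positivity)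
    have h2 : Real.log (((n + 1 : ℕ) : ℝ) / D) = Real.log (n / D) + Real.log (((n + 1 : ℕ) : ℝ) / n) := by
      rw [← Real.log_mul (by positivity) (by positivity)]; congr 1; field_simp
    have h3 : 1 - (((n + 1 : ℕ) : ℝ) / n)⁻¹ = 1 / ((n + 1 : ℕ) : ℝ) := by
      push_cast; field_simp; ring
    rw [h2]; linarith

def vkN (u y q b d : ℕ) : ℕ := ((Ioc 0 (y / d)).filter (fun m => u < d * m ∧ d * m ≡ b [MOD q])).card

theorem vkN_filter (u y q b : ℕ) {d : ℕ} (hd : 0 < d) :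
    (Ioc 0 (y / d)).filter (fun m => u < d * m ∧ d * m ≡ b [MOD q])
      = (Ioc (u / d) (y / d)).filter (fun m => d * m ≡ b [MOD q]) := by
  ext m
  simp only [mem_filter, mem_Ioc, Nat.div_lt_iff_lt_mul hd, mul_comm m d]
  constructor
  · rintro ⟨⟨h1, h2⟩, h3, h4⟩; exact ⟨⟨h3, h2⟩, h4⟩
  · rintro ⟨⟨h1, h2⟩, h3⟩
    exact ⟨⟨Nat.pos_of_ne_zero (by rintro rfl; simp at h1), h2⟩, h1, h3⟩

theorem vk_card_modEq (a b q v : ℕ) (hq : 0 < q) (hab : a ≤ b) :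
    |(((Ioc a b).filter (fun m => m ≡ v [MOD q])).card : ℝ) - (b - a) / q| ≤ 1 := by
  have h := Nat.Ioc_filter_modEq_card a b hq v
  have hq0 : (0 : ℝ) < q := by exact_mod_cast hq
  have h1 : ⌊((a : ℚ) - v) / q⌋ ≤ ⌊((b : ℚ) - v) / q⌋ := by
    apply Int.floor_le_floor
    gcongr
  rw [max_eq_left (by linarith)] at h
  have h2 : (((Ioc a b).filter (fun m => m ≡ v [MOD q])).card : ℝ) =
     (⌊((b : ℚ) - v) / q⌋ : ℝ) - (⌊((a : ℚ) - v) / q⌋ : ℝ) := by exact_mod_cast h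
  rw [h2]
  have a1 := Int.floor_le (((a : ℚ) - v) / q)
  have a2 := Int.lt_floor_add_one (((a : ℚ) - v) / q)
  have b1 := Int.floor_le (((b : ℚ) - v) / q)
  have b2 := Int.lt_floor_add_one (((b : ℚ) - v) / q)
  set A := ⌊((a : ℚ) - v) / q⌋
  set B := ⌊((b : ℚ) - v) / q⌋
  have a1' : (A : ℝ) ≤ ((a : ℝ) - v) / q := by exact_mod_cast a1
  have a2' : ((a : ℝ) - v) / q < A + 1 := by exact_mod_cast a2
  have b1' : (B : ℝ) ≤ ((b : ℝ) - v) / q := by exact_mod_cast b1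
  have b2' : ((b : ℝ) - v) / q < B + 1 := by exact_mod_cast b2
  have e : ((b : ℝ) - a) / q = ((b : ℝ) - v) / q - ((a : ℝ) - v) / q := by ring
  rw [e, abs_le]
  constructor <;> linarith

theorem vkN_approx {u y q b d : ℕ} (hd : 0 < d) (hq : 0 < q) (huy : u ≤ y) (hdq : d.Coprime q) :
    |(vkN u y q b d : ℝ) - (y - u) / (d * q)| ≤ 2 := by
  have hq0 : (1 : ℝ) ≤ q := by exact_mod_cast hq
  have hd0 : (0 : ℝ) < d := by exact_mod_cast hd
  obtain ⟨e, he⟩ : ∃ e, d * e ≡ 1 [MOD q] := by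
    rcases (by omega : q = 1 ∨ 1 < q) with rfl | h
    · exact ⟨1, Nat.modEq_one⟩
    · obtain ⟨e, -, he⟩ := Nat.exists_mul_mod_eq_one_of_coprime hdq h
      exact ⟨e, by rw [Nat.ModEq, he, Nat.mod_eq_of_lt h]⟩
  have hiff : ∀ m, d * m ≡ b [MOD q] ↔ m ≡ e * b [MOD q] := by
    intro m
    constructor
    · intro h
      have h1 : e * (d * m) ≡ e * b [MOD q] := h.mul_left e
      have h2 : e * (d * m) ≡ 1 * m [MOD q] := by
        rw [← mul_assoc, mul_comm e d]; exact he.mul_right m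
      rw [one_mul] at h2
      exact h2.symm.trans h1
    · intro h
      have h1 : d * m ≡ d * (e * b) [MOD q] := h.mul_left d
      have h2 : d * (e * b) ≡ 1 * b [MOD q] := by
        rw [← mul_assoc]; exact he.mul_right b
      rw [one_mul] at h2
      exact h1.trans h2
  have h1 : (vkN u y q b d : ℝ) = (((Ioc (u / d) (y / d)).filter (fun m => m ≡ e * b [MOD q])).card : ℝ) := by
    rw [vkN, vkN_filter _ _ _ _ hd]; simp only [hiff]
  have h2 := vk_card_modEq (u / d) (y / d) q (e * b) hq (Nat.div_le_div_right huy)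
  rw [h1]
  have e1 : ((u / d : ℕ) : ℝ) = (⌊(u : ℝ) / d⌋₊ : ℝ) := by rw [Nat.floor_div_eq_div]
  have e2 : ((y / d : ℕ) : ℝ) = (⌊(y : ℝ) / d⌋₊ : ℝ) := by rw [Nat.floor_div_eq_div]
  have a1 := Nat.floor_le (show 0 ≤ (u : ℝ) / d by positivity)
  have a2 := Nat.lt_floor_add_one ((u : ℝ) / d)
  have b1 := Nat.floor_le (show 0 ≤ (y : ℝ) / d by positivity)
  have b2 := Nat.lt_floor_add_one ((y : ℝ) / d)
  rw [← e1] at a1 a2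
  rw [← e2] at b1 b2
  have h3 : |(((y / d : ℕ) : ℝ) - ((u / d : ℕ) : ℝ)) / q - (y - u) / (d * q)| ≤ 1 := by
    have : (((y / d : ℕ) : ℝ) - ((u / d : ℕ) : ℝ)) / q - (y - u) / (d * q)
       = ((((y / d : ℕ) : ℝ) - ((u / d : ℕ) : ℝ)) - (y / d - u / d)) / q := by field_simp
    rw [this, abs_div, abs_of_pos (by linarith : (0:ℝ) < q)]
    refine div_le_one_of_le₀ (le_trans ?_ hq0) (by linarith)
    rw [abs_le]; constructor <;> linarith
  have := abs_sub_le (((Ioc (u / d) (y / d)).filter (fun m => m ≡ e * b [MOD q])).card : ℝ)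
    ((((y / d : ℕ) : ℝ) - ((u / d : ℕ) : ℝ)) / q) ((y - u) / (d * q))
  linarith

theorem vkN_eq_zero {u y q b d : ℕ} (hb : b.Coprime q) (hdq : ¬ d.Coprime q) : vkN u y q b d = 0 := by
  rw [vkN, card_eq_zero, filter_eq_empty_iff]
  rintro m _ ⟨_, h⟩
  apply hdq
  have h1 := h.gcd_eq
  have h2 : (d * m).Coprime q := by rw [Nat.Coprime, h1]; exact hb
  exact Nat.Coprime.coprime_mul_right h2

theorem vkN_swap {u y q b D : ℕ} (hD : 0 < D) :
    ∑ d ∈ Ioc D y, vkN u y q b d ≤ ∑ m ∈ Ioc 0 (y / D), vkN u y q b m := by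
  simp only [vkN]
  rw [← card_sigma, ← card_sigma]
  refine card_le_card_of_injOn (fun x => ⟨x.2, x.1⟩) ?_ ?_
  · rintro ⟨d, m⟩ h
    simp only [Finset.coe_sigma, Set.mem_sigma_iff, mem_coe, mem_Ioc, mem_filter] at h ⊢
    obtain ⟨⟨h1, h2⟩, ⟨h3, h4⟩, h5, h6⟩ := h
    rw [Nat.le_div_iff_mul_le (by omega)] at h4
    refine ⟨⟨h3, ?_⟩, ⟨by omega, ?_⟩, ?_, ?_⟩
    · rw [Nat.le_div_iff_mul_le hD]; nlinarith
    · rw [Nat.le_div_iff_mul_le h3]; linarith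
    · rwa [mul_comm]
    · rwa [mul_comm]
  · rintro ⟨d, m⟩ _ ⟨d', m'⟩ _ h
    simp only [Sigma.mk.injEq, heq_eq_eq] at h ⊢
    tauto

theorem vk_bt_raw {u y q b D : ℕ} (hD : 1 ≤ D) (hDy : D ≤ y) (huy : u ≤ y) (hq : 0 < q) (hb : b.Coprime q) :
    |∑ d ∈ Ioc 0 y, (μ d : ℝ) * Real.log (y / d) ^ 2 * vkN u y q b d| ≤
      ((y - u : ℝ) / q) * (84 * (1 + Real.log y) * vkH q + 2 * Real.log (y / D) ^ 2 * (Real.log (y / D) + 1))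
        + 2 * D * Real.log y ^ 2 + 2 * Real.log (y / D) ^ 2 * (y / D) := by
  have hy1 : 1 ≤ y := hD.trans hDy
  have hy0 : (1 : ℝ) ≤ y := by exact_mod_cast hy1
  have hD0 : (1 : ℝ) ≤ D := by exact_mod_cast hD
  have hDy0 : (D : ℝ) ≤ y := by exact_mod_cast hDy
  have hq0 : (0 : ℝ) < q := by exact_mod_cast hq
  have hu0 : (u : ℝ) ≤ y := by exact_mod_cast huy
  set c := Real.log y with hc
  set l := Real.log (y / D) with hl
  have hc0 : 0 ≤ c := Real.log_nonneg hy0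
  have hl0 : 0 ≤ l := Real.log_nonneg (by rw [le_div_iff₀ (by linarith)]; linarith)
  set g : ℕ → ℝ := fun d => (μ d : ℝ) * Real.log (y / d) ^ 2 with hg
  set X : ℝ := (y - u : ℝ) / q with hX
  have hX0 : 0 ≤ X := div_nonneg (by linarith) hq0.le
  have hgabs : ∀ d, |g d| ≤ Real.log (y / d) ^ 2 := by
    intro d
    rw [hg]; simp only
    rw [abs_mul, abs_of_nonneg (sq_nonneg (Real.log (y / d)))]
    calc _ ≤ 1 * Real.log (y / d) ^ 2 := by gcongr; exact vk_abs_moebius d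
      _ = _ := one_mul _
  have hlarge : ∀ d ∈ Ioc D y, |g d| ≤ l ^ 2 := by
    intro d hd
    rw [mem_Ioc] at hd
    have hd0 : (0 : ℝ) < d := by exact_mod_cast (by omega : 0 < d)
    have hdD : (D : ℝ) ≤ d := by exact_mod_cast hd.1.le
    have hdy : (d : ℝ) ≤ y := by exact_mod_cast hd.2
    refine (hgabs d).trans ?_
    have h1 : 0 ≤ Real.log (y / d) := Real.log_nonneg (by rw [le_div_iff₀ hd0]; linarith)
    have h2 : Real.log (y / d) ≤ l := Real.log_le_log (by positivity) (by gcongr)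
    gcongr
  have hsplit : ∀ f : ℕ → ℝ, ∑ d ∈ Ioc 0 y, f d = ∑ d ∈ Ioc 0 D, f d + ∑ d ∈ Ioc D y, f d := by
    intro f; rw [sum_Ioc_consecutive _ (by omega) hDy]
  have s1 : |∑ d ∈ Ioc 0 D, (g d * vkN u y q b d - X * (if d.Coprime q then g d / d else 0))| ≤ 2 * D * c ^ 2 := by
    calc _ ≤ ∑ d ∈ Ioc 0 D, 2 * c ^ 2 := by
          refine (Finset.abs_sum_le_sum_abs _ _).trans (sum_le_sum fun d hd => ?_)
          rw [mem_Ioc] at hd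
          have hd1 : (1 : ℝ) ≤ d := by exact_mod_cast hd.1
          have hdy : (d : ℝ) ≤ y := by exact_mod_cast hd.2.trans hDy
          by_cases hdq : d.Coprime q
          · rw [if_pos hdq]
            have h1 := vkN_approx (b := b) hd.1 hq huy hdq
            have e : g d * vkN u y q b d - X * (g d / d) = g d * (vkN u y q b d - (y - u) / (d * q)) := by
              rw [hX]; field_simp
            rw [e, abs_mul]
            have h2 : |g d| ≤ c ^ 2 := by
              refine (hgabs d).trans ?_
              have h1 : 0 ≤ Real.log (y / d) := Real.log_nonneg (by rw [le_div_iff₀ (by linarith)]; linarith)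
              have h2 : Real.log (y / d) ≤ c := Real.log_le_log (by positivity) (div_le_self (by linarith) hd1)
              gcongr
            calc _ ≤ c ^ 2 * 2 := by gcongr
              _ = _ := by ring
          · rw [if_neg hdq, vkN_eq_zero hb hdq]
            simp; positivity
      _ = _ := by simp; ring
  have s2 : |∑ d ∈ Ioc 0 y, (if d.Coprime q then g d / d else 0)| ≤ 84 * (1 + c) * vkH q := by
    have := vkMq_bound hq.ne' hy0 (le_refl (y : ℝ))
    rw [vkMq, Nat.floor_natCast, sum_filter] at this
    convert this using 4 with d
    rw [hg]; ring
  have s3 : |∑ d ∈ Ioc D y, (if d.Coprime q then g d / d else 0)| ≤ l ^ 2 * l := by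
    calc _ ≤ ∑ d ∈ Ioc D y, l ^ 2 * (1 / (d : ℝ)) := by
          refine (Finset.abs_sum_le_sum_abs _ _).trans (sum_le_sum fun d hd => ?_)
          have := hlarge d hd
          split_ifs
          · rw [abs_div, Nat.abs_cast, mul_one_div]; gcongr
          · rw [abs_zero]; positivity
      _ ≤ _ := by
          rw [← mul_sum]
          gcongr
          exact vk_harm_tail hD hDy
  have s4 : |∑ d ∈ Ioc D y, g d * vkN u y q b d| ≤ l ^ 2 * (X * (1 + l) + 2 * (y / D)) := by
    calc _ ≤ ∑ d ∈ Ioc D y, l ^ 2 * (vkN u y q b d : ℝ) := by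
          refine (Finset.abs_sum_le_sum_abs _ _).trans (sum_le_sum fun d hd => ?_)
          have := hlarge d hd
          rw [abs_mul, Nat.abs_cast]; gcongr
      _ ≤ l ^ 2 * ∑ m ∈ Ioc 0 (y / D), (vkN u y q b m : ℝ) := by
          rw [← mul_sum]
          refine mul_le_mul_of_nonneg_left ?_ (sq_nonneg l)
          exact_mod_cast vkN_swap hD
      _ ≤ l ^ 2 * ∑ m ∈ Ioc 0 (y / D), (X * (1 / m) + 2) := by
          gcongr with m hm
          rw [mem_Ioc] at hm
          have hm0 : (0 : ℝ) < m := by exact_mod_cast hm.1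
          by_cases hmq : m.Coprime q
          · have h1 := vkN_approx (b := b) hm.1 hq huy hmq
            have e : X * (1 / m) = (y - u) / (m * q) := by rw [hX]; field_simp
            rw [e]
            linarith [(abs_le.mp h1).2]
          · rw [vkN_eq_zero hb hmq]
            have : 0 ≤ X * (1 / m) := by positivity
            push_cast; linarith
      _ ≤ _ := by
          rw [sum_add_distrib, ← mul_sum]
          have hyD1 : 1 ≤ y / D := by rw [Nat.le_div_iff_mul_le (by omega)]; omega
          have h1 := vk_harm (y / D) hyD1
          have h2 : ((y / D : ℕ) : ℝ) ≤ y / D := Nat.cast_div_le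
          have h3 : Real.log ((y / D : ℕ) : ℝ) ≤ l := Real.log_le_log (by exact_mod_cast hyD1) h2
          have h4 : ∑ m ∈ Ioc 0 (y / D), (2 : ℝ) ≤ 2 * (y / D) := by
            simp; linarith
          gcongr
          linarith
  have hfin : ∑ d ∈ Ioc 0 y, g d * vkN u y q b d =
      ∑ d ∈ Ioc 0 D, (g d * vkN u y q b d - X * (if d.Coprime q then g d / d else 0))
      + X * ∑ d ∈ Ioc 0 y, (if d.Coprime q then g d / d else 0)
      - X * ∑ d ∈ Ioc D y, (if d.Coprime q then g d / d else 0)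
      + ∑ d ∈ Ioc D y, g d * vkN u y q b d := by
    rw [hsplit (fun d => if d.Coprime q then g d / d else 0), hsplit, sum_sub_distrib, ← mul_sum]
    ring
  rw [hfin]
  have t2 : |X * ∑ d ∈ Ioc 0 y, (if d.Coprime q then g d / d else 0)| ≤ X * (84 * (1 + c) * vkH q) := by
    rw [abs_mul, abs_of_nonneg hX0]; gcongr
  have t3 : |X * ∑ d ∈ Ioc D y, (if d.Coprime q then g d / d else 0)| ≤ X * (l ^ 2 * l) := by
    rw [abs_mul, abs_of_nonneg hX0]; gcongr
  have : 0 ≤ X * l ^ 2 := by positivity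
  rw [abs_le] at *
  constructor <;> nlinarith

theorem vk_bt_raw2 {u y q b D : ℕ} (hD : 1 ≤ D) (hDy : D ≤ y) (huy : u ≤ y) (hq : 0 < q) :
    Real.log y * ∑ n ∈ (Ioc u y).filter (fun n => n ≡ b [MOD q] ∧ n.Coprime q), Λ n ≤
      ((y - u : ℝ) / q) * (84 * (1 + Real.log y) * vkH q + 2 * Real.log (y / D) ^ 2 * (Real.log (y / D) + 1))
        + 2 * D * Real.log y ^ 2 + 2 * Real.log (y / D) ^ 2 * (y / D) := by
  have hy1 : 1 ≤ y := hD.trans hDy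
  have hy0 : (1 : ℝ) ≤ y := by exact_mod_cast hy1
  have hc0 : 0 ≤ Real.log y := Real.log_nonneg hy0
  by_cases hb : b.Coprime q
  · refine le_trans ?_ (le_trans (le_abs_self _) (vk_bt_raw hD hDy huy hq hb))
    have e : ∑ d ∈ Ioc 0 y, (μ d : ℝ) * Real.log (y / d) ^ 2 * vkN u y q b d =
        ∑ n ∈ Ioc 0 y, if (u < n ∧ n ≡ b [MOD q]) then vkTheta (Real.log y) n else 0 := by
      have h := vk_swap (fun d m => if (u < d * m ∧ d * m ≡ b [MOD q]) then (μ d : ℝ) * (Real.log y - Real.log d) ^ 2 else 0) y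
      have h1 : ∑ n ∈ Ioc 0 y, (if (u < n ∧ n ≡ b [MOD q]) then vkTheta (Real.log y) n else 0) =
          ∑ n ∈ Ioc 0 y, ∑ p ∈ n.divisorsAntidiagonal, if (u < p.1 * p.2 ∧ p.1 * p.2 ≡ b [MOD q]) then (μ p.1 : ℝ) * (Real.log y - Real.log p.1) ^ 2 else 0 := by
        refine sum_congr rfl fun n _ => ?_
        have : ∀ p ∈ n.divisorsAntidiagonal, (if (u < p.1 * p.2 ∧ p.1 * p.2 ≡ b [MOD q]) then (μ p.1 : ℝ) * (Real.log y - Real.log p.1) ^ 2 else 0) = (if (u < n ∧ n ≡ b [MOD q]) then (μ p.1 : ℝ) * (Real.log y - Real.log p.1) ^ 2 else 0) := by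
          intro p hp
          rw [Nat.mem_divisorsAntidiagonal] at hp
          rw [hp.1]
        rw [sum_congr rfl this, vkTheta]
        split_ifs
        · rfl
        · simp
      rw [h1, h]
      refine sum_congr rfl fun d hd => ?_
      rw [mem_Ioc] at hd
      have hd0 : (d : ℝ) ≠ 0 := by have := hd.1; positivity
      rw [Real.log_div (by linarith) hd0, ← sum_filter, sum_const, vkN, nsmul_eq_mul, mul_comm]
    rw [e, mul_sum]
    rw [← sum_filter]
    have hss : (Ioc u y).filter (fun n => n ≡ b [MOD q] ∧ n.Coprime q) ⊆ (Ioc 0 y).filter (fun n => u < n ∧ n ≡ b [MOD q]) := by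
      intro n hn
      simp only [mem_filter, mem_Ioc] at hn ⊢
      exact ⟨⟨by omega, hn.1.2⟩, hn.1.1, hn.2.1⟩
    have hge : ∀ n ∈ (Ioc 0 y).filter (fun n => u < n ∧ n ≡ b [MOD q]), Λ n * Real.log y ≤ vkTheta (Real.log y) n := by
      intro n hn
      simp only [mem_filter, mem_Ioc] at hn
      exact vkTheta_ge _ _ (Real.log_le_log (by exact_mod_cast hn.1.1) (by exact_mod_cast hn.1.2))
    calc _ ≤ ∑ n ∈ (Ioc u y).filter (fun n => n ≡ b [MOD q] ∧ n.Coprime q), vkTheta (Real.log y) n := by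
          refine sum_le_sum fun n hn => ?_
          rw [mul_comm]; exact hge n (hss hn)
      _ ≤ _ := sum_le_sum_of_subset_of_nonneg hss fun n hn _ =>
          le_trans (mul_nonneg vonMangoldt_nonneg hc0) (hge n hn)
  · have : (Ioc u y).filter (fun n => n ≡ b [MOD q] ∧ n.Coprime q) = ∅ := by
      rw [filter_eq_empty_iff]
      rintro n _ ⟨h1, h2⟩
      apply hb
      rw [Nat.Coprime, ← h1.gcd_eq]; exact h2
    rw [this]
    have hu0 : (u : ℝ) ≤ y := by exact_mod_cast huy
    have hH := vkH_one_le q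
    have hD0 : (1 : ℝ) ≤ D := by exact_mod_cast hD
    have hDy0 : (D : ℝ) ≤ y := by exact_mod_cast hDy
    have hl0 : 0 ≤ Real.log (y / D) := Real.log_nonneg (by rw [le_div_iff₀ (by linarith)]; linarith)
    have : (0 : ℝ) ≤ y - u := by linarith
    simp only [sum_empty, mul_zero]
    positivity
end PartA4

section PartA5
open ArithmeticFunction
open scoped ArithmeticFunction.Moebius ArithmeticFunction.zeta

theorem vk_ev_log (A : ℝ) (n : ℕ) : ∀ᶠ c : ℝ in atTop, A * Real.log c ^ n ≤ c := by
  have h := (Real.isLittleO_pow_log_id_atTop (n := n)).bound (c := (|A| + 1)⁻¹) (by positivity)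
  filter_upwards [h, eventually_ge_atTop 1] with c h1 h2
  have hl := Real.log_nonneg h2
  rw [Real.norm_of_nonneg (by positivity), id, Real.norm_of_nonneg (by linarith)] at h1
  have h3 : 0 < |A| + 1 := by positivity
  rw [inv_mul_eq_div, le_div_iff₀ h3] at h1
  have : 0 ≤ Real.log c ^ n := by positivity
  nlinarith [le_abs_self A]

theorem vk_ev_exp (A : ℝ) (n : ℕ) : ∀ᶠ c : ℝ in atTop, A * c ^ n ≤ Real.exp c := by
  have h := (Real.isLittleO_pow_exp_atTop (n := n)).bound (c := (|A| + 1)⁻¹) (by positivity)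
  filter_upwards [h, eventually_ge_atTop 1] with c h1 h2
  rw [Real.norm_of_nonneg (by positivity), Real.norm_of_nonneg (by positivity)] at h1
  have h3 : 0 < |A| + 1 := by positivity
  rw [inv_mul_eq_div, le_div_iff₀ h3] at h1
  have : 0 ≤ c ^ n := by positivity
  nlinarith [le_abs_self A]

theorem vk_tendsto_log : Tendsto (fun y : ℕ => Real.log (y : ℝ)) atTop atTop :=
  Real.tendsto_log_atTop.comp tendsto_natCast_atTop_atTop

theorem vk_choose_D (K : ℕ) : ∀ᶠ y : ℕ in atTop, ∃ D : ℕ, 1 ≤ D ∧ D ≤ y ∧ (D : ℝ) ≤ y / Real.log y ^ K ∧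
    (y : ℝ) / D ≤ 2 * Real.log y ^ K ∧ 0 ≤ Real.log (y / D) ∧ Real.log (y / D) ≤ (K + 1) * Real.log (Real.log y) := by
  have h1 := vk_tendsto_log.eventually (vk_ev_exp 2 K)
  have h2 := vk_tendsto_log.eventually (eventually_ge_atTop (2 : ℝ))
  filter_upwards [h1, h2, eventually_ge_atTop 1] with y h1 h2 h3
  have hy0 : (1 : ℝ) ≤ y := by exact_mod_cast h3
  set c := Real.log y with hc
  rw [hc, Real.exp_log (by linarith), ← hc] at h1
  have hW : 1 ≤ c ^ K := one_le_pow₀ (by linarith)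
  have hle : (⌊(y : ℝ) / c ^ K⌋₊ : ℝ) ≤ y / c ^ K := Nat.floor_le (by positivity)
  have h2' : 2 ≤ (y : ℝ) / c ^ K := by rw [le_div_iff₀ (by linarith)]; exact h1
  have hgt := Nat.lt_floor_add_one ((y : ℝ) / c ^ K)
  set D := ⌊(y : ℝ) / c ^ K⌋₊ with hD
  have hD1 : 1 ≤ D := by rw [hD, Nat.one_le_floor_iff]; linarith
  have hD0 : (1 : ℝ) ≤ D := by exact_mod_cast hD1
  have hDy : (D : ℝ) ≤ y := hle.trans (div_le_self (by linarith) hW)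
  have hyD : (y : ℝ) / D ≤ 2 * c ^ K := by
    rw [div_le_iff₀ (by linarith)]
    have : (y : ℝ) / c ^ K ≤ 2 * D := by linarith
    rw [div_le_iff₀ (by linarith)] at this
    linarith
  refine ⟨D, hD1, by exact_mod_cast hDy, hle, hyD, ?_, ?_⟩
  · exact Real.log_nonneg (by rw [le_div_iff₀ (by linarith)]; linarith)
  · have := Real.log_le_log (by positivity) hyD
    rw [Real.log_mul (by norm_num) (by positivity), Real.log_pow] at this
    have h5 := Real.log_le_log (by norm_num) h2
    linarith

set_option maxHeartbeats 1000000 in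
theorem vk_bt (B : ℕ) : ∀ᶠ y : ℕ in atTop, ∀ u q b : ℕ, u ≤ y → 0 < q → (q : ℝ) ≤ Real.log y ^ B →
    (y : ℝ) / Real.log y ^ B ≤ y - u →
    ∑ n ∈ (Ioc u y).filter (fun n => n ≡ b [MOD q] ∧ n.Coprime q), Λ n ≤ 172 * vkH q * ((y - u) / q) := by
  set K := 2 * B + 2 with hK
  have h1 := vk_tendsto_log.eventually (vk_ev_exp 4 (K + 2 * B + 1))
  have h2 := vk_tendsto_log.eventually (eventually_ge_atTop (4 : ℝ))
  have h3 := vk_tendsto_log.eventually (vk_ev_log (4 * (K + 1) ^ 3) 3)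
  filter_upwards [h1, h2, h3, eventually_ge_atTop 1, vk_choose_D K] with y h1 h2 h3 hy1 hD
  obtain ⟨D, hD1, hDy, hDle, hyD, hl0, hl⟩ := hD
  intro u q b huy hq hqB hh
  have hy0 : (1 : ℝ) ≤ y := by exact_mod_cast hy1
  have hq0 : (1 : ℝ) ≤ q := by exact_mod_cast hq
  have hbt := vk_bt_raw2 (b := b) hD1 hDy huy hq
  set c := Real.log y with hc
  set l := Real.log (y / D) with hldef
  set H := vkH q
  have hH : 1 ≤ H := vkH_one_le q
  rw [hc, Real.exp_log (by linarith), ← hc] at h1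
  set X := (y - u : ℝ) / q with hX
  have hc0 : 0 < c := by linarith
  have hXl : y / c ^ (2 * B) ≤ X := by
    rw [hX, le_div_iff₀ (by linarith)]
    refine le_trans ?_ hh
    rw [le_div_iff₀ (by positivity)]
    calc _ ≤ y / c ^ (2 * B) * c ^ B * c ^ B := by gcongr
      _ = y := by rw [two_mul, pow_add]; field_simp
  set M := (K + 1) * Real.log c with hM
  have hM1 : 1 ≤ M := by
    have h5 : Real.log 4 ≤ Real.log c := Real.log_le_log (by norm_num) h2
    have h6 : (1 : ℝ) ≤ Real.log 4 := by
      rw [show (4 : ℝ) = 2 ^ 2 by norm_num, Real.log_pow]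
      have := Real.log_two_gt_d9
      push_cast; linarith
    have : (0 : ℝ) ≤ K := by positivity
    rw [hM]; nlinarith
  have hM3 : 4 * M ^ 3 ≤ c := by rw [hM, mul_pow]; linarith
  have hl3 : 2 * l ^ 2 * (l + 1) ≤ c := by
    calc 2 * l ^ 2 * (l + 1) ≤ 2 * M ^ 2 * (M + M) := by gcongr
      _ = 4 * M ^ 3 := by ring
      _ ≤ c := hM3
  have hl2 : 2 * l ^ 2 ≤ c := by nlinarith [sq_nonneg l]
  have t1 : 2 * l ^ 2 * (y / D) ≤ X := by
    refine le_trans ?_ hXl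
    rw [le_div_iff₀ (by positivity)]
    calc 2 * l ^ 2 * (y / D) * c ^ (2 * B) ≤ c * (2 * c ^ K) * c ^ (2 * B) := by gcongr
      _ ≤ 4 * c ^ (K + 2 * B + 1) := by
        have : c * (2 * c ^ K) * c ^ (2 * B) = 2 * c ^ (K + 2 * B + 1) := by ring
        rw [this]; have : 0 ≤ c ^ (K + 2 * B + 1) := by positivity
        linarith
      _ ≤ y := h1
  have t2 : 2 * D * c ^ 2 ≤ 2 * X := by
    have : D * c ^ 2 ≤ y / c ^ (2 * B) := by
      calc D * c ^ 2 ≤ y / c ^ K * c ^ 2 := by gcongr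
        _ = _ := by rw [hK, pow_add]; field_simp
    linarith
  have hX0 : 0 ≤ X := le_trans (by positivity) hXl
  have t3 : c * ∑ n ∈ (Ioc u y).filter (fun n => n ≡ b [MOD q] ∧ n.Coprime q), Λ n ≤ c * (172 * H * X) := by
    calc _ ≤ _ := hbt
      _ ≤ X * (84 * (1 + c) * H + c) + 2 * X + X := by gcongr
      _ ≤ X * (84 * (c + c) * H + c * H) + X * (c * H) + X * (c * H) := by
          have e1 : c ≤ c * H := le_mul_of_one_le_right hc0.le hH
          have e2 : (2 : ℝ) ≤ c * H := by linarith
          have e3 : 2 * X ≤ X * (c * H) := by rw [mul_comm]; exact mul_le_mul_of_nonneg_left e2 hX0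
          have e4 : X ≤ X * (c * H) := le_mul_of_one_le_right hX0 (by linarith)
          gcongr
          linarith
      _ = 171 * (c * H * X) := by ring
      _ ≤ _ := by
        have : 0 ≤ c * H * X := by positivity
        linarith
  exact le_of_mul_le_mul_left t3 hc0
end PartA5

section PartA6
open ArithmeticFunction
open scoped ArithmeticFunction.Moebius ArithmeticFunction.zeta

noncomputable def vke (t : ℝ) : ℂ := Complex.exp (Complex.I * ((2 * Real.pi * t : ℝ) : ℂ))

theorem vke_add (s t : ℝ) : vke (s + t) = vke s * vke t := by
  rw [vke, vke, vke, ← Complex.exp_add]; congr 1; push_cast; ring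

theorem vke_norm (t : ℝ) : ‖vke t‖ = 1 := by
  rw [vke, mul_comm]; exact Complex.norm_exp_ofReal_mul_I _

theorem vke_int (k : ℤ) : vke k = 1 := by
  rw [vke, Complex.exp_eq_one_iff]
  exact ⟨k, by push_cast; ring⟩

theorem vke_add_int (t : ℝ) (k : ℤ) : vke (t + k) = vke t := by
  rw [vke_add, vke_int, mul_one]

theorem vke_nat_mul (m : ℕ) (t : ℝ) : vke (m * t) = vke t ^ m := by
  rw [vke, vke, ← Complex.exp_nat_mul]; congr 1; push_cast; ring

theorem vke_neg (t : ℝ) : vke (-t) = (starRingEnd ℂ) (vke t) := by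
  rw [vke, vke, ← Complex.exp_conj, map_mul, Complex.conj_ofReal, Complex.conj_I]; congr 1
  push_cast; ring

theorem vke_one_sub_norm (t : ℝ) : ‖1 - vke t‖ = 2 * |Real.sin (Real.pi * t)| := by
  rw [norm_sub_rev, vke, Complex.norm_exp_I_mul_ofReal_sub_one, norm_mul, Real.norm_eq_abs, Real.norm_eq_abs]
  congr 2
  · norm_num
  · congr 1; ring

theorem vke_sub_norm_le (s t : ℝ) : ‖vke s - vke t‖ ≤ 2 * Real.pi * |s - t| := by
  have : vke s - vke t = vke s * (1 - vke (t - s)) := by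
    have : vke t = vke s * vke (t - s) := by rw [← vke_add]; congr 1; ring
    rw [this]
    ring
  rw [this, norm_mul, vke_norm, one_mul, vke_one_sub_norm]
  have := Real.abs_sin_le_abs (x := Real.pi * (t - s))
  rw [abs_mul, abs_of_pos Real.pi_pos, abs_sub_comm t s] at this
  linarith

theorem vk_geom_norm (w : ℂ) (hw : ‖w‖ = 1) (A B : ℕ) (X : ℝ) (hX : 0 ≤ X) (hwX : 2 ≤ X * ‖1 - w‖) :
    ‖∑ m ∈ Ioc A B, w ^ m‖ ≤ X := by
  have hne : 0 < ‖1 - w‖ := by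
    rcases (norm_nonneg (1 - w)).lt_or_eq with h | h
    · exact h
    · rw [← h] at hwX; norm_num at hwX
  rcases le_or_gt A B with h | h
  · have h1 : (1 - w) * ∑ m ∈ Ioc A B, w ^ m = w ^ (A + 1) - w ^ (B + 1) := by
      induction B, h using Nat.le_induction with
      | base => simp
      | succ n hn ih => rw [sum_Ioc_succ_top (by omega), mul_add, ih]; ring
    have h2 : ‖1 - w‖ * ‖∑ m ∈ Ioc A B, w ^ m‖ ≤ 2 := by
      rw [← norm_mul, h1]
      refine (norm_sub_le _ _).trans ?_
      rw [norm_pow, norm_pow, hw]; norm_num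
    by_contra hc
    push Not at hc
    nlinarith
  · rw [Ioc_eq_empty (by omega)]; simpa using hX

noncomputable def vkF (q : ℕ) (z : ZMod q) : ℝ := if z = 0 then 0 else (q : ℝ) / z.val + q / (q - z.val)

theorem vkF_nonneg (q : ℕ) [NeZero q] (z : ZMod q) : 0 ≤ vkF q z := by
  rw [vkF]
  split_ifs with h
  · exact le_rfl
  · have : (z.val : ℝ) ≤ q := by exact_mod_cast (ZMod.val_lt z).le
    have : (0 : ℝ) ≤ q - z.val := by linarith
    positivity

theorem vk_geo {q : ℕ} [NeZero q] {a r : ℤ} {α : ℝ}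
    (hβ : |(r : ℝ)| * |α - a / q| ≤ 1 / (2 * q)) (hz : ((a * r : ℤ) : ZMod q) ≠ 0) (A B : ℕ) :
    ‖∑ m ∈ Ioc A B, vke (m * (r * α))‖ ≤ vkF q ((a * r : ℤ) : ZMod q) := by
  have hq0 : (0 : ℝ) < q := by exact_mod_cast Nat.pos_of_ne_zero (NeZero.ne q)
  set z := ((a * r : ℤ) : ZMod q) with hzdef
  set s := z.val with hs
  have hs0 : 0 < s := Nat.pos_of_ne_zero (by rw [hs]; simpa [ZMod.val_eq_zero] using hz)
  have hsq : s < q := ZMod.val_lt z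
  have hs1 : (1 : ℝ) ≤ s := by exact_mod_cast hs0
  have hsq1 : (s : ℝ) + 1 ≤ q := by exact_mod_cast hsq
  have hmod : (s : ℤ) = (a * r) % q := by rw [hs, hzdef, ZMod.val_intCast]
  have hdecomp : (a * r : ℤ) = q * ((a * r) / q) + s := by rw [hmod]; exact (Int.mul_ediv_add_emod _ _).symm
  set k := (a * r) / (q : ℤ)
  set t : ℝ := s / q + r * (α - a / q) with ht
  have hrα : r * α = t + k := by
    have : (a : ℝ) * r = q * k + s := by exact_mod_cast hdecomp
    rw [ht]; field_simp; linarith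
  have hw : vke (r * α) = vke t := by rw [hrα, vke_add_int]
  simp only [vke_nat_mul, hw]
  have hF : vkF q z = (q : ℝ) / s + q / (q - s) := by rw [vkF, if_neg hz]
  have hqs : (0 : ℝ) < q - s := by linarith
  have hrb : |r * (α - a / q)| ≤ 1 / (2 * q) := by rw [abs_mul]; exact hβ
  rw [abs_le] at hrb
  have ht1 : s / (2 * q) ≤ t := by
    have e : (s : ℝ) / q = s / (2 * q) + s / (2 * q) := by field_simp; ring
    have : 1 / (2 * (q : ℝ)) ≤ s / (2 * q) := by gcongr
    rw [ht]; linarith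
  have ht2 : t ≤ 1 - (q - s) / (2 * q) := by
    have e : (s : ℝ) / q = 1 - (q - s) / (2 * q) - (q - s) / (2 * q) := by field_simp; ring
    have : 1 / (2 * (q : ℝ)) ≤ (q - s) / (2 * q) := by gcongr; linarith
    rw [ht]; linarith
  have p1 : (0 : ℝ) < s / (2 * q) := by positivity
  have p2 : (0 : ℝ) < (q - s) / (2 * q) := by positivity
  have g1 : (0 : ℝ) < q / s := by positivity
  have g2 : (0 : ℝ) < q / (q - s) := by positivity
  refine vk_geom_norm _ (vke_norm _) A B _ (by rw [hF]; positivity) ?_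
  rw [vke_one_sub_norm, hF]
  have hpi := Real.pi_pos
  rcases le_total t (1/2) with h | h
  · have := Real.mul_le_sin (x := Real.pi * t) (by nlinarith) (by nlinarith)
    have e : 2 / Real.pi * (Real.pi * t) = 2 * t := by field_simp
    rw [e] at this
    have h2 := le_abs_self (Real.sin (Real.pi * t))
    calc (2 : ℝ) ≤ q / s * (2 * (2 * (s / (2 * q)))) := by field_simp; norm_num
      _ ≤ (q / s + q / (q - s)) * (2 * |Real.sin (Real.pi * t)|) := by
        apply mul_le_mul
        · linarith
        · linarith
        · positivity
        · positivity
  · have := Real.mul_le_sin (x := Real.pi * (1 - t)) (by nlinarith) (by nlinarith)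
    have e : 2 / Real.pi * (Real.pi * (1 - t)) = 2 * (1 - t) := by field_simp
    have e2 : Real.sin (Real.pi * (1 - t)) = Real.sin (Real.pi * t) := by
      rw [mul_sub, mul_one, Real.sin_pi_sub]
    rw [e, e2] at this
    have h2 := le_abs_self (Real.sin (Real.pi * t))
    calc (2 : ℝ) ≤ q / (q - s) * (2 * (2 * ((q - s) / (2 * q)))) := by field_simp; norm_num
      _ ≤ (q / s + q / (q - s)) * (2 * |Real.sin (Real.pi * t)|) := by
        apply mul_le_mul
        · linarith
        · linarith
        · positivity
        · positivity

theorem vkF_sum (q : ℕ) [NeZero q] : ∑ z : ZMod q, vkF q z ≤ 2 * q * (1 + Real.log q) := by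
  have hq := Nat.pos_of_ne_zero (NeZero.ne q)
  have h1 : ∑ z : ZMod q, vkF q z = ∑ s ∈ range q, (if s = 0 then 0 else (q : ℝ) / s + q / (q - s)) := by
    refine sum_bij' (fun z _ => z.val) (fun s _ => (s : ZMod q)) ?_ ?_ ?_ ?_ ?_
    · intro z _; simpa using ZMod.val_lt z
    · intro s _; simp
    · intro z _; simp
    · intro s hs; exact ZMod.val_cast_of_lt (by simpa using hs)
    · intro z _; rw [vkF]; simp [ZMod.val_eq_zero]
  have hrange : ∀ f : ℕ → ℝ, ∑ s ∈ range q, (if s = 0 then 0 else f s) = ∑ s ∈ Ioc 0 (q - 1), f s := by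
    intro f
    obtain ⟨n, rfl⟩ : ∃ n, q = n + 1 := ⟨q - 1, by omega⟩
    rw [sum_range_succ', Nat.add_sub_cancel]
    simp only [if_true, add_zero, Nat.add_eq_zero_iff, one_ne_zero, and_false, if_false]
    rw [← Icc_add_one_left_eq_Ioc, zero_add, range_eq_Ico, sum_Ico_add' f 0 n 1]
    rfl
  rw [h1, hrange, sum_add_distrib]
  have h2 : ∑ s ∈ Ioc 0 (q - 1), (q : ℝ) / (q - s) = ∑ s ∈ Ioc 0 (q - 1), (q : ℝ) / s := by
    refine sum_bij' (fun s _ => q - s) (fun s _ => q - s) ?_ ?_ ?_ ?_ ?_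
    · intro s hs; rw [mem_Ioc] at *; omega
    · intro s hs; rw [mem_Ioc] at *; omega
    · intro s hs; rw [mem_Ioc] at *; omega
    · intro s hs; rw [mem_Ioc] at *; omega
    · intro s hs; rw [mem_Ioc] at hs; rw [Nat.cast_sub (by omega)]
  rw [h2]
  have h3 : ∑ s ∈ Ioc 0 (q - 1), (q : ℝ) / s ≤ q * (1 + Real.log q) := by
    calc _ ≤ ∑ s ∈ Ioc 0 q, (q : ℝ) / s :=
          sum_le_sum_of_subset_of_nonneg (Ioc_subset_Ioc_right (by omega)) (fun _ _ _ => by positivity)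
      _ = q * ∑ s ∈ Ioc 0 q, (1 : ℝ) / s := by
          rw [mul_sum]; refine sum_congr rfl fun _ _ => ?_; ring
      _ ≤ _ := by gcongr; exact vk_harm q hq
  linarith

theorem vk_periodic_sum (q : ℕ) [NeZero q] (f : ZMod q → ℝ) (hf : ∀ z, 0 ≤ f z) (u v : ℕ) (huv : u ≤ v) :
    ∑ r ∈ Ioc u v, f (r : ZMod q) ≤ ((v - u : ℝ) / q + 1) * ∑ z : ZMod q, f z := by
  have hq := Nat.pos_of_ne_zero (NeZero.ne q)
  rw [← sum_fiberwise (Ioc u v) (fun r => (r : ZMod q)), mul_sum]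
  refine sum_le_sum fun z _ => ?_
  rw [sum_congr rfl (g := fun _ => f z) (by intro r hr; rw [(mem_filter.mp hr).2]), sum_const, nsmul_eq_mul]
  refine mul_le_mul_of_nonneg_right ?_ (hf z)
  have h := vk_card_modEq u v q z.val hq huv
  have e : (Ioc u v).filter (fun r : ℕ => (r : ZMod q) = z) = (Ioc u v).filter (fun r => r ≡ z.val [MOD q]) := by
    refine filter_congr fun r _ => ?_
    rw [← ZMod.natCast_eq_natCast_iff]; simp
  rw [e]
  linarith [(abs_le.mp h).2]

theorem vkF_range_sum {q : ℕ} [NeZero q] {a : ℤ} (ha : IsUnit (a : ZMod q)) (n : ℤ) (u v : ℕ) (huv : u ≤ v) :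
    ∑ r ∈ Ioc u v, vkF q ((a * (n - r) : ℤ) : ZMod q) ≤ ((v - u : ℝ) / q + 1) * (2 * q * (1 + Real.log q)) := by
  have h := vk_periodic_sum q (fun z => vkF q ((a : ZMod q) * (n - z))) (fun z => vkF_nonneg q _) u v huv
  have e : ∑ z : ZMod q, vkF q ((a : ZMod q) * (n - z)) = ∑ z : ZMod q, vkF q z := by
    obtain ⟨w, hw⟩ := ha
    refine Fintype.sum_equiv ((Equiv.subLeft (n : ZMod q)).trans w.mulLeft) _ _ ?_
    intro z
    simp [hw]
  simp only [e] at h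
  push_cast
  refine h.trans ?_
  have : (u : ℝ) ≤ v := by exact_mod_cast huv
  have : 0 ≤ ((v - u : ℝ) / q + 1) := by
    have : 0 ≤ (v - u : ℝ) / q := div_nonneg (by linarith) (by positivity)
    linarith
  gcongr
  exact vkF_sum q
end PartA6

section PartA7
open ArithmeticFunction
open scoped ArithmeticFunction.Moebius ArithmeticFunction.zeta

theorem vk_theta_sum (c : ℝ) (N : ℕ) (w : ℕ → ℂ) :
    ∑ n ∈ Ioc 0 N, (vkTheta c n : ℂ) * w n =
      ∑ d ∈ Ioc 0 N, (((μ d : ℝ) * (c - Real.log d) ^ 2 : ℝ) : ℂ) * ∑ m ∈ Ioc 0 (N / d), w (d * m) := by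
  have h := vk_swap (fun d m => (((μ d : ℝ) * (c - Real.log d) ^ 2 : ℝ) : ℂ) * w (d * m)) N
  simp only [← mul_sum] at h
  rw [← h]
  refine sum_congr rfl fun n _ => ?_
  rw [vkTheta, Complex.ofReal_sum, sum_mul]
  refine sum_congr rfl fun p hp => ?_
  rw [Nat.mem_divisorsAntidiagonal] at hp
  rw [hp.1]

theorem vk_combine (c : ℝ) (N : ℕ) (w : ℕ → ℂ) :
    (c : ℂ) * ∑ n ∈ Ioc 0 N, (Λ n : ℂ) * w n =
      ∑ d ∈ Ioc 0 N, (((μ d : ℝ) * (c - Real.log d) ^ 2 : ℝ) : ℂ) * ∑ m ∈ Ioc 0 (N / d), w (d * m)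
      - ∑ n ∈ Ioc 0 N, (if n = 1 then (c : ℂ) ^ 2 else 0) * w n
      - ∑ n ∈ Ioc 0 N, ((Λ n * (c - Real.log n) : ℝ) : ℂ) * w n
      - ∑ m ∈ Ioc 0 N, (Λ m : ℂ) * ∑ n ∈ Ioc 0 (N / m), (Λ n : ℂ) * w (m * n) := by
  rw [← vk_theta_sum]
  have h := vk_swap (fun d m => (Λ d : ℂ) * ((Λ m : ℂ) * w (d * m))) N
  simp only [← mul_sum] at h
  rw [← h, mul_sum, ← sum_sub_distrib, ← sum_sub_distrib, ← sum_sub_distrib]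
  refine sum_congr rfl fun n _ => ?_
  have e : ∑ p ∈ n.divisorsAntidiagonal, (Λ p.1 : ℂ) * ((Λ p.2 : ℂ) * w (p.1 * p.2)) =
      ((∑ p ∈ n.divisorsAntidiagonal, Λ p.1 * Λ p.2 : ℝ) : ℂ) * w n := by
    rw [Complex.ofReal_sum, sum_mul]
    refine sum_congr rfl fun p hp => ?_
    rw [Nat.mem_divisorsAntidiagonal] at hp
    rw [hp.1]; push_cast; ring
  rw [e, vkTheta_eq]
  push_cast
  split_ifs <;> push_cast <;> ring

theorem vk_g_abs (N d : ℕ) : ‖(((μ d : ℝ) * Real.log (N / d) ^ 2 : ℝ) : ℂ)‖ ≤ Real.log (N / d) ^ 2 := by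
  rw [Complex.norm_real, Real.norm_eq_abs, abs_mul, abs_of_nonneg (sq_nonneg (Real.log (N / d)))]
  calc _ ≤ 1 * Real.log (N / d) ^ 2 := by gcongr; exact vk_abs_moebius d
      _ = _ := one_mul _

theorem vk_g_abs_small {N d : ℕ} (hd : 1 ≤ d) (hdN : d ≤ N) :
    ‖(((μ d : ℝ) * Real.log (N / d) ^ 2 : ℝ) : ℂ)‖ ≤ Real.log N ^ 2 := by
  refine (vk_g_abs N d).trans ?_
  have hd1 : (1 : ℝ) ≤ d := by exact_mod_cast hd
  have hdy : (d : ℝ) ≤ N := by exact_mod_cast hdN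
  have h1 : 0 ≤ Real.log (N / d) := Real.log_nonneg (by rw [le_div_iff₀ (by linarith)]; linarith)
  have h2 : Real.log (N / d) ≤ Real.log N := Real.log_le_log (by apply div_pos <;> linarith) (div_le_self (by linarith) hd1)
  gcongr

theorem vk_g_abs_large {N D d : ℕ} (hD : 1 ≤ D) (hd : D ≤ d) (hdN : d ≤ N) :
    ‖(((μ d : ℝ) * Real.log (N / d) ^ 2 : ℝ) : ℂ)‖ ≤ Real.log (N / D) ^ 2 := by
  refine (vk_g_abs N d).trans ?_
  have hd1 : (1 : ℝ) ≤ d := by exact_mod_cast hD.trans hd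
  have hD1 : (1 : ℝ) ≤ D := by exact_mod_cast hD
  have hDd : (D : ℝ) ≤ d := by exact_mod_cast hd
  have hdy : (d : ℝ) ≤ N := by exact_mod_cast hdN
  have h1 : 0 ≤ Real.log (N / d) := Real.log_nonneg (by rw [le_div_iff₀ (by linarith)]; linarith)
  have h2 : Real.log (N / d) ≤ Real.log (N / D) := Real.log_le_log (by apply div_pos <;> linarith) (by gcongr)
  gcongr

theorem vk_sum_mult (q D : ℕ) (hq : 0 < q) (f : ℕ → ℝ) :
    ∑ d ∈ (Ioc 0 D).filter (fun d => q ∣ d), f d = ∑ e ∈ Ioc 0 (D / q), f (q * e) := by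
  have h2 : (Ioc 0 D).filter (fun d => q ∣ d) = (Ioc 0 (D / q)).image (fun e => q * e) := by
    ext d
    simp only [mem_filter, mem_image, mem_Ioc]
    constructor
    · rintro ⟨⟨h1, h2⟩, e, rfl⟩
      exact ⟨e, ⟨Nat.pos_of_mul_pos_left h1, by rw [Nat.le_div_iff_mul_le hq, mul_comm]; exact h2⟩, rfl⟩
    · rintro ⟨e, ⟨h1, h2⟩, rfl⟩
      rw [Nat.le_div_iff_mul_le hq, mul_comm] at h2
      exact ⟨⟨Nat.mul_pos hq h1, h2⟩, dvd_mul_right _ _⟩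
  rw [h2, sum_image (by intro a _ b _ h; exact Nat.eq_of_mul_eq_mul_left hq h)]

theorem vk_typeI {N D q : ℕ} [NeZero q] {a : ℤ} {α : ℝ} (ha : IsUnit (a : ZMod q)) (hD : 1 ≤ D) (hDN : D ≤ N)
    (hβ : D * |α - a / q| ≤ 1 / (2 * q)) :
    ‖∑ d ∈ Ioc 0 N, (((μ d : ℝ) * Real.log (N / d) ^ 2 : ℝ) : ℂ) * ∑ m ∈ Ioc 0 (N / d), vke ((d * m : ℕ) * α)‖ ≤
      Real.log N ^ 2 * ((D / q + 1) * (2 * q * (1 + Real.log q))) + Real.log N ^ 2 * (N / q * (1 + Real.log N))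
        + N * Real.log (N / D) ^ 3 := by
  have hN1 : 1 ≤ N := hD.trans hDN
  have hN0 : (1 : ℝ) ≤ N := by exact_mod_cast hN1
  have hD0 : (1 : ℝ) ≤ D := by exact_mod_cast hD
  have hDN0 : (D : ℝ) ≤ N := by exact_mod_cast hDN
  have hq := Nat.pos_of_ne_zero (NeZero.ne q)
  have hq0 : (0 : ℝ) < q := by exact_mod_cast hq
  set g : ℕ → ℂ := fun d => (((μ d : ℝ) * Real.log (N / d) ^ 2 : ℝ) : ℂ) with hg
  set I : ℕ → ℂ := fun d => ∑ m ∈ Ioc 0 (N / d), vke ((d * m : ℕ) * α) with hI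
  have hItriv : ∀ d, ‖I d‖ ≤ N / d := by
    intro d
    refine (norm_sum_le _ _).trans ?_
    simp only [vke_norm, sum_const, Nat.card_Ioc, nsmul_eq_mul, mul_one, tsub_zero]
    exact Nat.cast_div_le
  change ‖∑ d ∈ Ioc 0 N, g d * I d‖ ≤ _
  rw [← sum_Ioc_consecutive _ (Nat.zero_le D) hDN]
  have hl0 : 0 ≤ Real.log (N / D) := Real.log_nonneg (by rw [le_div_iff₀ (by linarith)]; linarith)
  have hL0 : 0 ≤ Real.log N := Real.log_nonneg hN0
  have h2 : ‖∑ d ∈ Ioc D N, g d * I d‖ ≤ N * Real.log (N / D) ^ 3 := by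
    calc _ ≤ ∑ d ∈ Ioc D N, Real.log (N / D) ^ 2 * N * (1 / (d : ℝ)) := by
          refine (norm_sum_le _ _).trans (sum_le_sum fun d hd => ?_)
          rw [mem_Ioc] at hd
          rw [norm_mul]
          calc _ ≤ Real.log (N / D) ^ 2 * (N / d) :=
                mul_le_mul (vk_g_abs_large hD hd.1.le hd.2) (hItriv d) (norm_nonneg _) (by positivity)
            _ = _ := by ring
      _ ≤ Real.log (N / D) ^ 2 * N * Real.log (N / D) := by
          rw [← mul_sum]
          gcongr
          exact vk_harm_tail hD hDN
      _ = _ := by ring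
  have h1 : ‖∑ d ∈ Ioc 0 D, g d * I d‖ ≤ Real.log N ^ 2 * ((D / q + 1) * (2 * q * (1 + Real.log q))) + Real.log N ^ 2 * (N / q * (1 + Real.log N)) := by
    calc _ ≤ ∑ d ∈ Ioc 0 D, Real.log N ^ 2 * (vkF q ((a * d : ℤ) : ZMod q) + if q ∣ d then (N : ℝ) / d else 0) := by
          refine (norm_sum_le _ _).trans (sum_le_sum fun d hd => ?_)
          rw [mem_Ioc] at hd
          rw [norm_mul]
          refine mul_le_mul (vk_g_abs_small hd.1 (hd.2.trans hDN)) ?_ (norm_nonneg _) (by positivity)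
          split_ifs with hqd
          · have := vkF_nonneg q ((a * d : ℤ) : ZMod q)
            linarith [hItriv d]
          · rw [add_zero]
            have hz : ((a * d : ℤ) : ZMod q) ≠ 0 := by
              intro h
              push_cast at h
              rw [ha.mul_right_eq_zero, ZMod.natCast_eq_zero_iff] at h
              exact hqd h
            have := vk_geo (α := α) (r := (d : ℤ)) (a := a) (q := q) ?_ hz 0 (N / d)
            · refine le_trans (le_of_eq ?_) this
              rw [hI]; congr 1
              refine sum_congr rfl fun m _ => ?_
              congr 1; push_cast; ring
            · refine le_trans ?_ hβ
              have : (d : ℝ) ≤ D := by exact_mod_cast hd.2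
              rw [Int.cast_natCast, Nat.abs_cast]
              gcongr
      _ = Real.log N ^ 2 * ∑ d ∈ Ioc 0 D, vkF q ((a * d : ℤ) : ZMod q) + Real.log N ^ 2 * ∑ d ∈ Ioc 0 D, if q ∣ d then (N : ℝ) / d else 0 := by
          rw [← mul_sum, sum_add_distrib, mul_add]
      _ ≤ _ := by
          gcongr
          · have := vkF_range_sum (q := q) (a := -a) (by push_cast; exact ha.neg) 0 0 D (Nat.zero_le _)
            simpa using this
          · rw [← sum_filter, vk_sum_mult q D hq (fun d => (N : ℝ) / d)]
            rcases Nat.eq_zero_or_pos (D / q) with h | h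
            · rw [h]; simp; positivity
            · have hh := vk_harm (D / q) h
              have : Real.log ((D / q : ℕ) : ℝ) ≤ Real.log N := by
                apply Real.log_le_log (by exact_mod_cast h)
                exact_mod_cast (Nat.div_le_self D q).trans hDN
              calc _ = N / q * ∑ e ∈ Ioc 0 (D / q), (1 : ℝ) / e := by
                    rw [mul_sum]; refine sum_congr rfl fun e _ => ?_
                    push_cast; rw [div_mul_div_comm, mul_one]
                _ ≤ _ := by gcongr; linarith
  exact (norm_add_le _ _).trans (by linarith)
end PartA7

section PartA8
open ArithmeticFunction
open scoped ArithmeticFunction.Moebius ArithmeticFunction.zeta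

theorem vk_Lambda_le_log {n N : ℕ} (h : n ≤ N) : Λ n ≤ Real.log N := by
  rcases Nat.eq_zero_or_pos n with rfl | hn
  · simp; exact Real.log_natCast_nonneg N
  · exact vonMangoldt_le_log.trans (Real.log_le_log (by exact_mod_cast hn) (by exact_mod_cast h))

theorem vk_bilin_block {N M q : ℕ} [NeZero q] {a : ℤ} {α : ℝ} (ha : IsUnit (a : ZMod q)) (hM : 1 ≤ M) (hMN : 2 * M ≤ N)
    (hβ : ((N : ℝ) / M) * |α - a / q| ≤ 1 / (2 * q)) :
    ‖∑ m ∈ Ioc M (2 * M), (Λ m : ℂ) * ∑ n ∈ Ioc 0 (N / m), (Λ n : ℂ) * vke ((m * n : ℕ) * α)‖ ^ 2 ≤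
      12 * Real.log N ^ 3 * N * (((N / M : ℝ) / q + 1) * (M + 2 * q * (1 + Real.log q))) := by
  have hM0 : (1 : ℝ) ≤ M := by exact_mod_cast hM
  have hN1 : 1 ≤ N := by omega
  have hN0 : (1 : ℝ) ≤ N := by exact_mod_cast hN1
  have hq := Nat.pos_of_ne_zero (NeZero.ne q)
  have hq0 : (0 : ℝ) < q := by exact_mod_cast hq
  set L := Real.log N with hL
  have hL0 : 0 ≤ L := Real.log_nonneg hN0
  set X := N / M with hX
  have hXN : (X : ℝ) ≤ N / M := Nat.cast_div_le
  set E : ℕ → ℕ → ℂ := fun m n => if m * n ≤ N then (Λ n : ℂ) * vke ((m * n : ℕ) * α) else 0 with hE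
  have hinner : ∀ m ∈ Ioc M (2 * M), ∑ n ∈ Ioc 0 (N / m), (Λ n : ℂ) * vke ((m * n : ℕ) * α) = ∑ n ∈ Ioc 0 X, E m n := by
    intro m hm
    rw [mem_Ioc] at hm
    simp only [hE]
    rw [← sum_filter]
    refine sum_congr ?_ fun _ _ => rfl
    ext n
    simp only [mem_filter, mem_Ioc]
    rw [Nat.le_div_iff_mul_le (by omega), hX, Nat.le_div_iff_mul_le (by omega), mul_comm n m, mul_comm n M]
    constructor
    · rintro ⟨h1, h2⟩; exact ⟨⟨h1, le_trans (Nat.mul_le_mul_right n hm.1.le) h2⟩, h2⟩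
    · rintro ⟨⟨h1, _⟩, h2⟩; exact ⟨h1, h2⟩
  rw [sum_congr rfl (fun m hm => by rw [hinner m hm])]
  have hΛ2 : ∑ m ∈ Ioc M (2 * M), Λ m ^ 2 ≤ L * (12 * M) := by
    calc _ ≤ ∑ m ∈ Ioc M (2 * M), L * Λ m := by
          refine sum_le_sum fun m hm => ?_
          rw [mem_Ioc] at hm
          rw [pow_two]
          exact mul_le_mul_of_nonneg_right (vk_Lambda_le_log (hm.2.trans hMN)) vonMangoldt_nonneg
      _ ≤ L * ∑ m ∈ Ioc 0 (2 * M), Λ m := by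
          rw [← mul_sum]
          exact mul_le_mul_of_nonneg_left (sum_le_sum_of_subset_of_nonneg (Ioc_subset_Ioc_left (Nat.zero_le _)) (fun _ _ _ => vonMangoldt_nonneg)) hL0
      _ ≤ _ := by
          gcongr
          have := vk_psi (2 * M)
          push_cast at this; linarith
  have hsq : ((∑ m ∈ Ioc M (2 * M), ‖∑ n ∈ Ioc 0 X, E m n‖ ^ 2 : ℝ) : ℂ) =
      ∑ n ∈ Ioc 0 X, ∑ n' ∈ Ioc 0 X, ∑ m ∈ Ioc M (2 * M), E m n * (starRingEnd ℂ) (E m n') := by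
    rw [Complex.ofReal_sum]
    have : ∀ m ∈ Ioc M (2 * M), ((‖∑ n ∈ Ioc 0 X, E m n‖ ^ 2 : ℝ) : ℂ) = ∑ n ∈ Ioc 0 X, ∑ n' ∈ Ioc 0 X, E m n * (starRingEnd ℂ) (E m n') := by
      intro m _
      rw [Complex.ofReal_pow, ← Complex.mul_conj', map_sum, sum_mul_sum]
    rw [sum_congr rfl this, sum_comm]
    refine sum_congr rfl fun n _ => ?_
    rw [sum_comm]
  have hpair : ∀ n ∈ Ioc 0 X, ∀ n' ∈ Ioc 0 X, ‖∑ m ∈ Ioc M (2 * M), E m n * (starRingEnd ℂ) (E m n')‖ ≤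
      L ^ 2 * (vkF q ((a * ((n : ℤ) - n') : ℤ) : ZMod q) + M * (if (n' : ZMod q) = (n : ZMod q) then 1 else 0)) := by
    intro n hn n' hn'
    rw [mem_Ioc] at hn hn'
    have hXle : X ≤ N := Nat.div_le_self _ _
    have e : ∑ m ∈ Ioc M (2 * M), E m n * (starRingEnd ℂ) (E m n') =
        (Λ n : ℂ) * (Λ n' : ℂ) * ∑ m ∈ Ioc M (min (2 * M) (min (N / n) (N / n'))), vke (m * (((n : ℤ) - n' : ℤ) * α)) := by
      have hf : Ioc M (min (2 * M) (min (N / n) (N / n'))) = (Ioc M (2 * M)).filter (fun m => m * n ≤ N ∧ m * n' ≤ N) := by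
        ext m
        simp only [mem_filter, mem_Ioc, le_min_iff, Nat.le_div_iff_mul_le hn.1, Nat.le_div_iff_mul_le hn'.1]
        tauto
      rw [hf, sum_filter, mul_sum]
      refine sum_congr rfl fun m _ => ?_
      simp only [hE]
      by_cases h1 : m * n ≤ N
      · by_cases h2 : m * n' ≤ N
        · rw [if_pos h1, if_pos h2, if_pos ⟨h1, h2⟩, map_mul, Complex.conj_ofReal, ← vke_neg]
          have : vke (m * (((n : ℤ) - n' : ℤ) * α)) = vke ((m * n : ℕ) * α) * vke (-((m * n' : ℕ) * α)) := by
            rw [← vke_add]; congr 1; push_cast; ring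
          rw [this]; ring
        · rw [if_neg h2, if_neg (show ¬ (m * n ≤ N ∧ m * n' ≤ N) from fun h => h2 h.2)]; simp
      · rw [if_neg h1, if_neg (show ¬ (m * n ≤ N ∧ m * n' ≤ N) from fun h => h1 h.1)]; simp
    rw [e, norm_mul, norm_mul, Complex.norm_real, Complex.norm_real, Real.norm_of_nonneg vonMangoldt_nonneg, Real.norm_of_nonneg vonMangoldt_nonneg]
    refine mul_le_mul ?_ ?_ (norm_nonneg _) (by positivity)
    · rw [pow_two]
      exact mul_le_mul (vk_Lambda_le_log (hn.2.trans hXle)) (vk_Lambda_le_log (hn'.2.trans hXle)) vonMangoldt_nonneg hL0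
    · split_ifs with h
      · have h0 := vkF_nonneg q ((a * ((n : ℤ) - n') : ℤ) : ZMod q)
        have : ‖∑ m ∈ Ioc M (min (2 * M) (min (N / n) (N / n'))), vke (m * (((n : ℤ) - n' : ℤ) * α))‖ ≤ M := by
          refine (norm_sum_le _ _).trans ?_
          simp only [vke_norm, sum_const, Nat.card_Ioc, nsmul_eq_mul, mul_one]
          have : min (2 * M) (min (N / n) (N / n')) - M ≤ M := by omega
          exact_mod_cast this
        linarith
      · rw [mul_zero, add_zero]
        refine vk_geo ?_ ?_ _ _
        · refine le_trans ?_ hβ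
          gcongr
          refine le_trans ?_ hXN
          rw [abs_le]
          have a1 : (1 : ℝ) ≤ n := by exact_mod_cast hn.1
          have a2 : (n : ℝ) ≤ X := by exact_mod_cast hn.2
          have a3 : (1 : ℝ) ≤ n' := by exact_mod_cast hn'.1
          have a4 : (n' : ℝ) ≤ X := by exact_mod_cast hn'.2
          push_cast
          constructor <;> linarith
        · intro h'
          push_cast at h'
          rw [ha.mul_right_eq_zero, sub_eq_zero] at h'
          exact h h'.symm
  have hlogq : 0 ≤ Real.log q := Real.log_natCast_nonneg q
  have hquad : ∑ m ∈ Ioc M (2 * M), ‖∑ n ∈ Ioc 0 X, E m n‖ ^ 2 ≤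
      L ^ 2 * (N / M) * (((N / M : ℝ) / q + 1) * (M + 2 * q * (1 + Real.log q))) := by
    have h0 : 0 ≤ ∑ m ∈ Ioc M (2 * M), ‖∑ n ∈ Ioc 0 X, E m n‖ ^ 2 := sum_nonneg fun _ _ => by positivity
    rw [← Complex.norm_of_nonneg h0, hsq]
    calc _ ≤ ∑ n ∈ Ioc 0 X, ∑ n' ∈ Ioc 0 X, L ^ 2 * (vkF q ((a * ((n : ℤ) - n') : ℤ) : ZMod q) + M * (if (n' : ZMod q) = (n : ZMod q) then 1 else 0)) := by
          refine (norm_sum_le _ _).trans (sum_le_sum fun n hn => (norm_sum_le _ _).trans (sum_le_sum fun n' hn' => hpair n hn n' hn'))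
      _ ≤ ∑ n ∈ Ioc 0 X, L ^ 2 * (((X : ℝ) / q + 1) * (M + 2 * q * (1 + Real.log q))) := by
          refine sum_le_sum fun n hn => ?_
          rw [← mul_sum, sum_add_distrib, ← mul_sum]
          have b1 := vkF_range_sum ha (n : ℤ) 0 X (Nat.zero_le _)
          have b2 := vk_periodic_sum q (fun z => if z = (n : ZMod q) then 1 else 0) (fun z => by split_ifs <;> norm_num) 0 X (Nat.zero_le _)
          simp only [sum_ite_eq', mem_univ, if_true, Nat.cast_zero, sub_zero, mul_one] at b1 b2
          refine mul_le_mul_of_nonneg_left ?_ (by positivity)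
          have : (M : ℝ) * ∑ n' ∈ Ioc 0 X, (if (n' : ZMod q) = (n : ZMod q) then (1 : ℝ) else 0) ≤ M * ((X : ℝ) / q + 1) := by gcongr
          linarith
      _ = X * (L ^ 2 * (((X : ℝ) / q + 1) * (M + 2 * q * (1 + Real.log q)))) := by simp
      _ ≤ (N / M) * (L ^ 2 * (((N / M : ℝ) / q + 1) * (M + 2 * q * (1 + Real.log q)))) := by gcongr
      _ = _ := by ring
  have hCS : ‖∑ m ∈ Ioc M (2 * M), (Λ m : ℂ) * ∑ n ∈ Ioc 0 X, E m n‖ ^ 2 ≤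
      (∑ m ∈ Ioc M (2 * M), Λ m ^ 2) * ∑ m ∈ Ioc M (2 * M), ‖∑ n ∈ Ioc 0 X, E m n‖ ^ 2 := by
    refine le_trans ?_ (sum_mul_sq_le_sq_mul_sq _ _ _)
    gcongr
    refine (norm_sum_le _ _).trans (le_of_eq ?_)
    refine sum_congr rfl fun m _ => ?_
    rw [norm_mul, Complex.norm_real, Real.norm_of_nonneg vonMangoldt_nonneg]
  refine hCS.trans ?_
  calc _ ≤ L * (12 * M) * (L ^ 2 * (N / M) * (((N / M : ℝ) / q + 1) * (M + 2 * q * (1 + Real.log q)))) := by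
        refine mul_le_mul hΛ2 hquad (sum_nonneg fun _ _ => by positivity) (by positivity)
    _ = _ := by field_simp
end PartA8

section PartA9
open ArithmeticFunction
open scoped ArithmeticFunction.Moebius ArithmeticFunction.zeta

theorem vk_hyper_swap {β : Type*} [AddCommMonoid β] {V N : ℕ} (hV : 1 ≤ V) (f : ℕ → ℕ → β) :
    ∑ m ∈ Ioc V N, ∑ n ∈ Ioc 0 (N / m), f m n = ∑ n ∈ Ioc 0 (N / V), ∑ m ∈ Ioc V (N / n), f m n := by
  refine sum_comm' ?_
  intro m n
  simp only [mem_Ioc]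
  constructor
  · rintro ⟨⟨h1, h2⟩, h3, h4⟩
    rw [Nat.le_div_iff_mul_le (by omega)] at h4
    refine ⟨⟨h1, ?_⟩, h3, ?_⟩
    · rw [Nat.le_div_iff_mul_le h3]; linarith [mul_comm m n]
    · rw [Nat.le_div_iff_mul_le hV]; exact le_trans (Nat.mul_le_mul_left n h1.le) h4
  · rintro ⟨⟨h1, h2⟩, h3, h4⟩
    rw [Nat.le_div_iff_mul_le h3] at h2
    refine ⟨⟨h1, le_trans (Nat.le_mul_of_pos_right m h3) h2⟩, h3, ?_⟩
    rw [Nat.le_div_iff_mul_le (by omega)]; linarith [mul_comm m n]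

theorem vk_dyadic {β : Type*} [AddCommMonoid β] (f : ℕ → β) {i0 i1 : ℕ} (h : i0 ≤ i1) :
    ∑ m ∈ Ioc (2 ^ i0) (2 ^ i1), f m = ∑ j ∈ Ico i0 i1, ∑ m ∈ Ioc (2 ^ j) (2 ^ (j + 1)), f m := by
  induction i1, h using Nat.le_induction with
  | base => simp
  | succ n hn ih =>
    rw [sum_Ico_succ_top hn, ← ih, sum_Ioc_consecutive]
    · exact Nat.pow_le_pow_right (by norm_num) hn
    · exact Nat.pow_le_pow_right (by norm_num) (by omega)

theorem vk_pow2 {x : ℝ} (hx : 1 ≤ x) : ∃ i : ℕ, x ≤ ((2 ^ i : ℕ) : ℝ) ∧ ((2 ^ i : ℕ) : ℝ) ≤ 2 * x := by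
  obtain ⟨n, h1, h2⟩ := exists_nat_pow_near hx (by norm_num : (1 : ℝ) < 2)
  refine ⟨n + 1, ?_, ?_⟩
  · push_cast; exact h2.le
  · push_cast; rw [pow_succ]; linarith

theorem vk_pow2_log {i N : ℕ} (h : 2 ^ i ≤ N) : (i : ℝ) ≤ 2 * Real.log N := by
  have h1 : Real.log ((2 ^ i : ℕ) : ℝ) ≤ Real.log N := Real.log_le_log (by positivity) (by exact_mod_cast h)
  push_cast at h1
  rw [Real.log_pow] at h1
  have := Real.log_two_gt_d9
  have hi : (0 : ℝ) ≤ i := by positivity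
  nlinarith

theorem vk_log_tail : ∀ᶠ N : ℕ in atTop, ∑ n ∈ Ioc 0 N, Λ n * (Real.log N - Real.log n) ≤ 6 * N * (1 + 2 * Real.log (Real.log N)) := by
  filter_upwards [vk_choose_D 1, vk_tendsto_log.eventually (eventually_ge_atTop (1 : ℝ))] with N hD hL1
  obtain ⟨D, hD1, hDN, hDle, -, hl0, hl⟩ := hD
  have hN0 : (0 : ℝ) < N := by exact_mod_cast (by omega : 0 < N)
  have hD0 : (0 : ℝ) < D := by exact_mod_cast (by omega : 0 < D)
  set L := Real.log N with hL
  set ℓ := Real.log L with hℓ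
  have hℓ0 : 0 ≤ ℓ := Real.log_nonneg hL1
  rw [← sum_Ioc_consecutive _ (Nat.zero_le D) hDN]
  have h1 : ∑ n ∈ Ioc 0 D, Λ n * (L - Real.log n) ≤ 6 * N := by
    calc _ ≤ ∑ n ∈ Ioc 0 D, Λ n * L := by
          refine sum_le_sum fun n hn => mul_le_mul_of_nonneg_left ?_ vonMangoldt_nonneg
          linarith [Real.log_natCast_nonneg n]
      _ ≤ (6 * D) * L := by
          rw [← sum_mul]
          exact mul_le_mul_of_nonneg_right (vk_psi D) (by linarith)
      _ ≤ _ := by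
          rw [pow_one, le_div_iff₀ (by linarith)] at hDle; linarith
  have h2 : ∑ n ∈ Ioc D N, Λ n * (L - Real.log n) ≤ 6 * N * (2 * ℓ) := by
    calc _ ≤ ∑ n ∈ Ioc D N, Λ n * (2 * ℓ) := by
          refine sum_le_sum fun n hn => mul_le_mul_of_nonneg_left ?_ vonMangoldt_nonneg
          rw [mem_Ioc] at hn
          rw [Real.log_div hN0.ne' hD0.ne'] at hl
          have : Real.log D ≤ Real.log n := Real.log_le_log hD0 (by exact_mod_cast hn.1.le)
          push_cast at hl
          linarith
      _ ≤ (6 * N) * (2 * ℓ) := by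
          rw [← sum_mul]
          refine mul_le_mul_of_nonneg_right (le_trans ?_ (vk_psi N)) (by linarith)
          exact sum_le_sum_of_subset_of_nonneg (Ioc_subset_Ioc_left (Nat.zero_le _)) (fun _ _ _ => vonMangoldt_nonneg)
  linarith

theorem vk_trivial_small {U N : ℕ} (hU : 1 ≤ U) :
    ∑ m ∈ Ioc 0 U, Λ m * ∑ n ∈ Ioc 0 (N / m), Λ n ≤ 6 * N * (Real.log U + 6) := by
  calc _ ≤ ∑ m ∈ Ioc 0 U, 6 * N * (Λ m / m) := by
        refine sum_le_sum fun m hm => ?_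
        have h1 : ∑ n ∈ Ioc 0 (N / m), Λ n ≤ 6 * (N / m : ℝ) := (vk_psi _).trans (by gcongr; exact Nat.cast_div_le)
        calc _ ≤ Λ m * (6 * (N / m : ℝ)) := mul_le_mul_of_nonneg_left h1 vonMangoldt_nonneg
          _ = _ := by ring
    _ ≤ _ := by
        rw [← mul_sum]
        exact mul_le_mul_of_nonneg_left (vk_mertens U hU) (by positivity)

theorem vk_norm_double (N : ℕ) (s : Finset ℕ) (w : ℕ → ℂ) (hw : ∀ n, ‖w n‖ ≤ 1) :
    ‖∑ m ∈ s, (Λ m : ℂ) * ∑ n ∈ Ioc 0 (N / m), (Λ n : ℂ) * w (m * n)‖ ≤ ∑ m ∈ s, Λ m * ∑ n ∈ Ioc 0 (N / m), Λ n := by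
  refine (norm_sum_le _ _).trans (sum_le_sum fun m _ => ?_)
  rw [norm_mul, Complex.norm_real, Real.norm_of_nonneg vonMangoldt_nonneg]
  refine mul_le_mul_of_nonneg_left ((norm_sum_le _ _).trans (sum_le_sum fun n _ => ?_)) vonMangoldt_nonneg
  rw [norm_mul, Complex.norm_real, Real.norm_of_nonneg vonMangoldt_nonneg]
  exact mul_le_of_le_one_right vonMangoldt_nonneg (hw _)

theorem vk_bilin_minor {N q i0 i1 : ℕ} [NeZero q] {a : ℤ} {α L : ℝ} (hL : L = Real.log N) (hL1 : 1 ≤ L) (ha : IsUnit (a : ZMod q))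
    (hi : i0 ≤ i1) (hi0 : 2 * L ^ 8 ≤ (2 ^ i0 : ℕ)) (hi1 : ((2 ^ i1 : ℕ) : ℝ) ≤ 2 * (N / L ^ 8)) (hi1N : 2 ^ i1 ≤ N)
    (hq1 : L ^ 8 ≤ q) (hq2 : (q : ℝ) ≤ N / L ^ 8) (hβ : |α - a / q| ≤ L ^ 8 / (q * N)) :
    ‖∑ m ∈ Ioc 0 N, (Λ m : ℂ) * ∑ n ∈ Ioc 0 (N / m), (Λ n : ℂ) * vke ((m * n : ℕ) * α)‖ ≤
      6 * N * (Real.log (2 ^ i0 : ℕ) + 6) + 6 * N * (Real.log (N / (2 ^ i1 : ℕ)) + 6) + 22 * N := by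
  have hN1 : 1 ≤ N := le_trans Nat.one_le_two_pow hi1N
  have hN0 : (0 : ℝ) < N := by exact_mod_cast hN1
  have hq := Nat.pos_of_ne_zero (NeZero.ne q)
  have hq0 : (0 : ℝ) < q := by exact_mod_cast hq
  have hU1 : 1 ≤ 2 ^ i0 := Nat.one_le_two_pow
  have hV1 : 1 ≤ 2 ^ i1 := Nat.one_le_two_pow
  have hUV : 2 ^ i0 ≤ 2 ^ i1 := Nat.pow_le_pow_right (by norm_num) hi
  have hL8 : 1 ≤ L ^ 8 := one_le_pow₀ hL1
  rw [← sum_Ioc_consecutive _ (Nat.zero_le (2 ^ i1)) hi1N, ← sum_Ioc_consecutive _ (Nat.zero_le (2 ^ i0)) hUV]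
  have hw : ∀ n : ℕ, ‖vke (n * α)‖ ≤ 1 := fun n => (vke_norm _).le
  have h1 := (vk_norm_double N (Ioc 0 (2 ^ i0)) (fun n => vke (n * α)) hw).trans (vk_trivial_small hU1)
  have h3 : ‖∑ m ∈ Ioc (2 ^ i1) N, (Λ m : ℂ) * ∑ n ∈ Ioc 0 (N / m), (Λ n : ℂ) * vke ((m * n : ℕ) * α)‖ ≤ 6 * N * (Real.log (N / (2 ^ i1 : ℕ)) + 6) := by
    refine (vk_norm_double N (Ioc (2 ^ i1) N) (fun n => vke (n * α)) hw).trans ?_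
    simp only [mul_sum]
    rw [vk_hyper_swap hV1]
    have hU' : 1 ≤ N / 2 ^ i1 := (Nat.one_le_div_iff (by positivity)).2 hi1N
    refine le_trans ?_ ((vk_trivial_small (N := N) hU').trans ?_)
    · refine sum_le_sum fun n hn => ?_
      rw [mul_sum]
      refine le_trans (sum_le_sum_of_subset_of_nonneg (Ioc_subset_Ioc_left (Nat.zero_le _)) (fun _ _ _ => mul_nonneg vonMangoldt_nonneg vonMangoldt_nonneg)) (le_of_eq ?_)
      exact sum_congr rfl fun _ _ => mul_comm _ _
    · gcongr
      exact Nat.cast_div_le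
  have h2 : ‖∑ m ∈ Ioc (2 ^ i0) (2 ^ i1), (Λ m : ℂ) * ∑ n ∈ Ioc 0 (N / m), (Λ n : ℂ) * vke ((m * n : ℕ) * α)‖ ≤ 22 * N := by
    rw [vk_dyadic _ hi]
    have hb : ∀ j ∈ Ico i0 i1, ‖∑ m ∈ Ioc (2 ^ j) (2 ^ (j + 1)), (Λ m : ℂ) * ∑ n ∈ Ioc 0 (N / m), (Λ n : ℂ) * vke ((m * n : ℕ) * α)‖ ≤ 11 * N / L ^ 2 := by
      intro j hj
      rw [mem_Ico] at hj
      have hM1 : 1 ≤ 2 ^ j := Nat.one_le_two_pow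
      have hM2 : 2 * 2 ^ j ≤ 2 ^ i1 := by
        rw [mul_comm, ← pow_succ]; exact Nat.pow_le_pow_right (by norm_num) hj.2
      have hM3 : 2 ^ i0 ≤ 2 ^ j := Nat.pow_le_pow_right (by norm_num) hj.1
      rw [show 2 ^ (j + 1) = 2 * 2 ^ j by ring]
      set M := 2 ^ j with hM
      have hM0 : (1 : ℝ) ≤ M := by exact_mod_cast hM1
      have hMl : 2 * L ^ 8 ≤ M := hi0.trans (by exact_mod_cast hM3)
      have hMu : 2 * (M : ℝ) ≤ 2 * (N / L ^ 8) := le_trans (by exact_mod_cast hM2) hi1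
      have hMu' : (M : ℝ) ≤ N / L ^ 8 := by linarith
      have hβ' : ((N : ℝ) / M) * |α - a / q| ≤ 1 / (2 * q) := by
        calc _ ≤ ((N : ℝ) / M) * (L ^ 8 / (q * N)) := by gcongr
          _ = L ^ 8 / M / q := by field_simp
          _ ≤ (1 / 2) / q := by
              refine div_le_div_of_nonneg_right ?_ hq0.le
              rw [div_le_div_iff₀ (by linarith) (by norm_num)]; linarith
          _ = _ := by field_simp
      have hbl := vk_bilin_block ha hM1 (hM2.trans hi1N) hβ'
      rw [← hL] at hbl
      have hqN : (q : ℝ) ≤ N := hq2.trans (div_le_self hN0.le hL8)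
      have hlq : Real.log q ≤ L := by rw [hL]; exact Real.log_le_log hq0 hqN
      have hlq0 : 0 ≤ Real.log q := Real.log_natCast_nonneg q
      have hkey : ((N / M : ℝ) / q + 1) * (M + 2 * q * (1 + Real.log q)) ≤ 8 * L * (N / L ^ 8) := by
        have e : ((N / M : ℝ) / q + 1) * (M + 2 * q * (1 + Real.log q)) = N / q + M + 2 * (N / M) * (1 + Real.log q) + 2 * q * (1 + Real.log q) := by
          field_simp; ring
        rw [e]
        set W := (N : ℝ) / L ^ 8 with hW
        have hW0 : 0 ≤ W := by positivity
        have e1 : (N : ℝ) / q ≤ W := by rw [hW]; gcongr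
        have e2 : (N : ℝ) / M ≤ W / 2 := by
          rw [hW, div_div, mul_comm]; gcongr
        have hl2 : 1 + Real.log q ≤ 2 * L := by linarith
        have e3 : 2 * ((N : ℝ) / M) * (1 + Real.log q) ≤ 2 * (W / 2) * (2 * L) := by gcongr
        have e4 : 2 * (q : ℝ) * (1 + Real.log q) ≤ 2 * W * (2 * L) := by gcongr
        nlinarith
      have hfin : 12 * L ^ 3 * N * (((N / M : ℝ) / q + 1) * (M + 2 * q * (1 + Real.log q))) ≤ (11 * N / L ^ 2) ^ 2 := by
        calc _ ≤ 12 * L ^ 3 * N * (8 * L * (N / L ^ 8)) := by gcongr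
          _ = 96 * (N / L ^ 2) ^ 2 := by field_simp; ring
          _ ≤ 121 * (N / L ^ 2) ^ 2 := by gcongr; norm_num
          _ = _ := by ring
      exact le_of_sq_le_sq (hbl.trans hfin) (by positivity)
    refine (norm_sum_le _ _).trans ((sum_le_sum hb).trans ?_)
    rw [sum_const, Nat.card_Ico, nsmul_eq_mul]
    have hj : ((i1 - i0 : ℕ) : ℝ) ≤ 2 * L := by
      refine le_trans ?_ (hL ▸ vk_pow2_log hi1N)
      exact_mod_cast Nat.sub_le _ _
    calc _ ≤ 2 * L * (11 * N / L ^ 2) := by gcongr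
      _ = 22 * N / L := by field_simp; ring
      _ ≤ _ := div_le_self (by positivity) hL1
  refine (norm_add_le _ _).trans ?_
  have := norm_add_le (∑ m ∈ Ioc 0 (2 ^ i0), (Λ m : ℂ) * ∑ n ∈ Ioc 0 (N / m), (Λ n : ℂ) * vke ((m * n : ℕ) * α)) (∑ m ∈ Ioc (2 ^ i0) (2 ^ i1), (Λ m : ℂ) * ∑ n ∈ Ioc 0 (N / m), (Λ n : ℂ) * vke ((m * n : ℕ) * α))
  linarith

set_option maxHeartbeats 1000000 in
theorem vk_minor (ε : ℝ) (hε : 0 < ε) : ∀ᶠ N : ℕ in atTop, ∀ (q : ℕ) (a : ℤ) (α : ℝ), IsUnit (a : ZMod q) →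
    Real.log N ^ 8 ≤ q → (q : ℝ) ≤ N / Real.log N ^ 8 → |α - a / q| ≤ Real.log N ^ 8 / (q * N) →
    ‖∑ n ∈ Ioc 0 N, (Λ n : ℂ) * vke (n * α)‖ ≤ ε * N := by
  filter_upwards [vk_choose_D 10, vk_log_tail, vk_tendsto_log.eventually (eventually_ge_atTop (3 : ℝ)),
    vk_tendsto_log.eventually (vk_ev_log (2000 / ε) 3), vk_tendsto_log.eventually (vk_ev_exp 4 16), vk_tendsto_log.eventually (vk_ev_exp 1 2)]
    with N hD hlt hL3 hev hexp hexp2 q a α ha hq1 hq2 hβ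
  obtain ⟨D, hD1, hDN, hDle, -, hl0, hl⟩ := hD
  have hN1 : 1 ≤ N := hD1.trans hDN
  have hN0 : (0 : ℝ) < N := by exact_mod_cast hN1
  rw [Real.exp_log hN0] at hexp hexp2
  set L := Real.log N with hL
  set ℓ := Real.log L with hℓ
  have hL1 : 1 ≤ L := by linarith
  have hℓ1 : 1 ≤ ℓ := by
    rw [hℓ, Real.le_log_iff_exp_le (by linarith)]
    linarith [Real.exp_one_lt_d9]
  have hL8 : 1 ≤ L ^ 8 := one_le_pow₀ hL1
  have hq0 : (0 : ℝ) < q := by linarith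
  have hqn : q ≠ 0 := by rintro rfl; simp at hq0
  have : NeZero q := ⟨hqn⟩
  obtain ⟨i0, hi0, hi0'⟩ := vk_pow2 (x := 2 * L ^ 8) (by linarith)
  have hW1 : 4 * L ^ 8 ≤ N / L ^ 8 := by
    rw [le_div_iff₀ (by linarith)]
    calc 4 * L ^ 8 * L ^ 8 = 4 * L ^ 16 := by ring
      _ ≤ _ := hexp
  obtain ⟨i1, hi1, hi1'⟩ := vk_pow2 (x := N / L ^ 8) (by linarith)
  have hi : i0 ≤ i1 := by
    have : ((2 ^ i0 : ℕ) : ℝ) ≤ (2 ^ i1 : ℕ) := by linarith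
    exact (Nat.pow_le_pow_iff_right (a := 2) (by norm_num)).1 (by exact_mod_cast this)
  have hL82 : 2 ≤ L ^ 8 := by
    calc (2 : ℝ) ≤ 3 := by norm_num
      _ ≤ L := hL3
      _ ≤ L ^ 8 := le_self_pow₀ hL1 (by norm_num)
  have hi1N : 2 ^ i1 ≤ N := by
    have : ((2 ^ i1 : ℕ) : ℝ) ≤ N := by
      refine hi1'.trans ?_
      rw [← mul_div_assoc, div_le_iff₀ (by linarith)]
      nlinarith
    exact_mod_cast this
  have hbil := vk_bilin_minor hL hL1 ha hi hi0 hi1' hi1N hq1 hq2 hβ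
  have hqN : (q : ℝ) ≤ N := hq2.trans (div_le_self hN0.le hL8)
  have hlq : Real.log q ≤ L := Real.log_le_log hq0 hqN
  have hlq0 : 0 ≤ Real.log q := Real.log_natCast_nonneg q
  have hD0 : (0 : ℝ) < D := by exact_mod_cast hD1
  have hI := vk_typeI (N := N) (D := D) (α := α) ha hD1 hDN (by
    calc (D : ℝ) * |α - a / q| ≤ (N / L ^ 10) * (L ^ 8 / (q * N)) := by gcongr
      _ = (1 / L ^ 2) / q := by field_simp
      _ ≤ (1 / 2) / q := by
          refine div_le_div_of_nonneg_right ?_ hq0.le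
          rw [div_le_div_iff₀ (by positivity) (by norm_num)]; nlinarith
      _ = _ := by field_simp)
  rw [← hL] at hI
  have hlU : Real.log (2 ^ i0 : ℕ) ≤ 2 + 8 * ℓ := by
    calc Real.log (2 ^ i0 : ℕ) ≤ Real.log (4 * L ^ 8) := Real.log_le_log (by positivity) (by linarith)
      _ = Real.log 4 + 8 * ℓ := by
          rw [Real.log_mul (by norm_num) (by positivity), Real.log_pow]; push_cast; rfl
      _ ≤ _ := by
          have : Real.log 4 = 2 * Real.log 2 := by
            rw [show (4 : ℝ) = 2 ^ 2 by norm_num, Real.log_pow]; norm_num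
          linarith [Real.log_two_lt_d9]
  have hlV : Real.log (N / (2 ^ i1 : ℕ)) ≤ 8 * ℓ := by
    calc Real.log (N / (2 ^ i1 : ℕ)) ≤ Real.log (L ^ 8) := by
          refine Real.log_le_log (by positivity) ?_
          rw [div_le_iff₀ (by positivity)]
          rw [div_le_iff₀ (by positivity)] at hi1
          linarith
      _ = _ := by rw [Real.log_pow]; push_cast; rfl
  have hcomb := vk_combine L N (fun n => vke (n * α))
  have hlogs : ∀ d ∈ Ioc 0 N, (((μ d : ℝ) * (L - Real.log d) ^ 2 : ℝ) : ℂ) * ∑ m ∈ Ioc 0 (N / d), vke ((d * m : ℕ) * α) =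
      (((μ d : ℝ) * Real.log (N / d) ^ 2 : ℝ) : ℂ) * ∑ m ∈ Ioc 0 (N / d), vke ((d * m : ℕ) * α) := by
    intro d hd
    rw [mem_Ioc] at hd
    rw [Real.log_div hN0.ne' (by exact_mod_cast (by omega : d ≠ 0))]
  rw [sum_congr rfl hlogs] at hcomb
  have h1 : ‖∑ n ∈ Ioc 0 N, (if n = 1 then (L : ℂ) ^ 2 else 0) * vke (n * α)‖ ≤ N := by
    simp only [ite_mul, zero_mul]
    rw [sum_ite_eq', if_pos (by simp; omega), norm_mul, vke_norm, norm_pow, Complex.norm_real, Real.norm_of_nonneg (by linarith)]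
    linarith
  have h2 : ‖∑ n ∈ Ioc 0 N, ((Λ n * (L - Real.log n) : ℝ) : ℂ) * vke (n * α)‖ ≤ 6 * N * (1 + 2 * ℓ) := by
    refine (norm_sum_le _ _).trans (le_trans (sum_le_sum fun n hn => ?_) hlt)
    rw [mem_Ioc] at hn
    rw [norm_mul, vke_norm, mul_one, Complex.norm_real, Real.norm_of_nonneg]
    refine mul_nonneg vonMangoldt_nonneg (sub_nonneg.2 (Real.log_le_log (by exact_mod_cast hn.1) (by exact_mod_cast hn.2)))
  have hnorm : L * ‖∑ n ∈ Ioc 0 N, (Λ n : ℂ) * vke (n * α)‖ = ‖(L : ℂ) * ∑ n ∈ Ioc 0 N, (Λ n : ℂ) * vke (n * α)‖ := by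
    rw [norm_mul, Complex.norm_real, Real.norm_of_nonneg (by linarith)]
  have hI2 : L ^ 2 * ((D / q + 1) * (2 * q * (1 + Real.log q))) + L ^ 2 * (N / q * (1 + L)) + N * Real.log (N / D) ^ 3 ≤ N * (10 + 1331 * ℓ ^ 3) := by
    have hD8 : (D : ℝ) ≤ N / L ^ 8 := hDle.trans (by gcongr; norm_num)
    have a1 : L ^ 2 * ((D / q + 1) * (2 * q * (1 + Real.log q))) ≤ 8 * N := by
      calc _ = L ^ 2 * (2 * (D + q) * (1 + Real.log q)) := by field_simp
        _ ≤ L ^ 2 * (2 * (N / L ^ 8 + N / L ^ 8) * (L + L)) := by gcongr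
        _ = 8 * (N / L ^ 5) := by field_simp; ring
        _ ≤ 8 * N := by gcongr; exact div_le_self hN0.le (one_le_pow₀ hL1)
    have a2 : L ^ 2 * (N / q * (1 + L)) ≤ 2 * N := by
      calc _ ≤ L ^ 2 * (N / L ^ 8 * (L + L)) := by gcongr
        _ = 2 * (N / L ^ 5) := by field_simp; ring
        _ ≤ 2 * N := by gcongr; exact div_le_self hN0.le (one_le_pow₀ hL1)
    have a3 : N * Real.log (N / D) ^ 3 ≤ N * (1331 * ℓ ^ 3) := by
      have : Real.log (N / D) ^ 3 ≤ ((10 + 1) * ℓ) ^ 3 := by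
        push_cast at hl; gcongr
      calc _ ≤ N * ((10 + 1) * ℓ) ^ 3 := by gcongr
        _ = _ := by ring
    linarith
  have htot : L * ‖∑ n ∈ Ioc 0 N, (Λ n : ℂ) * vke (n * α)‖ ≤ N * (2000 * ℓ ^ 3) := by
    rw [hnorm, hcomb]
    refine (norm_sub_le _ _).trans ?_
    refine (add_le_add_left (norm_sub_le _ _) _).trans ?_
    refine (add_le_add_left (add_le_add_left (norm_sub_le _ _) _) _).trans ?_
    have hb : 6 * (N : ℝ) * (Real.log (2 ^ i0 : ℕ) + 6) + 6 * N * (Real.log (N / (2 ^ i1 : ℕ)) + 6) + 22 * N ≤ N * (106 + 96 * ℓ) := by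
      have : 6 * (N : ℝ) * (Real.log (2 ^ i0 : ℕ) + 6) ≤ 6 * N * (2 + 8 * ℓ + 6) := by gcongr
      have : 6 * (N : ℝ) * (Real.log (N / (2 ^ i1 : ℕ)) + 6) ≤ 6 * N * (8 * ℓ + 6) := by gcongr
      linarith
    have hl3 : ℓ ≤ ℓ ^ 3 := le_self_pow₀ hℓ1 (by norm_num)
    have : (N : ℝ) * (10 + 1331 * ℓ ^ 3) + N + 6 * N * (1 + 2 * ℓ) + N * (106 + 96 * ℓ) ≤ N * (2000 * ℓ ^ 3) := by
      have : (10 + 1331 * ℓ ^ 3) + 1 + 6 * (1 + 2 * ℓ) + (106 + 96 * ℓ) ≤ 2000 * ℓ ^ 3 := by linarith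
      calc _ = (N : ℝ) * ((10 + 1331 * ℓ ^ 3) + 1 + 6 * (1 + 2 * ℓ) + (106 + 96 * ℓ)) := by ring
        _ ≤ _ := mul_le_mul_of_nonneg_left this hN0.le
    linarith [hI.trans hI2, hbil.trans hb]
  rw [div_mul_eq_mul_div, div_le_iff₀ hε] at hev
  have : L * ‖∑ n ∈ Ioc 0 N, (Λ n : ℂ) * vke (n * α)‖ ≤ L * (ε * N) := by
    refine htot.trans ?_
    calc (N : ℝ) * (2000 * ℓ ^ 3) ≤ N * (L * ε) := by gcongr
      _ = _ := by ring
  exact le_of_mul_le_mul_left this (by linarith)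
end PartA9

section PartA10
open ArithmeticFunction
open scoped ArithmeticFunction.Moebius ArithmeticFunction.zeta

noncomputable def vkw (u q : ℕ) (a : ℤ) (n : ℕ) : ℂ := if u < n then vke (n * ((a : ℝ) / q)) else 0

theorem vkw_norm (u q : ℕ) (a : ℤ) (n : ℕ) : ‖vkw u q a n‖ = if u < n then 1 else 0 := by
  rw [vkw]; split_ifs
  · exact vke_norm _
  · simp

theorem vkw_norm_le (u q : ℕ) (a : ℤ) (n : ℕ) : ‖vkw u q a n‖ ≤ 1 := by
  rw [vkw_norm]; split_ifs <;> norm_num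

theorem vkw_sum {u y q d : ℕ} (a : ℤ) (hd : 0 < d) :
    ∑ m ∈ Ioc 0 (y / d), vkw u q a (d * m) = ∑ m ∈ Ioc (u / d) (y / d), vke ((d * m : ℕ) * ((a : ℝ) / q)) := by
  simp only [vkw]
  rw [← sum_filter]
  refine sum_congr ?_ fun _ _ => rfl
  ext m
  simp only [mem_filter, mem_Ioc, Nat.div_lt_iff_lt_mul hd, mul_comm m d]
  constructor
  · rintro ⟨⟨h1, h2⟩, h3⟩; exact ⟨h3, h2⟩
  · rintro ⟨h1, h2⟩; exact ⟨⟨Nat.pos_of_mul_pos_left (a := d) (by omega), h2⟩, h1⟩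

theorem vkw_N (u y d : ℕ) : (vkN u y 1 0 d : ℝ) = ∑ m ∈ Ioc 0 (y / d), if u < d * m then (1 : ℝ) else 0 := by
  rw [vkN, card_filter]
  push_cast
  refine sum_congr rfl fun m _ => ?_
  have : (d * m ≡ 0 [MOD 1]) := Nat.modEq_one
  simp only [this, and_true]

theorem vkw_sum_norm {u y q d : ℕ} (a : ℤ) :
    ‖∑ m ∈ Ioc 0 (y / d), vkw u q a (d * m)‖ ≤ vkN u y 1 0 d := by
  rw [vkw_N]
  refine (norm_sum_le _ _).trans (le_of_eq ?_)
  exact sum_congr rfl fun m _ => vkw_norm _ _ _ _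

theorem vkw_sum_dvd {u y q d : ℕ} (hq : 0 < q) (a : ℤ) (hqd : q ∣ d) :
    ∑ m ∈ Ioc 0 (y / d), vkw u q a (d * m) = ((vkN u y 1 0 d : ℝ) : ℂ) := by
  rw [vkw_N]
  push_cast
  refine sum_congr rfl fun m _ => ?_
  rw [vkw]
  split_ifs
  · obtain ⟨e, rfl⟩ := hqd
    have hq0 : (q : ℝ) ≠ 0 := by exact_mod_cast hq.ne'
    rw [show ((q * e * m : ℕ) : ℝ) * ((a : ℝ) / q) = ((e * m * a : ℤ) : ℝ) by push_cast; field_simp]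
    rw [vke_int]; simp
  · simp

theorem vk_moebius_mul_eq (q e : ℕ) : (μ (q * e) : ℤ) = if e.Coprime q then μ q * μ e else 0 := by
  split_ifs with h
  · exact isMultiplicative_moebius.map_mul_of_coprime h.symm
  · apply moebius_eq_zero_of_not_squarefree
    intro hs
    exact h (Nat.squarefree_mul_iff.1 hs).1.symm

theorem vk_mult_main {y q : ℕ} (hq : 0 < q) (hy : 1 ≤ y) :
    |∑ d ∈ (Ioc 0 y).filter (fun d => q ∣ d), (μ d : ℝ) * Real.log (y / d) ^ 2 / d| ≤ 84 * (1 + Real.log y) * vkH q / q := by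
  have hq0 : (1 : ℝ) ≤ q := by exact_mod_cast hq
  rw [vk_sum_mult q y hq (fun d => (μ d : ℝ) * Real.log (y / d) ^ 2 / d)]
  have e : ∑ e ∈ Ioc 0 (y / q), (μ (q * e) : ℝ) * Real.log (y / (q * e : ℕ)) ^ 2 / (q * e : ℕ) = (μ q : ℝ) / q * vkMq q (y / q) := by
    rw [vkMq, sum_filter, mul_sum, Nat.floor_div_natCast, Nat.floor_natCast]
    refine sum_congr rfl fun e _ => ?_
    rw [vk_moebius_mul_eq]
    split_ifs
    · push_cast
      rw [div_div]
      rw [div_mul_eq_mul_div, div_mul_eq_mul_div, mul_div_assoc, mul_div_assoc, mul_div_assoc, mul_comm (q : ℝ) e]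
      rw [mul_div_assoc']
      field_simp
    · simp
  rw [e, abs_mul, abs_div, Nat.abs_cast]
  have h1 := vkMq_bound (q := q) hq.ne' (T := y) (t := y / q) (by exact_mod_cast hy) (div_le_self (by positivity) hq0)
  calc _ ≤ 1 / q * (84 * (1 + Real.log y) * vkH q) := by
        gcongr; exact vk_abs_moebius q
    _ = _ := by ring

theorem vk_typeI_major {u y D q : ℕ} [NeZero q] {a : ℤ} (ha : IsUnit (a : ZMod q)) (hD : 1 ≤ D) (hDy : D ≤ y) (huy : u ≤ y) :
    ‖∑ d ∈ Ioc 0 y, (((μ d : ℝ) * Real.log (y / d) ^ 2 : ℝ) : ℂ) * ∑ m ∈ Ioc 0 (y / d), vkw u q a (d * m)‖ ≤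
      Real.log y ^ 2 * ((D / q + 1) * (2 * q * (1 + Real.log q))) + (y - u) * (84 * (1 + Real.log y) * vkH q / q)
        + (y - u) * Real.log (y / D) ^ 3 + 2 * D * Real.log y ^ 2
        + Real.log (y / D) ^ 2 * ((y - u) * (1 + Real.log (y / D)) + 2 * (y / D)) := by
  have hN1 : 1 ≤ y := hD.trans hDy
  have hN0 : (1 : ℝ) ≤ y := by exact_mod_cast hN1
  have hD0 : (1 : ℝ) ≤ D := by exact_mod_cast hD
  have hDN0 : (D : ℝ) ≤ y := by exact_mod_cast hDy
  have hq := Nat.pos_of_ne_zero (NeZero.ne q)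
  have hq0 : (0 : ℝ) < q := by exact_mod_cast hq
  have hu0 : (u : ℝ) ≤ y := by exact_mod_cast huy
  set h : ℝ := y - u with hh
  have hh0 : 0 ≤ h := by rw [hh]; linarith
  set l := Real.log (y / D) with hl
  set c := Real.log y with hc
  have hl0 : 0 ≤ l := Real.log_nonneg (by rw [le_div_iff₀ (by linarith)]; linarith)
  have hc0 : 0 ≤ c := Real.log_nonneg hN0
  set g : ℕ → ℂ := fun d => (((μ d : ℝ) * Real.log (y / d) ^ 2 : ℝ) : ℂ) with hg
  set I : ℕ → ℂ := fun d => ∑ m ∈ Ioc 0 (y / d), vkw u q a (d * m) with hI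
  change ‖∑ d ∈ Ioc 0 y, g d * I d‖ ≤ _
  have s4 : ‖∑ d ∈ Ioc D y, g d * I d‖ ≤ l ^ 2 * (h * (1 + l) + 2 * (y / D)) := by
    calc _ ≤ ∑ d ∈ Ioc D y, l ^ 2 * (vkN u y 1 0 d : ℝ) := by
          refine (norm_sum_le _ _).trans (sum_le_sum fun d hd => ?_)
          rw [mem_Ioc] at hd
          rw [norm_mul]
          exact mul_le_mul (vk_g_abs_large hD hd.1.le hd.2) (vkw_sum_norm a) (norm_nonneg _) (by positivity)
      _ ≤ l ^ 2 * ∑ m ∈ Ioc 0 (y / D), (vkN u y 1 0 m : ℝ) := by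
          rw [← mul_sum]
          refine mul_le_mul_of_nonneg_left ?_ (sq_nonneg l)
          exact_mod_cast vkN_swap hD
      _ ≤ l ^ 2 * ∑ m ∈ Ioc 0 (y / D), (h * (1 / m) + 2) := by
          refine mul_le_mul_of_nonneg_left (sum_le_sum fun m hm => ?_) (sq_nonneg l)
          rw [mem_Ioc] at hm
          have h1 := vkN_approx (b := 0) hm.1 one_pos huy (Nat.coprime_one_right m)
          have h2 := (abs_le.mp h1).2
          push_cast at h2
          rw [mul_one] at h2
          rw [mul_one_div]; linarith
      _ ≤ _ := by
          rw [sum_add_distrib, ← mul_sum]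
          have hyD1 : 1 ≤ y / D := by rw [Nat.le_div_iff_mul_le (by omega)]; omega
          have h1 := vk_harm (y / D) hyD1
          have h2 : ((y / D : ℕ) : ℝ) ≤ y / D := Nat.cast_div_le
          have h3 : Real.log ((y / D : ℕ) : ℝ) ≤ l := Real.log_le_log (by exact_mod_cast hyD1) h2
          have h4 : ∑ m ∈ Ioc 0 (y / D), (2 : ℝ) ≤ 2 * (y / D) := by
            simp; linarith
          gcongr
          linarith
  have s1 : ‖∑ d ∈ Ioc 0 D, (if q ∣ d then 0 else g d * I d)‖ ≤ c ^ 2 * ((D / q + 1) * (2 * q * (1 + Real.log q))) := by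
    calc _ ≤ ∑ d ∈ Ioc 0 D, c ^ 2 * vkF q ((a * d : ℤ) : ZMod q) := by
          refine (norm_sum_le _ _).trans (sum_le_sum fun d hd => ?_)
          rw [mem_Ioc] at hd
          have hF := vkF_nonneg q ((a * d : ℤ) : ZMod q)
          split_ifs with hqd
          · rw [norm_zero]; positivity
          rw [norm_mul]
          refine mul_le_mul (vk_g_abs_small hd.1 (hd.2.trans hDy)) ?_ (norm_nonneg _) (by positivity)
          have hz : ((a * d : ℤ) : ZMod q) ≠ 0 := by
            intro h
            push_cast at h
            rw [ha.mul_right_eq_zero, ZMod.natCast_eq_zero_iff] at h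
            exact hqd h
          have := vk_geo (α := (a : ℝ) / q) (r := (d : ℤ)) (a := a) (q := q) (by rw [sub_self, abs_zero, mul_zero]; positivity) hz (u / d) (y / d)
          refine le_trans (le_of_eq ?_) this
          simp only [hI]
          rw [vkw_sum a hd.1]; congr 1
          refine sum_congr rfl fun m _ => ?_
          congr 1; push_cast; ring
      _ = c ^ 2 * ∑ d ∈ Ioc 0 D, vkF q ((a * d : ℤ) : ZMod q) := by rw [← mul_sum]
      _ ≤ _ := by
          gcongr
          have := vkF_range_sum (q := q) (a := -a) (by push_cast; exact ha.neg) 0 0 D (Nat.zero_le _)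
          simpa using this
  set gr : ℕ → ℝ := fun d => (μ d : ℝ) * Real.log (y / d) ^ 2 with hgr
  have hgn : ∀ d, |gr d| = ‖g d‖ := fun d => by rw [hg]; simp only [Complex.norm_real]; rfl
  have s2 : |∑ d ∈ Ioc 0 D, (if q ∣ d then gr d * vkN u y 1 0 d - h * (gr d / d) else 0)| ≤ 2 * D * c ^ 2 := by
    calc _ ≤ ∑ d ∈ Ioc 0 D, 2 * c ^ 2 := by
          refine (Finset.abs_sum_le_sum_abs _ _).trans (sum_le_sum fun d hd => ?_)
          rw [mem_Ioc] at hd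
          split_ifs
          · have h1 := vkN_approx (b := 0) hd.1 one_pos huy (Nat.coprime_one_right d)
            push_cast at h1
            rw [mul_one] at h1
            rw [show gr d * vkN u y 1 0 d - h * (gr d / d) = gr d * (vkN u y 1 0 d - h / d) by ring, abs_mul, hgn]
            calc _ ≤ c ^ 2 * 2 := mul_le_mul (vk_g_abs_small hd.1 (hd.2.trans hDy)) h1 (abs_nonneg _) (by positivity)
              _ = _ := by ring
          · rw [abs_zero]; positivity
      _ = _ := by simp; ring
  have s3 : |∑ d ∈ Ioc D y, (if q ∣ d then gr d / d else 0)| ≤ l ^ 3 := by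
    calc _ ≤ ∑ d ∈ Ioc D y, l ^ 2 * (1 / (d : ℝ)) := by
          refine (Finset.abs_sum_le_sum_abs _ _).trans (sum_le_sum fun d hd => ?_)
          rw [mem_Ioc] at hd
          have : |gr d| ≤ l ^ 2 := by rw [hgn]; exact vk_g_abs_large hD hd.1.le hd.2
          split_ifs
          · rw [abs_div, Nat.abs_cast, mul_one_div]; gcongr
          · rw [abs_zero]; positivity
      _ ≤ l ^ 2 * l := by
          rw [← mul_sum]
          gcongr
          exact vk_harm_tail hD hDy
      _ = _ := by ring
  have s5 := vk_mult_main hq hN1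
  rw [sum_filter, ← sum_Ioc_consecutive _ (Nat.zero_le D) hDy] at s5
  have hdec : ∑ d ∈ Ioc 0 y, g d * I d = ∑ d ∈ Ioc 0 D, (if q ∣ d then 0 else g d * I d) +
      ((∑ d ∈ Ioc 0 D, (if q ∣ d then gr d * vkN u y 1 0 d - h * (gr d / d) else 0)
        + h * ∑ d ∈ Ioc 0 D, (if q ∣ d then gr d / d else 0) : ℝ) : ℂ) + ∑ d ∈ Ioc D y, g d * I d := by
    rw [← sum_Ioc_consecutive _ (Nat.zero_le D) hDy, mul_sum, ← sum_add_distrib, Complex.ofReal_sum, ← sum_add_distrib]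
    congr 1
    refine sum_congr rfl fun d hd => ?_
    split_ifs with hqd
    · rw [hI]; simp only
      rw [vkw_sum_dvd hq a hqd]
      simp only [hg, hgr]; push_cast; ring
    · simp
  rw [hdec]
  refine (norm_add₃_le).trans ?_
  rw [Complex.norm_real, Real.norm_eq_abs]
  have t : |∑ d ∈ Ioc 0 D, (if q ∣ d then gr d * vkN u y 1 0 d - h * (gr d / d) else 0)
        + h * ∑ d ∈ Ioc 0 D, (if q ∣ d then gr d / d else 0)| ≤ 2 * D * c ^ 2 + h * (84 * (1 + c) * vkH q / q + l ^ 3) := by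
    refine (abs_add_le _ _).trans (add_le_add s2 ?_)
    rw [abs_mul, abs_of_nonneg hh0]
    refine mul_le_mul_of_nonneg_left ?_ hh0
    change |∑ d ∈ Ioc 0 D, (if q ∣ d then gr d / d else 0) + ∑ d ∈ Ioc D y, (if q ∣ d then gr d / d else 0)| ≤ _ at s5
    rw [abs_le] at *
    constructor <;> linarith [s3.1, s3.2, s5.1, s5.2]
  linarith
end PartA10

section PartA11
open ArithmeticFunction
open scoped ArithmeticFunction.Moebius ArithmeticFunction.zeta

theorem vk_nc_mass (q y : ℕ) (hq : 0 < q) :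
    ∑ n ∈ (Ioc 0 y).filter (fun n => ¬ n.Coprime q), Λ n ≤ q * (2 * Real.log y + 1) * Real.log y := by
  have hy0 := Real.log_natCast_nonneg y
  set s := ((Ioc 0 y).filter (fun n => ¬ n.Coprime q)).filter (fun n => Λ n ≠ 0) with hs
  have h1 : ∑ n ∈ (Ioc 0 y).filter (fun n => ¬ n.Coprime q), Λ n = ∑ n ∈ s, Λ n := (sum_filter_ne_zero _).symm
  rw [h1]
  have h2 : s ⊆ (q.primeFactors ×ˢ range (Nat.log 2 y + 1)).image (fun x => x.1 ^ x.2) := by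
    intro n hn
    simp only [hs, mem_filter, mem_Ioc, vonMangoldt_ne_zero_iff] at hn
    obtain ⟨⟨⟨hn0, hny⟩, hnc⟩, hpp⟩ := hn
    obtain ⟨p, k, hp, hk, rfl⟩ := (isPrimePow_nat_iff _).1 hpp
    simp only [mem_image, mem_product, mem_range, Prod.exists]
    refine ⟨p, k, ⟨?_, ?_⟩, rfl⟩
    · rw [Nat.mem_primeFactors]
      refine ⟨hp, ?_, hq.ne'⟩
      by_contra h
      exact hnc (Nat.Coprime.pow_left k ((Nat.Prime.coprime_iff_not_dvd hp).2 h))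
    · refine Nat.lt_succ_of_le (Nat.le_log_of_pow_le (by norm_num) (le_trans ?_ hny))
      exact Nat.pow_le_pow_left hp.two_le k
  have h3 : (s.card : ℝ) ≤ q * (2 * Real.log y + 1) := by
    have c1 := (card_le_card h2).trans card_image_le
    rw [card_product, card_range] at c1
    have c2 : q.primeFactors.card ≤ q := by
      have h := card_le_card (fun p hp => mem_Icc.2 ⟨(Nat.prime_of_mem_primeFactors hp).one_le, Nat.le_of_mem_primeFactors hp⟩ : q.primeFactors ⊆ Icc 1 q)
      simpa using h
    have c3 : ((Nat.log 2 y : ℕ) : ℝ) ≤ 2 * Real.log y := by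
      rcases Nat.eq_zero_or_pos y with rfl | hy
      · simp
      · exact vk_pow2_log (Nat.pow_log_le_self 2 hy.ne')
    calc (s.card : ℝ) ≤ (q.primeFactors.card : ℝ) * ((Nat.log 2 y : ℕ) + 1) := by exact_mod_cast c1
      _ ≤ _ := by gcongr
  calc _ ≤ ∑ n ∈ s, Real.log y := by
        refine sum_le_sum fun n hn => ?_
        simp only [hs, mem_filter, mem_Ioc] at hn
        exact vk_Lambda_le_log hn.1.1.2
    _ = s.card * Real.log y := by simp
    _ ≤ _ := by gcongr

theorem vk_bt2 (B : ℕ) : ∀ᶠ y : ℕ in atTop, ∀ u q b : ℕ, u ≤ y → 0 < q → (q : ℝ) ≤ Real.log y ^ B →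
    (y : ℝ) / Real.log y ^ B ≤ y - u →
    ∑ n ∈ (Ioc u y).filter (fun n => n ≡ b [MOD q]), Λ n ≤ 173 * vkH q * ((y - u) / q) := by
  filter_upwards [vk_bt B, vk_tendsto_log.eventually (vk_ev_exp 3 (3 * B + 2)), vk_tendsto_log.eventually (eventually_ge_atTop (1 : ℝ)), eventually_ge_atTop 1]
    with y hbt hexp hL1 hy1 u q b huy hq hqL hlen
  have hy0 : (0 : ℝ) < y := by exact_mod_cast hy1
  have hq0 : (0 : ℝ) < q := by exact_mod_cast hq
  rw [Real.exp_log hy0] at hexp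
  have h1 := hbt u q b huy hq hqL hlen
  have hu0 : (u : ℝ) ≤ y := by exact_mod_cast huy
  have hH := vkH_one_le q
  have h2 := vk_nc_mass q y hq
  set L := Real.log y with hL
  have h3 : ∑ n ∈ (Ioc u y).filter (fun n => n ≡ b [MOD q]), Λ n ≤
      ∑ n ∈ (Ioc u y).filter (fun n => n ≡ b [MOD q] ∧ n.Coprime q), Λ n + ∑ n ∈ (Ioc 0 y).filter (fun n => ¬ n.Coprime q), Λ n := by
    rw [← sum_filter_add_sum_filter_not ((Ioc u y).filter (fun n => n ≡ b [MOD q])) (fun n => n.Coprime q)]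
    rw [filter_filter]
    refine add_le_add le_rfl (sum_le_sum_of_subset_of_nonneg ?_ fun _ _ _ => vonMangoldt_nonneg)
    intro n hn
    simp only [mem_filter, mem_Ioc] at hn ⊢
    exact ⟨⟨by omega, hn.1.1.2⟩, hn.2⟩
  have h4 : (q : ℝ) * (2 * L + 1) * L ≤ (y - u) / q := by
    calc (q : ℝ) * (2 * L + 1) * L ≤ L ^ B * (2 * L + L) * L := by gcongr
      _ = 3 * L ^ (3 * B + 2) / L ^ B / L ^ B := by field_simp; ring
      _ ≤ y / L ^ B / L ^ B := by gcongr
      _ ≤ (y - u) / q := by gcongr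
  have h5 : 0 ≤ ((y : ℝ) - u) / q := div_nonneg (by linarith) hq0.le
  nlinarith

theorem vke_std {q : ℕ} [NeZero q] (a : ℤ) (m n : ℕ) : vke ((m * n : ℕ) * ((a : ℝ) / q)) = ZMod.stdAddChar ((a : ZMod q) * (m : ZMod q) * (n : ZMod q)) := by
  have := ZMod.stdAddChar_coe (N := q) (a * m * n)
  push_cast at this
  rw [this, vke]
  congr 1
  push_cast
  ring

theorem vk_parseval {q : ℕ} [NeZero q] {a : ZMod q} (ha : IsUnit a) (f : ZMod q → ℝ) :
    ∑ z : ZMod q, ‖∑ r : ZMod q, (f r : ℂ) * ZMod.stdAddChar (a * z * r)‖ ^ 2 = q * ∑ r, f r ^ 2 := by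
  have hC : ((∑ z : ZMod q, ‖∑ r : ZMod q, (f r : ℂ) * ZMod.stdAddChar (a * z * r)‖ ^ 2 : ℝ) : ℂ) = ((q * ∑ r, f r ^ 2 : ℝ) : ℂ) := by
    rw [Complex.ofReal_sum]
    have e : ∀ z : ZMod q, ((‖∑ r : ZMod q, (f r : ℂ) * ZMod.stdAddChar (a * z * r)‖ ^ 2 : ℝ) : ℂ) =
        ∑ r : ZMod q, ∑ r' : ZMod q, (f r : ℂ) * f r' * ZMod.stdAddChar (z * (a * (r - r'))) := by
      intro z
      rw [Complex.ofReal_pow, ← Complex.mul_conj', map_sum, sum_mul_sum]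
      refine sum_congr rfl fun r _ => sum_congr rfl fun r' _ => ?_
      rw [map_mul (starRingEnd ℂ), Complex.conj_ofReal, ← AddChar.map_neg_eq_conj]
      rw [show z * (a * (r - r')) = a * z * r + -(a * z * r') by ring, AddChar.map_add_eq_mul]
      ring
    rw [sum_congr rfl fun z _ => e z, sum_comm]
    push_cast
    rw [mul_sum]
    refine sum_congr rfl fun r _ => ?_
    rw [sum_comm]
    simp only [← mul_sum]
    have e2 : ∀ r' : ZMod q, ∑ z : ZMod q, (ZMod.stdAddChar (z * (a * (r - r'))) : ℂ) = if r = r' then (q : ℂ) else 0 := by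
      intro r'
      rw [AddChar.sum_mulShift _ (ZMod.isPrimitive_stdAddChar q), ZMod.card]
      simp only [ha.mul_right_eq_zero, sub_eq_zero]
      split_ifs <;> simp
    simp only [e2, mul_ite, mul_zero]
    rw [sum_ite_eq, if_pos (mem_univ _)]
    ring
  exact_mod_cast hC

theorem vk_cell {q : ℕ} [NeZero q] {a : ℤ} (ha : IsUnit (a : ZMod q)) (s t : Finset ℕ) (A B : ℝ) (hB0 : 0 ≤ B)
    (hA : ∀ b : ℕ, ∑ m ∈ s.filter (fun m => m ≡ b [MOD q]), Λ m ≤ A)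
    (hB : ∀ b : ℕ, ∑ n ∈ t.filter (fun n => n ≡ b [MOD q]), Λ n ≤ B) :
    ∑ m ∈ s, Λ m * ‖∑ n ∈ t, (Λ n : ℂ) * vke ((m * n : ℕ) * ((a : ℝ) / q))‖ ≤ A * B * (q * √q) := by
  set f : ZMod q → ℝ := fun z => ∑ n ∈ t.filter (fun n : ℕ => (n : ZMod q) = z), Λ n with hf
  set F : ZMod q → ℂ := fun z => ∑ r : ZMod q, (f r : ℂ) * ZMod.stdAddChar ((a : ZMod q) * z * r) with hF
  have hcl : ∀ (s : Finset ℕ) (z : ZMod q), s.filter (fun n : ℕ => (n : ZMod q) = z) = s.filter (fun n => n ≡ z.val [MOD q]) := by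
    intro s z
    refine filter_congr fun n _ => ?_
    rw [← ZMod.natCast_eq_natCast_iff, ZMod.natCast_zmod_val]
  have hfB : ∀ z, f z ≤ B := fun z => by rw [hf]; simp only [hcl]; exact hB _
  have hf0 : ∀ z, 0 ≤ f z := fun z => sum_nonneg fun _ _ => vonMangoldt_nonneg
  have hA0 : 0 ≤ A := le_trans (sum_nonneg fun _ _ => vonMangoldt_nonneg) (hA 0)
  have hin : ∀ m : ℕ, ∑ n ∈ t, (Λ n : ℂ) * vke ((m * n : ℕ) * ((a : ℝ) / q)) = F m := by
    intro m
    simp only [vke_std]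
    rw [← sum_fiberwise t (fun n : ℕ => (n : ZMod q)), hF]
    refine sum_congr rfl fun z _ => ?_
    rw [hf]; push_cast
    rw [sum_mul]
    refine sum_congr rfl fun n hn => ?_
    rw [(mem_filter.1 hn).2]
  simp only [hin]
  rw [← sum_fiberwise s (fun n : ℕ => (n : ZMod q))]
  have h1 : ∑ z : ZMod q, ∑ m ∈ s.filter (fun n : ℕ => (n : ZMod q) = z), Λ m * ‖F m‖ ≤ ∑ z : ZMod q, A * ‖F z‖ := by
    refine sum_le_sum fun z _ => ?_
    calc _ = ∑ m ∈ s.filter (fun n : ℕ => (n : ZMod q) = z), Λ m * ‖F z‖ :=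
          sum_congr rfl fun n hn => by rw [(mem_filter.1 hn).2]
      _ ≤ _ := by
          rw [← sum_mul]
          refine mul_le_mul_of_nonneg_right ?_ (norm_nonneg _)
          rw [hcl]; exact hA _
  refine h1.trans ?_
  rw [← mul_sum, mul_assoc]
  refine mul_le_mul_of_nonneg_left ?_ hA0
  have hP := vk_parseval ha f
  have h2 : (∑ z, ‖F z‖) ^ 2 ≤ (q : ℝ) * ∑ z, ‖F z‖ ^ 2 := by
    have := sq_sum_le_card_mul_sum_sq (s := (Finset.univ : Finset (ZMod q))) (f := fun z => ‖F z‖)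
    rwa [card_univ, ZMod.card] at this
  have h3 : ∑ r, f r ^ 2 ≤ q * B ^ 2 := by
    calc _ ≤ ∑ r : ZMod q, B ^ 2 := sum_le_sum fun r _ => by
          have := hf0 r; have := hfB r; gcongr
      _ = _ := by rw [sum_const, card_univ, ZMod.card, nsmul_eq_mul]
  have h4 : (∑ z, ‖F z‖) ^ 2 ≤ (B * (q * √q)) ^ 2 := by
    calc _ ≤ (q : ℝ) * (q * (q * B ^ 2)) := by
          refine h2.trans ?_
          rw [hF]; simp only; rw [hP]; gcongr
      _ = _ := by
          rw [mul_pow, mul_pow, Real.sq_sqrt (by positivity)]; ring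
  exact le_of_sq_le_sq h4 (by positivity)
end PartA11

section PartA12
open ArithmeticFunction
open scoped ArithmeticFunction.Moebius ArithmeticFunction.zeta

structure VkPar (y u E : ℕ) (r : ℝ) : Prop where
  hr : 4 ≤ r
  hL : Real.log y = r ^ 2
  hE : Real.exp r ≤ E
  hE2 : 4 * r ^ 40 ≤ E
  hy : 1 ≤ y
  huy : u ≤ y
  hh : (y : ℝ) / r ^ 24 ≤ y - u
  hbt : ∀ x : ℕ, E ≤ x → ∀ u q b : ℕ, u ≤ x → 0 < q → (q : ℝ) ≤ Real.log x ^ 40 →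
    (x : ℝ) / Real.log x ^ 40 ≤ x - u → ∑ n ∈ (Ioc u x).filter (fun n => n ≡ b [MOD q]), Λ n ≤ 173 * vkH q * ((x - u) / q)

theorem VkPar.log_ge {y u E : ℕ} {r : ℝ} (P : VkPar y u E r) {x : ℕ} (hx : E ≤ x) : r ≤ Real.log x := by
  have h1 : Real.exp r ≤ x := P.hE.trans (by exact_mod_cast hx)
  exact (Real.le_log_iff_exp_le (lt_of_lt_of_le (Real.exp_pos r) h1)).2 h1

theorem VkPar.bt_n {y u E : ℕ} {r : ℝ} (P : VkPar y u E r) {w q : ℕ} (b : ℕ) (hw : 1 ≤ w) (hwE : w * E ≤ y)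
    (hq : 0 < q) (hqr : (q : ℝ) ≤ r ^ 20) :
    ∑ n ∈ (Ioc (u / w) (y / w)).filter (fun n => n ≡ b [MOD q]), Λ n ≤ 346 * vkH q * ((y - u) / (w * q)) := by
  have hr := P.hr
  have hEx : E ≤ y / w := by rw [Nat.le_div_iff_mul_le hw]; linarith [mul_comm w E]
  have hlog := P.log_ge hEx
  have hw0 : (0 : ℝ) < w := by exact_mod_cast hw
  have hq0 : (0 : ℝ) < q := by exact_mod_cast hq
  have hy0 : (0 : ℝ) < y := by exact_mod_cast P.hy
  have hu : u / w ≤ y / w := Nat.div_le_div_right P.huy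
  have f1 : ((y / w : ℕ) : ℝ) ≤ y / w := Nat.cast_div_le
  have f2 : ((u / w : ℕ) : ℝ) ≤ u / w := Nat.cast_div_le
  have f3 : (y : ℝ) / w < (y / w : ℕ) + 1 := by rw [← Nat.floor_div_eq_div (K := ℝ)]; exact Nat.lt_floor_add_one _
  have f4 : (u : ℝ) / w < (u / w : ℕ) + 1 := by rw [← Nat.floor_div_eq_div (K := ℝ)]; exact Nat.lt_floor_add_one _
  set h : ℝ := (y : ℝ) - u with hh
  have hhw : h / w = y / w - u / w := by rw [hh]; ring
  have hr24 : (1 : ℝ) ≤ r ^ 24 := one_le_pow₀ (by linarith)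
  have hE0 : (E : ℝ) ≤ y / w := by
    rw [le_div_iff₀ hw0]; have : ((w * E : ℕ) : ℝ) ≤ y := by exact_mod_cast hwE
    push_cast at this; linarith
  have g1 : (y : ℝ) / w / r ^ 24 ≤ h / w := by
    rw [div_right_comm]; exact div_le_div_of_nonneg_right P.hh hw0.le
  have g2 : 2 ≤ h / w := by
    refine le_trans ?_ g1
    rw [le_div_iff₀ (by positivity)]
    have : r ^ 24 ≤ r ^ 40 := pow_le_pow_right₀ (by linarith) (by norm_num)
    linarith [P.hE2]
  have hr40 : r ^ 40 ≤ Real.log (y / w : ℕ) ^ 40 := by gcongr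
  have key := P.hbt (y / w) hEx (u / w) q b hu hq
    (hqr.trans (le_trans (pow_le_pow_right₀ (by linarith) (by norm_num)) hr40)) (by
      calc ((y / w : ℕ) : ℝ) / Real.log (y / w : ℕ) ^ 40 ≤ (y / w) / r ^ 40 := by gcongr
        _ ≤ (y / w) / (2 * r ^ 24) := by
            gcongr
            calc 2 * r ^ 24 ≤ r * r ^ 24 := by gcongr; linarith
              _ = r ^ 25 := by ring
              _ ≤ r ^ 40 := pow_le_pow_right₀ (by linarith) (by norm_num)
        _ = (y / w / r ^ 24) / 2 := by field_simp
        _ ≤ h / w / 2 := by gcongr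
        _ ≤ _ := by linarith)
  refine key.trans ?_
  have hH := vkH_one_le q
  calc 173 * vkH q * ((((y / w : ℕ) : ℝ) - (u / w : ℕ)) / q) ≤ 173 * vkH q * ((2 * (h / w)) / q) := by
        gcongr; linarith
    _ = _ := by field_simp; ring

theorem vkH_one : vkH 1 = 1 := by simp [vkH]

theorem VkPar.part1 {y u E : ℕ} {r : ℝ} (P : VkPar y u E r) {X : ℕ} (hX : 1 ≤ X) (hXE : X * E ≤ y) :
    ∑ m ∈ Ioc 0 X, Λ m * ∑ n ∈ Ioc (u / m) (y / m), Λ n ≤ 346 * (y - u) * (Real.log X + 6) := by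
  have hr := P.hr
  have hu : (u : ℝ) ≤ y := by exact_mod_cast P.huy
  calc _ ≤ ∑ m ∈ Ioc 0 X, 346 * ((y : ℝ) - u) * (Λ m / m) := by
        refine sum_le_sum fun m hm => ?_
        rw [mem_Ioc] at hm
        have h1 := P.bt_n (w := m) (q := 1) 0 hm.1 (le_trans (Nat.mul_le_mul_right E hm.2) hXE) one_pos (by
          push_cast; exact one_le_pow₀ (by linarith))
        have e : (Ioc (u / m) (y / m)).filter (fun n => n ≡ 0 [MOD 1]) = Ioc (u / m) (y / m) :=
          filter_true_of_mem fun _ _ => Nat.modEq_one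
        rw [e, vkH_one] at h1
        calc _ ≤ Λ m * (346 * 1 * ((y - u) / (m * (1 : ℕ)))) := mul_le_mul_of_nonneg_left h1 vonMangoldt_nonneg
          _ = _ := by push_cast; ring
    _ ≤ _ := by
        rw [← mul_sum]
        exact mul_le_mul_of_nonneg_left (vk_mertens X hX) (by linarith)

theorem vk_interval_diff {u1 y1 u0 y0 N : ℕ} (hu1 : u1 ≤ y1) (hu0 : u0 ≤ y0) (hu : u1 ≤ u0) (hy : y1 ≤ y0) (hN : y0 ≤ N)
    (v : ℕ → ℂ) (hv : ∀ n, ‖v n‖ ≤ 1) :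
    ‖∑ n ∈ Ioc u1 y1, (Λ n : ℂ) * v n‖ ≤ ‖∑ n ∈ Ioc u0 y0, (Λ n : ℂ) * v n‖ + Real.log N * ((y0 - y1) + (u0 - u1)) := by
  set f : ℕ → ℂ := fun n => (Λ n : ℂ) * v n with hf
  have hb : ∀ a b : ℕ, a ≤ b → b ≤ N → ‖∑ n ∈ Ioc a b, f n‖ ≤ Real.log N * (b - a) := by
    intro a b hab hbN
    calc _ ≤ ∑ n ∈ Ioc a b, Real.log N := by
          refine (norm_sum_le _ _).trans (sum_le_sum fun n hn => ?_)
          rw [mem_Ioc] at hn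
          rw [hf]; simp only
          rw [norm_mul, Complex.norm_real, Real.norm_of_nonneg vonMangoldt_nonneg]
          exact (mul_le_of_le_one_right vonMangoldt_nonneg (hv n)).trans (vk_Lambda_le_log (hn.2.trans hbN))
      _ = _ := by
          rw [sum_const, Nat.card_Ioc, nsmul_eq_mul, Nat.cast_sub hab]; ring
  have e : ∑ n ∈ Ioc u1 y1, f n = ∑ n ∈ Ioc u0 y0, f n - ∑ n ∈ Ioc y1 y0, f n + ∑ n ∈ Ioc u1 u0, f n := by
    have e1 := sum_Ioc_consecutive f hu1 hy
    have e2 := sum_Ioc_consecutive f hu hu0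
    rw [eq_comm, ← sub_eq_zero]
    linear_combination e2 - e1
  rw [e]
  have h1 := hb y1 y0 hy hN
  have h2 := hb u1 u0 hu (hu0.trans hN)
  refine (norm_add_le _ _).trans ?_
  have := norm_sub_le (∑ n ∈ Ioc u0 y0, f n) (∑ n ∈ Ioc y1 y0, f n)
  linarith

theorem vk_div_diff {y w m t k : ℕ} (hk : 1 ≤ k) (ht : 1 ≤ t) (hw : w = k * t) (hm : w < m) (hm2 : m ≤ w + t) :
    (((y / w : ℕ) : ℝ) - (y / m : ℕ)) ≤ y / (k * w) + 1 := by
  have f1 : ((y / w : ℕ) : ℝ) ≤ y / w := Nat.cast_div_le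
  have f3 : (y : ℝ) / m < (y / m : ℕ) + 1 := by rw [← Nat.floor_div_eq_div (K := ℝ)]; exact Nat.lt_floor_add_one _
  have hk0 : (0 : ℝ) < k := by exact_mod_cast hk
  have ht0 : (0 : ℝ) < t := by exact_mod_cast ht
  have hwr : (w : ℝ) = k * t := by exact_mod_cast hw
  have hw0 : (0 : ℝ) < w := by rw [hwr]; positivity
  have hmr : (w : ℝ) ≤ m := by exact_mod_cast hm.le
  have hm0 : (0 : ℝ) < m := by linarith
  have hm2r : (m : ℝ) - w ≤ t := by
    have : (m : ℝ) ≤ w + t := by exact_mod_cast hm2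
    linarith
  have : (y : ℝ) / w - y / m ≤ y / (k * w) := by
    calc (y : ℝ) / w - y / m = y * (m - w) / (w * m) := by field_simp
      _ ≤ y * t / (w * w) := by gcongr
      _ = y / (k * w) := by
          rw [div_eq_div_iff (by positivity) (by positivity), hwr]; ring
  linarith

theorem VkPar.cell {y u E : ℕ} {r : ℝ} (P : VkPar y u E r) {q k t : ℕ} [NeZero q] {a : ℤ} (ha : IsUnit (a : ZMod q))
    (hqr : (q : ℝ) ≤ r ^ 20) (hk : 1 ≤ k) (ht : 1 ≤ t) (hkt : E ≤ k * t) (hkE : (k * t) * E ≤ y) (hkr : (k : ℝ) + 1 ≤ 4 * r ^ 32) :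
    ∑ m ∈ Ioc (k * t) ((k + 1) * t), Λ m * ‖∑ n ∈ Ioc 0 (y / m), (Λ n : ℂ) * vkw u q a (m * n)‖ ≤
      59858 * vkH q ^ 2 * (y - u) / √q * (1 / k) + 2 * Real.log y ^ 2 * (y * (1 / k ^ 2) + t) := by
  have hr := P.hr
  have hu : (u : ℝ) ≤ y := by exact_mod_cast P.huy
  have hq := Nat.pos_of_ne_zero (NeZero.ne q)
  have hq0 : (0 : ℝ) < q := by exact_mod_cast hq
  have hk0 : (0 : ℝ) < k := by exact_mod_cast hk
  have ht0 : (0 : ℝ) < t := by exact_mod_cast ht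
  have hH := vkH_one_le q
  set h : ℝ := (y : ℝ) - u with hh
  have hh0 : 0 ≤ h := by rw [hh]; linarith
  set L := Real.log y with hL
  have hL0 : 0 ≤ L := Real.log_natCast_nonneg y
  set w := k * t with hw
  have hw1 : 1 ≤ w := Nat.mul_pos hk ht
  have hwr : (w : ℝ) = k * t := by rw [hw]; push_cast; rfl
  have hw2 : (k + 1) * t = w + t := by rw [hw]; ring
  rw [hw2]
  have hA : ∀ b : ℕ, ∑ m ∈ (Ioc w (w + t)).filter (fun m => m ≡ b [MOD q]), Λ m ≤ 173 * vkH q * (t / q) := by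
    intro b
    have hlog := P.log_ge (x := w + t) (by omega)
    have hr40 : r ^ 40 ≤ Real.log (w + t : ℕ) ^ 40 := by gcongr
    have key := P.hbt (w + t) (by omega) w q b (by omega) hq
      (hqr.trans (le_trans (pow_le_pow_right₀ (by linarith) (by norm_num)) hr40)) (by
        rw [div_le_iff₀ (lt_of_lt_of_le (by positivity) hr40)]
        push_cast
        calc (w : ℝ) + t = t * (k + 1) := by rw [hwr]; ring
          _ ≤ t * (4 * r ^ 32) := by gcongr
          _ ≤ t * (r * r ^ 32) := by gcongr
          _ = t * r ^ 33 := by ring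
          _ ≤ t * r ^ 40 := by gcongr <;> first | linarith | norm_num
          _ ≤ (w + t - w) * Real.log ((w : ℝ) + t) ^ 40 := by
              push_cast at hr40
              rw [add_sub_cancel_left]; gcongr)
    refine key.trans (le_of_eq ?_)
    push_cast; ring
  have hcell := vk_cell ha (Ioc w (w + t)) (Ioc (u / w) (y / w)) _ (346 * vkH q * (h / (w * q))) (by positivity) hA
    (fun b => P.bt_n b hw1 hkE hq hqr)
  have hm : ∀ m ∈ Ioc w (w + t), Λ m * ‖∑ n ∈ Ioc 0 (y / m), (Λ n : ℂ) * vkw u q a (m * n)‖ ≤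
      Λ m * ‖∑ n ∈ Ioc (u / w) (y / w), (Λ n : ℂ) * vke ((m * n : ℕ) * ((a : ℝ) / q))‖ + L * (L * (2 * (y / (k * w) + 1))) := by
    intro m hm
    rw [mem_Ioc] at hm
    have hm1 : 0 < m := by omega
    have e : ∑ n ∈ Ioc 0 (y / m), (Λ n : ℂ) * vkw u q a (m * n) = ∑ n ∈ Ioc (u / m) (y / m), (Λ n : ℂ) * vke ((m * n : ℕ) * ((a : ℝ) / q)) := by
      simp only [vkw, mul_ite, mul_zero]
      rw [← sum_filter]
      refine sum_congr ?_ fun _ _ => rfl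
      ext n
      simp only [mem_filter, mem_Ioc, Nat.div_lt_iff_lt_mul hm1, mul_comm n m]
      constructor
      · rintro ⟨⟨h1, h2⟩, h3⟩; exact ⟨h3, h2⟩
      · rintro ⟨h1, h2⟩; exact ⟨⟨Nat.pos_of_mul_pos_left (a := m) (by omega), h2⟩, h1⟩
    rw [e]
    have hd := vk_interval_diff (u1 := u / m) (y1 := y / m) (u0 := u / w) (y0 := y / w) (N := y)
      (Nat.div_le_div_right P.huy) (Nat.div_le_div_right P.huy) (Nat.div_le_div_left hm.1.le hw1) (Nat.div_le_div_left hm.1.le hw1)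
      (Nat.div_le_self _ _) (fun n => vke ((m * n : ℕ) * ((a : ℝ) / q))) (fun n => (vke_norm _).le)
    have d1 := vk_div_diff (y := y) hk ht hw hm.1 hm.2
    have d2 := vk_div_diff (y := u) hk ht hw hm.1 hm.2
    have d3 : (u : ℝ) / (k * w) ≤ y / (k * w) := by gcongr
    have hmN : m ≤ y := by
      have hE1 : 2 ≤ E := by
        have h1 := P.hE2
        have h2 : (1 : ℝ) ≤ r ^ 40 := one_le_pow₀ (by linarith)
        have : (2 : ℝ) ≤ E := by linarith
        exact_mod_cast this
      have : t ≤ w := by rw [hw]; exact Nat.le_mul_of_pos_left t hk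
      nlinarith
    have hΛ : Λ m ≤ L := vk_Lambda_le_log hmN
    have hstep : ‖∑ n ∈ Ioc (u / m) (y / m), (Λ n : ℂ) * vke ((m * n : ℕ) * ((a : ℝ) / q))‖ ≤
        ‖∑ n ∈ Ioc (u / w) (y / w), (Λ n : ℂ) * vke ((m * n : ℕ) * ((a : ℝ) / q))‖ + L * (2 * (y / (k * w) + 1)) := by
      refine hd.trans (add_le_add le_rfl (mul_le_mul_of_nonneg_left ?_ hL0))
      linarith
    calc _ ≤ Λ m * (‖∑ n ∈ Ioc (u / w) (y / w), (Λ n : ℂ) * vke ((m * n : ℕ) * ((a : ℝ) / q))‖ + L * (2 * (y / (k * w) + 1))) :=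
          mul_le_mul_of_nonneg_left hstep vonMangoldt_nonneg
      _ ≤ _ := by
          rw [mul_add]
          refine add_le_add le_rfl (mul_le_mul_of_nonneg_right hΛ (by positivity))
  refine (sum_le_sum hm).trans ?_
  rw [sum_add_distrib]
  refine add_le_add (hcell.trans (le_of_eq ?_)) (le_of_eq ?_)
  · rw [hwr]
    have hs : √(q : ℝ) ≠ 0 := by positivity
    field_simp
    rw [Real.sq_sqrt hq0.le]
    ring
  · rw [sum_const, Nat.card_Ioc, nsmul_eq_mul, hwr]
    rw [show w + t - w = t by omega]
    field_simp
end PartA12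

section PartA13
open ArithmeticFunction
open scoped ArithmeticFunction.Moebius ArithmeticFunction.zeta

theorem vk_split (f : ℕ → ℝ) (t A B : ℕ) (hAB : A ≤ B) :
    ∑ m ∈ Ioc (A * t) (B * t), f m = ∑ k ∈ Ico A B, ∑ m ∈ Ioc (k * t) ((k + 1) * t), f m := by
  induction B, hAB using Nat.le_induction with
  | base => simp
  | succ B hB ih =>
    rw [sum_Ico_succ_top hB, ← ih]
    exact (sum_Ioc_consecutive f (Nat.mul_le_mul_right t hB) (Nat.mul_le_mul_right t (Nat.le_succ B))).symm

theorem vk_inner_le (u q : ℕ) (a : ℤ) (y m : ℕ) (hm : 0 < m) :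
    ‖∑ n ∈ Ioc 0 (y / m), (Λ n : ℂ) * vkw u q a (m * n)‖ ≤ ∑ n ∈ Ioc (u / m) (y / m), Λ n := by
  have e : ∑ n ∈ Ioc 0 (y / m), (Λ n : ℂ) * vkw u q a (m * n) = ∑ n ∈ Ioc (u / m) (y / m), (Λ n : ℂ) * vke ((m * n : ℕ) * ((a : ℝ) / q)) := by
    simp only [vkw, mul_ite, mul_zero]
    rw [← sum_filter]
    refine sum_congr ?_ fun _ _ => rfl
    ext n
    simp only [mem_filter, mem_Ioc, Nat.div_lt_iff_lt_mul hm, mul_comm n m]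
    constructor
    · rintro ⟨⟨h1, h2⟩, h3⟩; exact ⟨h3, h2⟩
    · rintro ⟨h1, h2⟩; exact ⟨⟨Nat.pos_of_mul_pos_left (a := m) (by omega), h2⟩, h1⟩
  rw [e]
  refine (norm_sum_le _ _).trans (sum_le_sum fun n _ => ?_)
  rw [norm_mul, Complex.norm_real, Real.norm_of_nonneg vonMangoldt_nonneg, vke_norm, mul_one]

theorem VkPar.block {y u E : ℕ} {r : ℝ} (P : VkPar y u E r) {q s j : ℕ} [NeZero q] {a : ℤ} (ha : IsUnit (a : ZMod q))
    (hqr : (q : ℝ) ≤ r ^ 20) (hsj : s ≤ j) (hE : E ≤ 2 ^ j) (hjE : 2 ^ (j + 1) * E ≤ y) (hs : ((2 ^ s : ℕ) : ℝ) ≤ 2 * r ^ 32) :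
    ∑ m ∈ Ioc (2 ^ j) (2 ^ (j + 1)), Λ m * ‖∑ n ∈ Ioc 0 (y / m), (Λ n : ℂ) * vkw u q a (m * n)‖ ≤
      59858 * vkH q ^ 2 * (y - u) / √q + 2 * Real.log y ^ 2 * (y / (2 ^ s : ℕ) + (2 ^ j : ℕ)) := by
  have hu : (u : ℝ) ≤ y := by exact_mod_cast P.huy
  have hH := vkH_one_le q
  set S := 2 ^ s with hS
  set t := 2 ^ (j - s) with ht
  have hS1 : 1 ≤ S := Nat.one_le_two_pow
  have ht1 : 1 ≤ t := Nat.one_le_two_pow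
  have hS0 : (0 : ℝ) < S := by exact_mod_cast hS1
  have hSt : S * t = 2 ^ j := by rw [hS, ht, ← pow_add]; congr 1; omega
  have e2 : 2 ^ (j + 1) = (2 * S) * t := by rw [mul_assoc, hSt]; ring
  rw [e2] at hjE ⊢
  rw [← hSt] at hE ⊢
  rw [vk_split _ t S (2 * S) (by omega)]
  calc _ ≤ ∑ k ∈ Ico S (2 * S), (59858 * vkH q ^ 2 * (y - u) / √q * (1 / S) + 2 * Real.log y ^ 2 * (y * (1 / S ^ 2) + t)) := by
        refine sum_le_sum fun k hk => ?_
        rw [mem_Ico] at hk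
        have hkS : (S : ℝ) ≤ k := by exact_mod_cast hk.1
        refine (P.cell ha hqr (hS1.trans hk.1) ht1 (hE.trans (Nat.mul_le_mul_right t hk.1))
          (le_trans (Nat.mul_le_mul_right E (Nat.mul_le_mul_right t hk.2.le)) hjE) ?_).trans ?_
        · have : ((k + 1 : ℕ) : ℝ) ≤ (2 * S : ℕ) := by exact_mod_cast hk.2
          rw [Nat.cast_mul] at this; push_cast at this hs; linarith
        · have : 0 ≤ 59858 * vkH q ^ 2 * ((y : ℝ) - u) / √q := by
            have : 0 ≤ (y : ℝ) - u := by linarith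
            positivity
          gcongr
    _ = _ := by
        rw [sum_const, Nat.card_Ico, nsmul_eq_mul, show 2 * S - S = S by omega]
        push_cast
        field_simp

theorem VkPar.bilin {y u E : ℕ} {r : ℝ} (P : VkPar y u E r) {q j0 : ℕ} [NeZero q] {a : ℤ} (ha : IsUnit (a : ZMod q))
    (hqr : (q : ℝ) ≤ r ^ 20) (hEj : E = 2 ^ j0) (hE3 : (E : ℝ) ≤ 2 * Real.exp r) :
    ‖∑ m ∈ Ioc 0 y, (Λ m : ℂ) * ∑ n ∈ Ioc 0 (y / m), (Λ n : ℂ) * vkw u q a (m * n)‖ ≤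
      346 * (y - u) * (2 * r + 15) + 8 * (y - u) + 119716 * vkH q ^ 2 * (y - u) * r ^ 2 / √q := by
  have hr := P.hr
  have hu : (u : ℝ) ≤ y := by exact_mod_cast P.huy
  have hH := vkH_one_le q
  have hq := Nat.pos_of_ne_zero (NeZero.ne q)
  have hq0 : (0 : ℝ) < q := by exact_mod_cast hq
  have hy0 : (0 : ℝ) < y := by exact_mod_cast P.hy
  have hh0 : 0 ≤ (y : ℝ) - u := by linarith
  have hE1 : 1 ≤ E := by rw [hEj]; exact Nat.one_le_two_pow
  have hE0 : (0 : ℝ) < E := by exact_mod_cast hE1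
  have hEE : 2 * E * E ≤ y := by
    have h8 : (8 : ℝ) ≤ Real.exp (r ^ 2 - 2 * r) := by
      refine le_trans ?_ (Real.add_one_le_exp _); nlinarith
    have hyr : (y : ℝ) = Real.exp (r ^ 2) := by rw [← P.hL, Real.exp_log hy0]
    have : (2 * E * E : ℝ) ≤ y := by
      calc (2 * E * E : ℝ) ≤ 2 * (2 * Real.exp r) * (2 * Real.exp r) := by gcongr
        _ = 8 * Real.exp (2 * r) := by rw [two_mul r, Real.exp_add]; ring
        _ ≤ Real.exp (r ^ 2 - 2 * r) * Real.exp (2 * r) := by gcongr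
        _ = y := by rw [hyr, ← Real.exp_add]; congr 1; ring
    exact_mod_cast this
  have hEy : E * E ≤ y := by nlinarith
  have hdiv : E ≤ y / E := by rwa [Nat.le_div_iff_mul_le hE1]
  set j1 := Nat.log 2 (y / E) with hj1
  set X := 2 ^ j1 with hX
  have hX1 : 1 ≤ X := Nat.one_le_two_pow
  have hXE : X * E ≤ y := by
    have : X ≤ y / E := Nat.pow_log_le_self 2 (by omega)
    rwa [Nat.le_div_iff_mul_le hE1] at this
  have hXy : X ≤ y := le_trans (Nat.le_mul_of_pos_right X hE1) hXE
  have hj01 : j0 ≤ j1 := Nat.le_log_of_pow_le (by norm_num) (by rw [← hEj]; exact hdiv)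
  have hEX : E ≤ X := by rw [hEj]; exact Nat.pow_le_pow_right (by norm_num) hj01
  have hyX : y / X ≤ 2 * E := by
    have h1 : y / E < 2 ^ (j1 + 1) := Nat.lt_pow_succ_log_self (by norm_num) _
    rw [Nat.div_lt_iff_lt_mul hE1, pow_succ] at h1
    refine Nat.le_of_lt_succ ((Nat.div_lt_iff_lt_mul hX1).2 ?_)
    rw [← hX] at h1; nlinarith
  have hyX1 : 1 ≤ y / X := by rw [Nat.le_div_iff_mul_le hX1]; omega
  have hlogE : Real.log E ≤ r + 1 := by
    rw [Real.log_le_iff_le_exp hE0, Real.exp_add]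
    have := Real.add_one_le_exp 1
    nlinarith [Real.exp_pos r]
  have hlogyX : Real.log (y / X : ℕ) ≤ r + 2 := by
    have h1 : ((y / X : ℕ) : ℝ) ≤ 2 * E := by exact_mod_cast hyX
    rw [Real.log_le_iff_le_exp (by exact_mod_cast hyX1), show r + 2 = r + 1 + 1 by ring, Real.exp_add, Real.exp_add]
    have h2 := Real.add_one_le_exp 1
    have h3 := Real.exp_pos r
    have h4 : 2 * Real.exp r ≤ Real.exp r * Real.exp 1 := by nlinarith
    nlinarith [Real.exp_pos 1]
  set F : ℕ → ℝ := fun m => Λ m * ‖∑ n ∈ Ioc 0 (y / m), (Λ n : ℂ) * vkw u q a (m * n)‖ with hF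
  set f : ℕ → ℂ := fun m => (Λ m : ℂ) * ∑ n ∈ Ioc 0 (y / m), (Λ n : ℂ) * vkw u q a (m * n) with hf
  have hfF : ∀ m, ‖f m‖ = F m := by
    intro m; rw [hf, hF]; simp only
    rw [norm_mul, Complex.norm_real, Real.norm_of_nonneg vonMangoldt_nonneg]
  have hpart : ∀ Z : ℕ, ∑ m ∈ Ioc 0 Z, F m ≤ ∑ m ∈ Ioc 0 Z, Λ m * ∑ n ∈ Ioc (u / m) (y / m), Λ n := by
    intro Z
    refine sum_le_sum fun m hm => ?_
    exact mul_le_mul_of_nonneg_left (vk_inner_le u q a y m (mem_Ioc.1 hm).1) vonMangoldt_nonneg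
  have hsplit : ∑ m ∈ Ioc 0 y, f m = ∑ m ∈ Ioc 0 E, f m + ∑ m ∈ Ioc E X, f m + ∑ m ∈ Ioc X y, f m := by
    rw [sum_Ioc_consecutive f (Nat.zero_le E) hEX, sum_Ioc_consecutive f (Nat.zero_le X) hXy]
  have b1 : ‖∑ m ∈ Ioc 0 E, f m‖ ≤ 346 * (y - u) * (r + 7) := by
    calc _ ≤ ∑ m ∈ Ioc 0 E, F m := (norm_sum_le _ _).trans (sum_le_sum fun m _ => (hfF m).le)
      _ ≤ _ := (hpart E).trans (P.part1 hE1 hEy)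
      _ ≤ _ := mul_le_mul_of_nonneg_left (by linarith) (by positivity)
  have b3 : ‖∑ m ∈ Ioc X y, f m‖ ≤ 346 * (y - u) * (r + 8) := by
    have e : ∑ m ∈ Ioc X y, f m = ∑ n ∈ Ioc 0 (y / X), ∑ m ∈ Ioc X (y / n), (Λ m : ℂ) * ((Λ n : ℂ) * vkw u q a (m * n)) := by
      rw [← vk_hyper_swap hX1]
      simp only [hf, mul_sum]
    rw [e]
    calc _ ≤ ∑ n ∈ Ioc 0 (y / X), Λ n * ∑ m ∈ Ioc (u / n) (y / n), Λ m := by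
          refine (norm_sum_le _ _).trans (sum_le_sum fun n hn => ?_)
          have hn0 := (mem_Ioc.1 hn).1
          rw [mul_sum]
          refine (norm_sum_le _ _).trans ?_
          have hz : ∀ m ∈ Ioc X (y / n), ‖(Λ m : ℂ) * ((Λ n : ℂ) * vkw u q a (m * n))‖ ≤ if u / n < m then Λ n * Λ m else 0 := by
            intro m hm
            rw [norm_mul, norm_mul, Complex.norm_real, Complex.norm_real, Real.norm_of_nonneg vonMangoldt_nonneg, Real.norm_of_nonneg vonMangoldt_nonneg]
            unfold vkw
            simp only [Nat.div_lt_iff_lt_mul hn0]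
            split_ifs
            · rw [vke_norm]; apply le_of_eq; ring
            · simp
          refine (sum_le_sum hz).trans ?_
          rw [← sum_filter]
          refine sum_le_sum_of_subset_of_nonneg ?_ fun m _ _ => mul_nonneg vonMangoldt_nonneg vonMangoldt_nonneg
          intro m hm
          rw [mem_filter, mem_Ioc] at hm
          exact mem_Ioc.2 ⟨hm.2, hm.1.2⟩
      _ ≤ _ := P.part1 hyX1 (le_trans (Nat.mul_le_mul_right E hyX) hEE)
      _ ≤ _ := mul_le_mul_of_nonneg_left (by linarith) (by positivity)
  have b2 : ‖∑ m ∈ Ioc E X, f m‖ ≤ 119716 * vkH q ^ 2 * (y - u) * r ^ 2 / √q + 8 * (y - u) := by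
    obtain ⟨s, hs1, hs2⟩ := vk_pow2 (x := r ^ 32) (one_le_pow₀ (by linarith))
    have hr32 : r ^ 32 ≤ r ^ 40 := pow_le_pow_right₀ (by linarith) (by norm_num)
    have hr0 : 0 < r := by linarith
    have hsj0 : s ≤ j0 := by
      have h1 : ((2 ^ s : ℕ) : ℝ) ≤ (2 ^ j0 : ℕ) := by
        rw [← hEj]; have := P.hE2; have : 0 ≤ r ^ 40 := by positivity
        linarith
      have h2 : 2 ^ s ≤ 2 ^ j0 := by exact_mod_cast h1
      exact (Nat.pow_le_pow_iff_right (by norm_num)).1 h2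
    have hlog : (j1 : ℝ) ≤ 2 * Real.log y := vk_pow2_log hXy
    calc _ ≤ ∑ m ∈ Ioc E X, F m := (norm_sum_le _ _).trans (sum_le_sum fun m _ => (hfF m).le)
      _ = ∑ j ∈ Ico j0 j1, ∑ m ∈ Ioc (2 ^ j) (2 ^ (j + 1)), F m := by rw [hEj, hX, vk_dyadic F hj01]
      _ ≤ ∑ j ∈ Ico j0 j1, (59858 * vkH q ^ 2 * (y - u) / √q + 4 * r ^ 4 * (y / r ^ 32)) := by
          refine sum_le_sum fun j hj => ?_
          rw [mem_Ico] at hj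
          have hjX : 2 ^ (j + 1) ≤ X := Nat.pow_le_pow_right (by norm_num) hj.2
          refine (P.block ha hqr (hsj0.trans hj.1) (by rw [hEj]; exact Nat.pow_le_pow_right (by norm_num) hj.1)
            (le_trans (Nat.mul_le_mul_right E hjX) hXE) hs2).trans ?_
          have h1 : (y : ℝ) / (2 ^ s : ℕ) ≤ y / r ^ 32 := by gcongr
          have h2 : ((2 ^ j : ℕ) : ℝ) ≤ y / r ^ 32 := by
            rw [le_div_iff₀ (by positivity)]
            have h3 : 2 ^ j * E ≤ y := le_trans (Nat.mul_le_mul_right E (le_trans (Nat.pow_le_pow_right (by norm_num) (Nat.le_succ j)) hjX)) hXE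
            have h4 : ((2 ^ j : ℕ) : ℝ) * E ≤ y := by exact_mod_cast h3
            refine le_trans (mul_le_mul_of_nonneg_left ?_ (by positivity)) h4
            have := P.hE2; have : 0 ≤ r ^ 40 := by positivity
            linarith
          rw [P.hL]
          have : 2 * (r ^ 2) ^ 2 * ((y : ℝ) / (2 ^ s : ℕ) + (2 ^ j : ℕ)) ≤ 2 * (r ^ 2) ^ 2 * (y / r ^ 32 + y / r ^ 32) := by
            gcongr
          refine add_le_add le_rfl (this.trans (le_of_eq ?_))
          ring
      _ ≤ (2 * r ^ 2) * (59858 * vkH q ^ 2 * (y - u) / √q + 4 * r ^ 4 * (y / r ^ 32)) := by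
          rw [sum_const, Nat.card_Ico, nsmul_eq_mul]
          refine mul_le_mul_of_nonneg_right ?_ (by positivity)
          rw [← P.hL]
          refine le_trans ?_ hlog
          exact_mod_cast Nat.sub_le _ _
      _ = 119716 * vkH q ^ 2 * (y - u) * r ^ 2 / √q + 8 * (y / r ^ 26) := by
          field_simp
          ring
      _ ≤ _ := by
          have : (y : ℝ) / r ^ 26 ≤ y - u := by
            refine le_trans ?_ P.hh
            have : r ^ 24 ≤ r ^ 26 := pow_le_pow_right₀ (by linarith) (by norm_num)
            gcongr
          linarith
  rw [hsplit]
  have t1 := norm_add_le (∑ m ∈ Ioc 0 E, f m + ∑ m ∈ Ioc E X, f m) (∑ m ∈ Ioc X y, f m)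
  have t2 := norm_add_le (∑ m ∈ Ioc 0 E, f m) (∑ m ∈ Ioc E X, f m)
  linarith
end PartA13

section PartA14
open ArithmeticFunction
open scoped ArithmeticFunction.Moebius ArithmeticFunction.zeta

theorem vk_q0 (η : ℝ) (hη : 0 < η) : ∃ q0 : ℕ, 1 ≤ q0 ∧ ∀ q : ℕ, q0 ≤ q → vkH q ^ 2 / √q ≤ η ∧ vkH q / q ≤ η := by
  have h1 := (tendsto_natCast_atTop_atTop (R := ℝ)).eventually (vk_ev_log ((9 / η) ^ 2) 4)
  obtain ⟨N, hN⟩ := eventually_atTop.1 (h1.and (vk_tendsto_log.eventually_ge_atTop 1))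
  refine ⟨max N 1, le_max_right _ _, fun q hq => ?_⟩
  obtain ⟨h2, h3⟩ := hN q (le_trans (le_max_left _ _) hq)
  have hq1 : 1 ≤ q := le_trans (le_max_right _ _) hq
  have hq0 : (0 : ℝ) < q := by exact_mod_cast hq1
  have hq1r : (1 : ℝ) ≤ q := by exact_mod_cast hq1
  have hH := vkH_one_le q
  have hs : 0 < √(q : ℝ) := by positivity
  have hH2 : vkH q ≤ 3 * Real.log q := (vkH_le (by omega)).trans (by linarith)
  have h4 : 9 / η * Real.log q ^ 2 ≤ √q := by
    apply Real.le_sqrt_of_sq_le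
    calc _ = (9 / η) ^ 2 * Real.log q ^ 4 := by ring
      _ ≤ _ := h2
  have key : vkH q ^ 2 / √q ≤ η := by
    rw [div_le_iff₀ hs]
    calc vkH q ^ 2 ≤ (3 * Real.log q) ^ 2 := by gcongr
      _ = η * (9 / η * Real.log q ^ 2) := by field_simp; ring
      _ ≤ _ := by gcongr
  refine ⟨key, le_trans ?_ key⟩
  have hsq : √(q : ℝ) ≤ q := by
    rw [Real.sqrt_le_left hq0.le]; nlinarith
  gcongr
  nlinarith

theorem vk_params : ∀ᶠ y : ℕ in atTop, ∀ u : ℕ, u ≤ y → (y : ℝ) / Real.log y ^ 12 ≤ y - u →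
    ∃ E j0 : ℕ, VkPar y u E (√(Real.log y)) ∧ E = 2 ^ j0 ∧ (E : ℝ) ≤ 2 * Real.exp (√(Real.log y)) := by
  obtain ⟨x0, hx0⟩ := eventually_atTop.1 (vk_bt2 40)
  have hsq : Tendsto (fun y : ℕ => √(Real.log y)) atTop atTop := Real.tendsto_sqrt_atTop.comp vk_tendsto_log
  have h1 := hsq.eventually (vk_ev_exp 4 40)
  have h2 := hsq.eventually_ge_atTop 4
  have h3 := (Real.tendsto_exp_atTop.comp hsq).eventually_ge_atTop (x0 : ℝ)
  filter_upwards [h1, h2, h3, eventually_ge_atTop 1] with y h1 h2 h3 h4 u huy hh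
  have hlog : 0 ≤ Real.log (y : ℝ) := Real.log_natCast_nonneg y
  obtain ⟨j0, e1, e2⟩ := vk_pow2 (x := Real.exp (√(Real.log y))) (Real.one_le_exp (by linarith))
  refine ⟨2 ^ j0, j0, ⟨h2, (Real.sq_sqrt hlog).symm, e1, h1.trans e1, h4, huy, ?_, ?_⟩, rfl, e2⟩
  · rw [show (24 : ℕ) = 2 * 12 by norm_num, pow_mul, Real.sq_sqrt hlog]; exact hh
  · intro x hx
    refine hx0 x ?_
    have : (x0 : ℝ) ≤ x := by
      refine h3.trans (le_trans e1 ?_)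
      exact_mod_cast hx
    exact_mod_cast this

theorem vk_small_term {y u q : ℕ} {a : ℤ} (hu : (y : ℝ) - u ≤ y / 2) (huy : u ≤ y) (hy : 1 ≤ y) :
    ‖∑ n ∈ Ioc 0 y, ((Λ n * (Real.log y - Real.log n) : ℝ) : ℂ) * vkw u q a n‖ ≤ 12 * ((y : ℝ) - u) := by
  have hy0 : (0 : ℝ) < y := by exact_mod_cast hy
  have huy' : (u : ℝ) ≤ y := by exact_mod_cast huy
  calc _ ≤ ∑ n ∈ Ioc 0 y, Λ n * (2 * ((y : ℝ) - u) / y) := by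
        refine (norm_sum_le _ _).trans (sum_le_sum fun n hn => ?_)
        rw [mem_Ioc] at hn
        have hn0 : (0 : ℝ) < n := by exact_mod_cast hn.1
        have hny : (n : ℝ) ≤ y := by exact_mod_cast hn.2
        have hlog : Real.log n ≤ Real.log y := Real.log_le_log hn0 hny
        rw [norm_mul, vkw_norm, Complex.norm_real, Real.norm_of_nonneg (mul_nonneg vonMangoldt_nonneg (by linarith))]
        have hnn : 0 ≤ 2 * ((y : ℝ) - u) / y := div_nonneg (by linarith) hy0.le
        split_ifs with h
        · rw [mul_one]
          refine mul_le_mul_of_nonneg_left ?_ vonMangoldt_nonneg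
          have hun : (u : ℝ) ≤ n := by exact_mod_cast h.le
          rw [← Real.log_div hy0.ne' hn0.ne']
          have h1 := Real.log_le_sub_one_of_pos (div_pos hy0 hn0)
          refine h1.trans ?_
          have h2 : (y : ℝ) / n - 1 = (y - n) / n := by field_simp
          rw [h2, div_le_div_iff₀ hn0 hy0]
          have : (y : ℝ) ≤ 2 * n := by linarith
          calc ((y : ℝ) - n) * y ≤ (y - u) * y := by gcongr
            _ ≤ (y - u) * (2 * n) := mul_le_mul_of_nonneg_left this (by linarith)
            _ = _ := by ring
        · rw [mul_zero]; exact mul_nonneg vonMangoldt_nonneg hnn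
    _ ≤ (6 * y) * (2 * ((y : ℝ) - u) / y) := by
        rw [← sum_mul]
        exact mul_le_mul_of_nonneg_right (vk_psi y) (div_nonneg (by linarith) hy0.le)
    _ = _ := by field_simp; ring

set_option maxHeartbeats 1000000 in
theorem vk_major_raw : ∀ᶠ y : ℕ in atTop, ∀ (u q : ℕ) (a : ℤ), 0 < q → (q : ℝ) ≤ Real.log y ^ 10 → u ≤ y →
    (y : ℝ) / Real.log y ^ 12 ≤ y - u → (y : ℝ) - u ≤ y / Real.log y → IsUnit (a : ZMod q) →
    Real.log y * ‖∑ n ∈ Ioc 0 y, (Λ n : ℂ) * vkw u q a n‖ ≤ ((y : ℝ) - u) *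
      (5221 + 16384 * Real.log (Real.log y) ^ 3 + 692 * √(Real.log y) + 168 * Real.log y * (vkH q / q) + 119716 * Real.log y * (vkH q ^ 2 / √q)) := by
  have hLL := (Real.tendsto_log_atTop.comp vk_tendsto_log).eventually_ge_atTop 1
  filter_upwards [vk_params, vk_choose_D 15, vk_tendsto_log.eventually_ge_atTop 2, hLL, vk_tendsto_log.eventually (vk_ev_exp 4 27),
    eventually_ge_atTop 1] with y hpar hD hL2 hLL hexp hy u q a hq hqL huy hh hh2 ha
  have : NeZero q := ⟨hq.ne'⟩
  obtain ⟨E, j0, P, hEj, hE3⟩ := hpar u huy hh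
  obtain ⟨D, hD1, hDy, hDL, hyD, hl0, hl1⟩ := hD
  have hq0 : (0 : ℝ) < q := by exact_mod_cast hq
  have hq1 : (1 : ℝ) ≤ q := by exact_mod_cast hq
  have hy0 : (0 : ℝ) < y := by exact_mod_cast hy
  have hD0 : (0 : ℝ) < D := by exact_mod_cast hD1
  simp only [Function.comp] at hLL
  rw [Real.exp_log hy0] at hexp
  have hL0 : 0 ≤ Real.log (y : ℝ) := by linarith
  have hrsq : √(Real.log (y : ℝ)) ^ 2 = Real.log y := Real.sq_sqrt hL0
  have hbil := P.bilin ha (by rw [show 20 = 2 * 10 by norm_num, pow_mul, hrsq]; exact hqL) hEj hE3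
  have htI := vk_typeI_major (u := u) (y := y) ha hD1 hDy huy
  have hsm := vk_small_term (y := y) (u := u) (q := q) (a := a) (hh2.trans (by gcongr)) huy hy
  have hcomb := vk_combine (Real.log y) y (vkw u q a)
  rw [hrsq] at hbil
  set L := Real.log (y : ℝ) with hL
  set r := √L with hr
  set ℓ := Real.log ((y : ℝ) / D) with hℓ
  set M := Real.log L with hM
  set h : ℝ := (y : ℝ) - u with hhd
  have hL1 : 1 ≤ L := by linarith
  have hh0 : 0 < h := lt_of_lt_of_le (by positivity) hh
  have hH := vkH_one_le q
  have eI : ∑ d ∈ Ioc 0 y, (((μ d : ℝ) * (L - Real.log d) ^ 2 : ℝ) : ℂ) * ∑ m ∈ Ioc 0 (y / d), vkw u q a (d * m) =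
      ∑ d ∈ Ioc 0 y, (((μ d : ℝ) * Real.log (y / d) ^ 2 : ℝ) : ℂ) * ∑ m ∈ Ioc 0 (y / d), vkw u q a (d * m) := by
    refine sum_congr rfl fun d hd => ?_
    have hd0 : (0 : ℝ) < d := by exact_mod_cast (mem_Ioc.1 hd).1
    rw [Real.log_div hy0.ne' hd0.ne']
  rw [eI] at hcomb
  have h1 : ‖∑ n ∈ Ioc 0 y, (if n = 1 then (L : ℂ) ^ 2 else 0) * vkw u q a n‖ ≤ L ^ 2 := by
    have e : ∑ n ∈ Ioc 0 y, (if n = 1 then (L : ℂ) ^ 2 else 0) * vkw u q a n = (L : ℂ) ^ 2 * vkw u q a 1 := by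
      simp only [ite_mul, zero_mul]
      rw [sum_ite_eq' , if_pos (mem_Ioc.2 ⟨one_pos, hy⟩)]
    rw [e, norm_mul, norm_pow, Complex.norm_real, Real.norm_of_nonneg hL0]
    exact mul_le_of_le_one_right (by positivity) (vkw_norm_le _ _ _ _)
  have hnorm : L * ‖∑ n ∈ Ioc 0 y, (Λ n : ℂ) * vkw u q a n‖ = ‖(L : ℂ) * ∑ n ∈ Ioc 0 y, (Λ n : ℂ) * vkw u q a n‖ := by
    rw [norm_mul, Complex.norm_real, Real.norm_of_nonneg hL0]
  have hexp' : 4 * L ^ 15 ≤ h := by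
    refine le_trans ?_ hh
    rw [le_div_iff₀ (by positivity)]
    calc 4 * L ^ 15 * L ^ 12 = 4 * L ^ 27 := by ring
      _ ≤ _ := hexp
  have hL2h : L ^ 2 ≤ h := by
    have : L ^ 2 ≤ L ^ 15 := pow_le_pow_right₀ hL1 (by norm_num)
    have : 0 ≤ L ^ 15 := by positivity
    linarith
  have hlogq : Real.log q ≤ L := by
    rw [hL]
    refine Real.log_le_log hq0 (hqL.trans ?_)
    have : L ^ 10 ≤ L ^ 27 := pow_le_pow_right₀ hL1 (by norm_num)
    have : 0 ≤ L ^ 27 := by positivity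
    linarith
  have hlogq0 : 0 ≤ Real.log q := Real.log_natCast_nonneg q
  have hDh : D * L ^ 3 ≤ h := by
    refine le_trans ?_ hh
    rw [le_div_iff₀ (by positivity)]
    rw [le_div_iff₀ (by positivity)] at hDL
    calc _ = D * L ^ 15 := by ring
      _ ≤ _ := hDL
  have hqh : q * L ^ 3 ≤ h := by
    calc q * L ^ 3 ≤ L ^ 10 * L ^ 3 := by gcongr
      _ = L ^ 13 := by ring
      _ ≤ L ^ 15 := pow_le_pow_right₀ hL1 (by norm_num)
      _ ≤ h := by
        have : 0 ≤ L ^ 15 := by positivity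
        linarith
  have t1 : L ^ 2 * (((D : ℝ) / q + 1) * (2 * q * (1 + Real.log q))) ≤ 8 * h := by
    calc _ = L ^ 2 * ((D + q) * (2 * (1 + Real.log q))) := by field_simp
      _ ≤ L ^ 2 * ((D + q) * (2 * (L + L))) := by gcongr
      _ = 4 * (D * L ^ 3 + q * L ^ 3) := by ring
      _ ≤ _ := by linarith
  have t2 : h * (84 * (1 + L) * vkH q / q) ≤ h * (168 * L * (vkH q / q)) := by
    have e : 84 * (1 + L) * vkH q / q = 84 * (1 + L) * (vkH q / q) := by ring
    rw [e]
    have : 84 * (1 + L) ≤ 168 * L := by linarith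
    gcongr
  have t4 : 2 * D * L ^ 2 ≤ 2 * h := by
    have : (D : ℝ) * L ^ 2 ≤ D * L ^ 3 := by gcongr <;> first | exact hL1 | norm_num
    linarith
  have t5 : ℓ ^ 2 * (h * (1 + ℓ) + 2 * (y / D)) ≤ h * (ℓ ^ 2 * (2 + ℓ)) := by
    calc _ ≤ ℓ ^ 2 * (h * (1 + ℓ) + h) := by
          gcongr
          linarith
      _ = _ := by ring
  have hl16 : ℓ ≤ 16 * M := by norm_num at hl1; linarith
  have t6 : ℓ ^ 3 + ℓ ^ 2 * (2 + ℓ) ≤ 16384 * M ^ 3 := by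
    have s1 : ℓ ^ 3 ≤ (16 * M) ^ 3 := by gcongr
    have s2 : ℓ ^ 2 ≤ (16 * M) ^ 2 := by gcongr
    have s3 : M ^ 2 ≤ M ^ 3 := pow_le_pow_right₀ hLL (by norm_num)
    have s4 : 0 ≤ M ^ 3 := by positivity
    rw [mul_pow] at s1 s2
    have s5 : ℓ ^ 3 + ℓ ^ 2 * (2 + ℓ) = 2 * ℓ ^ 3 + 2 * ℓ ^ 2 := by ring
    rw [s5]
    norm_num at s1 s2
    linarith
  have hfin : L * ‖∑ n ∈ Ioc 0 y, (Λ n : ℂ) * vkw u q a n‖ ≤ (8 * h + h * (168 * L * (vkH q / q)) + h * ℓ ^ 3 + 2 * h + h * (ℓ ^ 2 * (2 + ℓ)))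
      + h + 12 * h + (346 * h * (2 * r + 15) + 8 * h + 119716 * vkH q ^ 2 * h * L / √q) := by
    rw [hnorm, hcomb]
    refine (norm_sub_le _ _).trans (add_le_add ((norm_sub_le _ _).trans (add_le_add ((norm_sub_le _ _).trans (add_le_add ?_ (h1.trans hL2h))) hsm)) hbil)
    linarith
  refine hfin.trans ?_
  have t7 := mul_le_mul_of_nonneg_left t6 hh0.le
  have e8 : 119716 * vkH q ^ 2 * h * L / √q = h * (119716 * L * (vkH q ^ 2 / √q)) := by ring
  rw [e8]
  linarith

theorem vk_major (δ : ℝ) (hδ : 0 < δ) : ∃ q0 : ℕ, ∀ᶠ y : ℕ in atTop, ∀ (u q : ℕ) (a : ℤ), q0 ≤ q → (q : ℝ) ≤ Real.log y ^ 10 → u ≤ y →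
    (y : ℝ) / Real.log y ^ 12 ≤ y - u → (y : ℝ) - u ≤ y / Real.log y → IsUnit (a : ZMod q) →
    ‖∑ n ∈ Ioc 0 y, (Λ n : ℂ) * vkw u q a n‖ ≤ δ * ((y : ℝ) - u) := by
  obtain ⟨q0, hq01, hq0⟩ := vk_q0 (δ / 239768) (by positivity)
  refine ⟨q0, ?_⟩
  filter_upwards [vk_major_raw, vk_tendsto_log.eventually (vk_ev_log (16384 * (6 / δ)) 3), vk_tendsto_log.eventually_ge_atTop (max 1 (5221 * (6 / δ))),
    vk_tendsto_log.eventually_ge_atTop ((692 * (6 / δ)) ^ 2)] with y h1 h2 h3 h4 u q a hq hqL huy hh hh2 ha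
  have key := h1 u q a (by omega) hqL huy hh hh2 ha
  obtain ⟨g1, g2⟩ := hq0 q hq
  set L := Real.log (y : ℝ) with hL
  have hL1 : 1 ≤ L := (le_max_left _ _).trans h3
  have h3' : 5221 * (6 / δ) ≤ L := (le_max_right _ _).trans h3
  have huy' : 0 ≤ (y : ℝ) - u := by
    have : (u : ℝ) ≤ y := by exact_mod_cast huy
    linarith
  have s1 : 5221 ≤ δ / 6 * L := by
    have := mul_le_mul_of_nonneg_left h3' (show 0 ≤ δ / 6 by positivity)
    refine le_trans (le_of_eq ?_) this; field_simp
  have s2 : 16384 * Real.log L ^ 3 ≤ δ / 6 * L := by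
    have := mul_le_mul_of_nonneg_left h2 (show 0 ≤ δ / 6 by positivity)
    refine le_trans (le_of_eq ?_) this; field_simp
  have s3 : 692 * √L ≤ δ / 6 * L := by
    have h5 : 692 * (6 / δ) ≤ √L := Real.le_sqrt_of_sq_le h4
    have h6 : 692 * (6 / δ) * √L ≤ √L * √L := by gcongr
    rw [Real.mul_self_sqrt (by linarith)] at h6
    have := mul_le_mul_of_nonneg_left h6 (show 0 ≤ δ / 6 by positivity)
    refine le_trans (le_of_eq ?_) this; field_simp
  have s4 : 168 * L * (vkH q / q) ≤ 168 * L * (δ / 239768) := by gcongr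
  have s5 : 119716 * L * (vkH q ^ 2 / √q) ≤ 119716 * L * (δ / 239768) := by gcongr
  have s6 : 5221 + 16384 * Real.log L ^ 3 + 692 * √L + 168 * L * (vkH q / q) + 119716 * L * (vkH q ^ 2 / √q) ≤ δ * L := by linarith
  have := key.trans (mul_le_mul_of_nonneg_left s6 huy')
  refine le_of_mul_le_mul_left (a := L) ?_ (by linarith)
  linarith
end PartA14

section PartA15
open ArithmeticFunction
open scoped ArithmeticFunction.Moebius ArithmeticFunction.zeta

theorem vk_step {y h q : ℕ} {a : ℤ} {β : ℝ} (hhy : h ≤ y) :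
    ‖∑ n ∈ Ioc 0 y, (Λ n : ℂ) * vke (n * ((a : ℝ) / q + β))‖ ≤ ‖∑ n ∈ Ioc 0 (y - h), (Λ n : ℂ) * vke (n * ((a : ℝ) / q + β))‖ +
      ‖∑ n ∈ Ioc 0 y, (Λ n : ℂ) * vkw (y - h) q a n‖ + 2 * Real.pi * h * |β| * ∑ n ∈ Ioc (y - h) y, Λ n := by
  set f : ℕ → ℂ := fun n => (Λ n : ℂ) * vke (n * ((a : ℝ) / q + β)) with hf
  have e0 : ∑ n ∈ Ioc 0 y, f n = ∑ n ∈ Ioc 0 (y - h), f n + ∑ n ∈ Ioc (y - h) y, f n :=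
    (sum_Ioc_consecutive f (Nat.zero_le _) (Nat.sub_le y h)).symm
  have e1 : ∑ n ∈ Ioc 0 y, (Λ n : ℂ) * vkw (y - h) q a n = ∑ n ∈ Ioc (y - h) y, (Λ n : ℂ) * vke (n * ((a : ℝ) / q)) := by
    rw [← sum_Ioc_consecutive _ (Nat.zero_le _) (Nat.sub_le y h)]
    rw [sum_eq_zero, zero_add]
    · refine sum_congr rfl fun n hn => ?_
      rw [vkw, if_pos (mem_Ioc.1 hn).1]
    · intro n hn
      rw [vkw, if_neg (by have := (mem_Ioc.1 hn).2; omega), mul_zero]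
  have e2 : ∑ n ∈ Ioc (y - h) y, f n = (∑ n ∈ Ioc (y - h) y, (Λ n : ℂ) * vke (n * ((a : ℝ) / q))) * vke (y * β) +
      ∑ n ∈ Ioc (y - h) y, (Λ n : ℂ) * vke (n * ((a : ℝ) / q)) * (vke (n * β) - vke (y * β)) := by
    rw [sum_mul, ← sum_add_distrib]
    refine sum_congr rfl fun n _ => ?_
    rw [hf]; simp only
    rw [mul_add, vke_add]; ring
  rw [e0, e2, e1, ← add_assoc]
  refine (norm_add_le _ _).trans (add_le_add ((norm_add_le _ _).trans (add_le_add le_rfl ?_)) ?_)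
  · rw [norm_mul, vke_norm, mul_one]
  · rw [mul_sum]
    refine (norm_sum_le _ _).trans (sum_le_sum fun n hn => ?_)
    rw [mem_Ioc] at hn
    rw [norm_mul, norm_mul, vke_norm, Complex.norm_real, Real.norm_of_nonneg vonMangoldt_nonneg, mul_one, mul_comm]
    refine mul_le_mul_of_nonneg_right ?_ vonMangoldt_nonneg
    refine (vke_sub_norm_le _ _).trans ?_
    have h1 : |(n : ℝ) * β - y * β| = (y - n) * |β| := by
      have : (n : ℝ) ≤ y := by exact_mod_cast hn.2
      rw [← sub_mul, abs_mul, abs_sub_comm, abs_of_nonneg (by linarith)]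
    have h2 : (y : ℝ) - n ≤ h := by
      have : y ≤ n + h := by omega
      have : (y : ℝ) ≤ n + h := by exact_mod_cast this
      linarith
    rw [h1, mul_assoc (2 * Real.pi)]
    have := Real.pi_pos
    gcongr

theorem vk_steps {N h q : ℕ} {a : ℤ} {β δ : ℝ} (k : ℕ) (hk : k * h ≤ N)
    (H : ∀ j < k, ‖∑ n ∈ Ioc 0 (N - j * h), (Λ n : ℂ) * vkw (N - j * h - h) q a n‖ ≤ δ * h) :
    ‖∑ n ∈ Ioc 0 N, (Λ n : ℂ) * vke (n * ((a : ℝ) / q + β))‖ ≤ ‖∑ n ∈ Ioc 0 (N - k * h), (Λ n : ℂ) * vke (n * ((a : ℝ) / q + β))‖ +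
      δ * (k * h) + 2 * Real.pi * h * |β| * ∑ n ∈ Ioc (N - k * h) N, Λ n := by
  induction k with
  | zero => simp
  | succ k ih =>
    have h1 : (k + 1) * h = k * h + h := by ring
    have hkh : k * h ≤ N := by omega
    have ih' := ih hkh fun j hj => H j (by omega)
    have hs := vk_step (y := N - k * h) (h := h) (q := q) (a := a) (β := β) (by omega)
    have hH := H k (by omega)
    rw [h1, ← Nat.sub_sub, ← sum_Ioc_consecutive _ (Nat.sub_le (N - k * h) h) (Nat.sub_le N (k * h))]
    push_cast
    linarith

set_option maxHeartbeats 1000000 in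
theorem vk_major_arc (δ : ℝ) (hδ : 0 < δ) : ∃ q0 : ℕ, ∀ᶠ N : ℕ in atTop, ∀ (q : ℕ) (a : ℤ) (β : ℝ), q0 ≤ q → (q : ℝ) ≤ Real.log N ^ 8 →
    |β| ≤ Real.log N ^ 8 / N → IsUnit (a : ZMod q) →
    ‖∑ n ∈ Ioc 0 N, (Λ n : ℂ) * vke (n * ((a : ℝ) / q + β))‖ ≤ (2 * δ) * N := by
  obtain ⟨q0, hq0⟩ := vk_major δ hδ
  obtain ⟨y0, hy0⟩ := eventually_atTop.1 hq0
  refine ⟨q0, ?_⟩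
  filter_upwards [vk_tendsto_log.eventually_ge_atTop (max 128 (max y0 (60 / δ))), vk_tendsto_log.eventually (vk_ev_exp 2 10),
    eventually_ge_atTop 1] with N hL hexp hN1 q a β hq hqL hβ ha
  have hN0 : (0 : ℝ) < N := by exact_mod_cast hN1
  rw [Real.exp_log hN0] at hexp
  set L := Real.log (N : ℝ) with hLd
  have hL128 : 128 ≤ L := (le_max_left _ _).trans hL
  have hLy0 : (y0 : ℝ) ≤ L := (le_max_left _ _).trans ((le_max_right _ _).trans hL)
  have hLδ : 60 / δ ≤ L := (le_max_right _ _).trans ((le_max_right _ _).trans hL)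
  have hL0 : 0 < L := by linarith
  have hL1 : 1 ≤ L := by linarith
  set h := ⌊(N : ℝ) / L ^ 10⌋₊ with hh
  have hX2 : 2 ≤ (N : ℝ) / L ^ 10 := by rw [le_div_iff₀ (by positivity)]; exact hexp
  have hh1 : (h : ℝ) ≤ N / L ^ 10 := Nat.floor_le (by positivity)
  have hh2 : (N : ℝ) / L ^ 10 / 2 ≤ h := by
    have := Nat.lt_floor_add_one ((N : ℝ) / L ^ 10)
    rw [← hh] at this; linarith
  have hhpos : (0 : ℝ) < h := by linarith
  have hL9 : (N : ℝ) / L ^ 10 ≤ N / L ^ 3 := by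
    have : L ^ 3 ≤ L ^ 10 := pow_le_pow_right₀ hL1 (by norm_num)
    gcongr
  set k := ⌊((N : ℝ) - N / L) / h⌋₊ with hk
  have hNL : (N : ℝ) / L ≤ N := div_le_self hN0.le hL1
  have hk1 : (k : ℝ) * h ≤ N - N / L := by
    have := Nat.floor_le (a := ((N : ℝ) - N / L) / h) (div_nonneg (by linarith) hhpos.le)
    rw [← hk, le_div_iff₀ hhpos] at this; exact this
  have hk2 : (N : ℝ) - N / L ≤ k * h + h := by
    have := (Nat.lt_floor_add_one (((N : ℝ) - N / L) / h)).le
    rw [← hk, div_le_iff₀ hhpos] at this; linarith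
  have hNLpos : 0 < (N : ℝ) / L := by positivity
  have hkN : k * h ≤ N := by
    have : ((k * h : ℕ) : ℝ) ≤ N := by push_cast; linarith
    exact_mod_cast this
  have hmain := vk_steps (N := N) (h := h) (q := q) (a := a) (β := β) (δ := δ) k hkN (by
    intro j hj
    have hjk : (j + 1) * h ≤ k * h := Nat.mul_le_mul_right h hj
    have hj1 : (j + 1) * h = j * h + h := by ring
    set y := N - j * h with hy
    have hyr : (y : ℝ) = N - j * h := by rw [hy, Nat.cast_sub (by omega)]; push_cast; rfl
    have hjk' : ((j : ℝ) + 1) * h ≤ k * h := by exact_mod_cast hjk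
    have hylow : (N : ℝ) / L ≤ y := by rw [hyr]; nlinarith
    have hyN : (y : ℝ) ≤ N := by rw [hyr]; have : 0 ≤ (j : ℝ) * h := by positivity
                                 linarith
    have hLL : L * L ≤ N := by
      have : L ^ 2 ≤ L ^ 10 := pow_le_pow_right₀ hL1 (by norm_num)
      have : 0 ≤ L ^ 10 := by positivity
      nlinarith
    have hyL : L ≤ y := le_trans ((le_div_iff₀ hL0).2 hLL) hylow
    have hy0' : y0 ≤ y := by
      have : (y0 : ℝ) ≤ y := hLy0.trans hyL
      exact_mod_cast this
    have hypos : (0 : ℝ) < y := by linarith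
    have hl1 : Real.log y ≤ L := Real.log_le_log hypos hyN
    have hl2 : L / 2 ≤ Real.log y := by
      have : (N : ℝ) ≤ y * y := by
        rw [div_le_iff₀ hL0] at hylow
        refine hylow.trans (by gcongr)
      have := Real.log_le_log hN0 this
      rw [Real.log_mul hypos.ne' hypos.ne'] at this
      linarith
    have hsub : ((y - h : ℕ) : ℝ) = y - h := Nat.cast_sub (by omega)
    have key := hy0 y hy0' (y - h) q a hq ?_ (Nat.sub_le _ _) ?_ ?_ ha
    · refine key.trans (le_of_eq ?_)
      rw [hsub]; ring
    · refine hqL.trans ?_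
      calc L ^ 8 ≤ (L ^ 2 / 1024) * L ^ 8 := by
            refine le_mul_of_one_le_left (by positivity) ?_
            rw [le_div_iff₀ (by norm_num)]; nlinarith
        _ = (L / 2) ^ 10 := by ring
        _ ≤ _ := by gcongr
    · rw [hsub]
      have : (y : ℝ) - (y - h) = h := by ring
      rw [this]
      refine le_trans ?_ hh2
      calc (y : ℝ) / Real.log y ^ 12 ≤ N / (L / 2) ^ 12 := by gcongr
        _ = N / (L ^ 10 * (L ^ 2 / 4096)) := by congr 1; ring
        _ ≤ N / (L ^ 10 * 2) := by
            gcongr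
            rw [le_div_iff₀ (by norm_num)]; nlinarith
        _ = _ := by field_simp
    · rw [hsub]
      have : (y : ℝ) - (y - h) = h := by ring
      rw [this]
      calc (h : ℝ) ≤ N / L ^ 3 := hh1.trans hL9
        _ ≤ N / L ^ 2 := by
            have : L ^ 2 ≤ L ^ 3 := pow_le_pow_right₀ hL1 (by norm_num)
            gcongr
        _ = N / L / L := by rw [div_div, sq]
        _ ≤ y / Real.log y := by
            have : 0 < Real.log y := by linarith
            gcongr)
  have hrem : ‖∑ n ∈ Ioc 0 (N - k * h), (Λ n : ℂ) * vke (n * ((a : ℝ) / q + β))‖ ≤ 12 * (N / L) := by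
    calc _ ≤ ∑ n ∈ Ioc 0 (N - k * h), Λ n := by
          refine (norm_sum_le _ _).trans (sum_le_sum fun n _ => ?_)
          rw [norm_mul, vke_norm, Complex.norm_real, Real.norm_of_nonneg vonMangoldt_nonneg, mul_one]
      _ ≤ 6 * (N - k * h : ℕ) := vk_psi _
      _ ≤ 6 * (2 * (N / L)) := by
          rw [Nat.cast_sub hkN]; push_cast
          have : (N : ℝ) / L ^ 3 ≤ N / L := by
            have : L ^ 1 ≤ L ^ 3 := pow_le_pow_right₀ hL1 (by norm_num)
            rw [pow_one] at this
            gcongr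
          linarith
      _ = _ := by ring
  have hβh : 2 * Real.pi * h * |β| ≤ 8 / L := by
    calc 2 * Real.pi * h * |β| ≤ 2 * 4 * (N / L ^ 10) * (L ^ 8 / N) := by
          have := Real.pi_pos
          have := Real.pi_le_four
          gcongr
      _ = 8 / L ^ 2 := by field_simp; norm_num
      _ ≤ 8 / L := by
          have : L ^ 1 ≤ L ^ 2 := pow_le_pow_right₀ hL1 (by norm_num)
          rw [pow_one] at this
          gcongr
  have hsum : ∑ n ∈ Ioc (N - k * h) N, Λ n ≤ 6 * N := by
    refine le_trans (sum_le_sum_of_subset_of_nonneg (Ioc_subset_Ioc_left (Nat.zero_le _)) fun _ _ _ => vonMangoldt_nonneg) (vk_psi N)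
  have hsum0 : 0 ≤ ∑ n ∈ Ioc (N - k * h) N, Λ n := sum_nonneg fun _ _ => vonMangoldt_nonneg
  have herr : 2 * Real.pi * h * |β| * ∑ n ∈ Ioc (N - k * h) N, Λ n ≤ 8 / L * (6 * N) := by gcongr
  have hfin : 60 * (N / L) ≤ δ * N := by
    rw [div_le_iff₀ hδ] at hLδ
    rw [← mul_div_assoc, div_le_iff₀ hL0]
    nlinarith
  have hkδ : δ * (k * h) ≤ δ * N := by
    refine mul_le_mul_of_nonneg_left ?_ hδ.le
    linarith
  have e : 8 / L * (6 * N) = 48 * (N / L) := by ring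
  rw [e] at herr
  linarith

theorem vk_irr {α : ℝ} (hα : Irrational α) (ε : ℝ) (hε : 0 < ε) : ∀ᶠ N : ℕ in atTop,
    ‖∑ n ∈ Ioc 0 N, (Λ n : ℂ) * vke (n * α)‖ ≤ ε * N := by
  obtain ⟨q0, hq0⟩ := vk_major_arc (ε / 2) (by positivity)
  have hlim : Tendsto (fun N : ℕ => Real.log N ^ 8 / N) atTop (nhds 0) := by
    have := (Real.isLittleO_pow_log_id_atTop (n := 8)).tendsto_div_nhds_zero
    exact this.comp tendsto_natCast_atTop_atTop
  have hsep : ∀ᶠ N : ℕ in atTop, ∀ q ∈ Finset.Ioo 0 q0, Real.log N ^ 8 / N < |(q : ℝ) * α - round ((q : ℝ) * α)| := by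
    rw [Filter.eventually_all_finset]
    intro q hq
    rw [mem_Ioo] at hq
    refine hlim.eventually_lt_const ?_
    rw [abs_pos, sub_ne_zero]
    have := (hα.natCast_mul (m := q) (by omega)).ne_int (round ((q : ℝ) * α))
    exact this
  filter_upwards [hq0, vk_minor ε hε, hsep, vk_tendsto_log.eventually_ge_atTop 1, vk_tendsto_log.eventually (vk_ev_exp 1 8),
    eventually_ge_atTop 1] with N hmaj hmin hsep hL1 hexp hN1
  have hN0 : (0 : ℝ) < N := by exact_mod_cast hN1
  rw [Real.exp_log hN0, one_mul] at hexp
  set L := Real.log (N : ℝ) with hLd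
  have hX : 1 ≤ (N : ℝ) / L ^ 8 := by rw [le_div_iff₀ (by positivity)]; linarith
  set n := ⌊(N : ℝ) / L ^ 8⌋₊ with hn
  have hn1 : 0 < n := Nat.floor_pos.2 hX
  have hnX : (n : ℝ) ≤ N / L ^ 8 := Nat.floor_le (by positivity)
  have hnX2 : (N : ℝ) / L ^ 8 ≤ n + 1 := (Nat.lt_floor_add_one _).le
  obtain ⟨x, hx1, hx2⟩ := Real.exists_rat_abs_sub_le_and_den_le α hn1
  have hd0 : (0 : ℝ) < x.den := by exact_mod_cast x.den_pos
  have hx1' : |α - x.num / x.den| ≤ L ^ 8 / (x.den * N) := by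
    have : (x : ℝ) = x.num / x.den := Rat.cast_def x
    rw [← this]
    refine hx1.trans ?_
    calc 1 / (((n : ℝ) + 1) * x.den) ≤ 1 / ((N / L ^ 8) * x.den) := by gcongr
      _ = _ := by field_simp
  have hunit : IsUnit ((x.num : ℤ) : ZMod x.den) := by
    rw [ZMod.coe_int_isUnit_iff_isCoprime, Int.isCoprime_iff_gcd_eq_one, Int.gcd_comm]
    exact x.reduced
  by_cases hc : L ^ 8 ≤ x.den
  · refine hmin x.den x.num α hunit hc ?_ hx1'
    refine le_trans ?_ hnX
    exact_mod_cast hx2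
  · push Not at hc
    have hq : q0 ≤ x.den := by
      by_contra hlt
      push Not at hlt
      have h1 := hsep x.den (mem_Ioo.2 ⟨x.den_pos, hlt⟩)
      have h2 := round_le ((x.den : ℝ) * α) x.num
      have h3 : |(x.den : ℝ) * α - x.num| ≤ L ^ 8 / N := by
        have e : (x.den : ℝ) * α - x.num = x.den * (α - x.num / x.den) := by field_simp
        rw [e, abs_mul, abs_of_pos hd0]
        calc _ ≤ x.den * (L ^ 8 / (x.den * N)) := by gcongr
          _ = _ := by field_simp
      linarith
    have h1 := hmaj x.den x.num (α - x.num / x.den) hq hc.le ?_ hunit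
    · simp only [add_sub_cancel] at h1
      linarith
    · refine hx1'.trans ?_
      have : (1 : ℝ) ≤ x.den := by exact_mod_cast x.den_pos
      gcongr
      nlinarith
end PartA15

section PartA16
open MeasureTheory

noncomputable def vkK (x : ℝ) : ℝ := 2 * (1 - Real.cos x) / x ^ 2

theorem vkK_nonneg (x : ℝ) : 0 ≤ vkK x := by
  unfold vkK
  have := Real.cos_le_one x
  exact div_nonneg (by linarith) (sq_nonneg x)

theorem vkK_le (x : ℝ) : vkK x ≤ 5 * (1 + x ^ 2)⁻¹ := by
  unfold vkK
  rcases eq_or_ne x 0 with rfl | hx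
  · simp
  have hx2 : 0 < x ^ 2 := by positivity
  rw [← div_eq_mul_inv, div_le_div_iff₀ hx2 (by positivity)]
  have h1 := Real.one_sub_sq_div_two_le_cos (x := x)
  have h2 := Real.neg_one_le_cos x
  rcases le_total (x ^ 2) 4 with h | h
  · nlinarith
  · nlinarith

theorem vkK_measurable : Measurable vkK := by
  unfold vkK; fun_prop

theorem vkK_integrable : Integrable vkK := by
  refine (integrable_inv_one_add_sq.const_mul 5).mono' vkK_measurable.aestronglyMeasurable ?_
  filter_upwards with x
  rw [Real.norm_of_nonneg (vkK_nonneg x)]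
  exact vkK_le x

theorem vkK_integral_pos : 0 < ∫ x, vkK x := by
  rw [integral_pos_iff_support_of_nonneg vkK_nonneg vkK_integrable]
  have : Set.Ioo 0 Real.pi ⊆ Function.support vkK := by
    intro x hx
    rw [Function.mem_support]
    unfold vkK
    have : Real.cos x < 1 := by
      have := Real.cos_lt_cos_of_nonneg_of_le_pi (le_refl 0) hx.2.le hx.1
      simpa using this
    have h1 := hx.1
    have : 0 < 2 * (1 - Real.cos x) / x ^ 2 := by
      apply div_pos <;> [linarith; positivity]
    exact this.ne'
  refine lt_of_lt_of_le ?_ (measure_mono this)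
  simp [Real.pi_pos]

noncomputable def vkTri (t : ℝ) : ℝ := max (1 - |t|) 0

theorem vkTri_cont : Continuous vkTri := by unfold vkTri; fun_prop

theorem vkTri_nonneg (t : ℝ) : 0 ≤ vkTri t := le_max_right _ _
theorem vkTri_le (t : ℝ) : vkTri t ≤ 1 := by
  unfold vkTri; exact max_le (by linarith [abs_nonneg t]) zero_le_one

theorem vk_tri_int (x : ℝ) (hx : x ≠ 0) : ∫ t in (-1 : ℝ)..1, (vkTri t : ℂ) * Complex.exp (x * t * Complex.I) = (vkK x : ℂ) := by
  have hx' : (x : ℂ) ≠ 0 := by exact_mod_cast hx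
  have hI := Complex.I_ne_zero
  have hint : ∀ a b : ℝ, IntervalIntegrable (fun t : ℝ => (vkTri t : ℂ) * Complex.exp (x * t * Complex.I)) volume a b := by
    intro a b
    apply Continuous.intervalIntegrable
    have := vkTri_cont
    fun_prop
  rw [← intervalIntegral.integral_add_adjacent_intervals (hint (-1) 0) (hint 0 1)]
  have e1 : ∫ t in (-1 : ℝ)..0, (vkTri t : ℂ) * Complex.exp (x * t * Complex.I) = ∫ t in (-1 : ℝ)..0, (1 + t : ℂ) * Complex.exp (x * t * Complex.I) := by
    refine intervalIntegral.integral_congr fun t ht => ?_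
    rw [Set.uIcc_of_le (by norm_num)] at ht
    rw [vkTri, abs_of_nonpos ht.2, max_eq_left (by linarith [ht.1])]
    push_cast; ring
  have e2 : ∫ t in (0 : ℝ)..1, (vkTri t : ℂ) * Complex.exp (x * t * Complex.I) = ∫ t in (0 : ℝ)..1, (1 - t : ℂ) * Complex.exp (x * t * Complex.I) := by
    refine intervalIntegral.integral_congr fun t ht => ?_
    rw [Set.uIcc_of_le (by norm_num)] at ht
    rw [vkTri, abs_of_nonneg ht.1, max_eq_left (by linarith [ht.2])]
    push_cast; ring
  have hexp : ∀ t : ℝ, HasDerivAt (fun t : ℝ => Complex.exp (x * t * Complex.I)) (Complex.exp (x * t * Complex.I) * (x * Complex.I)) t := by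
    intro t
    have h1 : HasDerivAt (fun t : ℝ => (x : ℂ) * t * Complex.I) (x * 1 * Complex.I) t :=
      ((Complex.ofRealCLM.hasDerivAt (x := t)).const_mul (x : ℂ)).mul_const Complex.I
    rw [mul_one] at h1
    exact h1.cexp
  have hid : ∀ t : ℝ, HasDerivAt (fun t : ℝ => (t : ℂ)) 1 t := fun t => Complex.ofRealCLM.hasDerivAt (x := t)
  have i1 : ∫ t in (-1 : ℝ)..0, (1 + t : ℂ) * Complex.exp (x * t * Complex.I) =
      (1 / (x * Complex.I) + 1 / x ^ 2) - (Complex.exp (-x * Complex.I) / x ^ 2) := by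
    rw [intervalIntegral.integral_eq_sub_of_hasDerivAt (f := fun t : ℝ => (1 + t : ℂ) * Complex.exp (x * t * Complex.I) / (x * Complex.I) + Complex.exp (x * t * Complex.I) / x ^ 2)]
    · push_cast
      simp
    · intro t _
      have := ((((hid t).const_add 1).mul (hexp t)).div_const (x * Complex.I)).add ((hexp t).div_const ((x : ℂ) ^ 2))
      refine HasDerivAt.congr_deriv this ?_
      field_simp
      first
        | linear_combination Complex.I_sq
        | linear_combination -Complex.I_sq
    · apply Continuous.intervalIntegrable; fun_prop
  have i2 : ∫ t in (0 : ℝ)..1, (1 - t : ℂ) * Complex.exp (x * t * Complex.I) =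
      (- Complex.exp (x * Complex.I) / x ^ 2) - (1 / (x * Complex.I) - 1 / x ^ 2) := by
    rw [intervalIntegral.integral_eq_sub_of_hasDerivAt (f := fun t : ℝ => (1 - t : ℂ) * Complex.exp (x * t * Complex.I) / (x * Complex.I) - Complex.exp (x * t * Complex.I) / x ^ 2)]
    · push_cast
      simp
      ring
    · intro t _
      have := ((((hid t).const_sub 1).mul (hexp t)).div_const (x * Complex.I)).sub ((hexp t).div_const ((x : ℂ) ^ 2))
      refine HasDerivAt.congr_deriv this ?_
      field_simp
      first
        | linear_combination Complex.I_sq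
        | linear_combination -Complex.I_sq
    · apply Continuous.intervalIntegrable; fun_prop
  rw [e1, e2, i1, i2, vkK]
  push_cast
  have hc := Complex.two_cos (x : ℂ)
  rw [show 2 * (1 - Complex.cos x) = 2 - 2 * Complex.cos x by ring, hc]
  ring
end PartA16

section PartA17
open MeasureTheory

theorem vk_W1a (g : ℝ → ℝ) (hgm : Measurable g) (C : ℝ) (hgC : ∀ u, |g u| ≤ C) (hg0 : ∀ u ≤ 0, g u = 0) (H : ℂ → ℂ)
    (hHg : ∀ z : ℂ, 0 < z.re → H z = ∫ u : ℝ, (g u : ℂ) * Complex.exp (-z * u)) (ε y : ℝ) (hε : 0 < ε) :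
    ∫ u : ℝ, (g u : ℂ) * Complex.exp (-ε * u) * (vkK (y - u) : ℂ) =
      ∫ t in Set.Ioc (-1 : ℝ) 1, (vkTri t : ℂ) * Complex.exp (y * t * Complex.I) * H (ε + t * Complex.I) := by
  have hC : 0 ≤ C := (abs_nonneg _).trans (hgC 0)
  set F : ℝ → ℝ → ℂ := fun t u => (vkTri t : ℂ) * Complex.exp (y * t * Complex.I) * ((g u : ℂ) * Complex.exp (-(ε + t * Complex.I) * u)) with hF
  have hdom : Integrable (fun u : ℝ => (Set.Ioi (0 : ℝ)).indicator (fun u => C * Real.exp (-ε * u)) u) := by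
    rw [integrable_indicator_iff measurableSet_Ioi]
    exact (integrableOn_exp_mul_Ioi (a := -ε) (by linarith) 0).const_mul C
  have hint : Integrable (Function.uncurry F) ((volume.restrict (Set.Ioc (-1 : ℝ) 1)).prod volume) := by
    have h1 : Integrable (fun _ : ℝ => (1 : ℝ)) (volume.restrict (Set.Ioc (-1 : ℝ) 1)) := integrable_const _
    refine (h1.mul_prod hdom).mono' ?_ ?_
    · apply Measurable.aestronglyMeasurable
      have := vkTri_cont.measurable
      simp only [hF, Function.uncurry_def]
      fun_prop
    · filter_upwards with p
      simp only [hF, Function.uncurry_def]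
      rw [norm_mul, norm_mul, norm_mul, Complex.norm_real, Complex.norm_real, Complex.norm_exp, Complex.norm_exp]
      have e1 : ((y : ℂ) * p.1 * Complex.I).re = 0 := by simp
      have e2 : (-((ε : ℂ) + p.1 * Complex.I) * p.2).re = -ε * p.2 := by simp
      rw [e1, e2, Real.exp_zero, mul_one, Real.norm_of_nonneg (vkTri_nonneg _), one_mul]
      by_cases hp : 0 < p.2
      · rw [Set.indicator_of_mem (Set.mem_Ioi.2 hp)]
        calc _ ≤ 1 * (|g p.2| * Real.exp (-ε * p.2)) := by
              gcongr
              · exact vkTri_le _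
              · exact le_of_eq (Real.norm_eq_abs _)
          _ ≤ _ := by rw [one_mul]; gcongr; exact hgC _
      · rw [Set.indicator_of_notMem (by simpa using hp), hg0 _ (not_lt.1 hp)]; simp
  have hswap := integral_integral_swap hint
  have eL : ∀ t : ℝ, ∫ u : ℝ, F t u = (vkTri t : ℂ) * Complex.exp (y * t * Complex.I) * H (ε + t * Complex.I) := by
    intro t
    simp only [hF]
    rw [integral_const_mul, hHg _ (by simpa using hε)]
  simp only [eL] at hswap
  rw [hswap]
  refine integral_congr_ae ?_
  have hne : ∀ᵐ u : ℝ, u ≠ y := by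
    rw [ae_iff]; simp
  filter_upwards [hne] with u hu
  rw [← vk_tri_int (y - u) (sub_ne_zero.2 (Ne.symm hu)), intervalIntegral.integral_of_le (by norm_num), ← integral_const_mul]
  refine integral_congr_ae (Eventually.of_forall fun t => ?_)
  simp only [hF]
  have : Complex.exp (((y - u : ℝ) : ℂ) * t * Complex.I) * Complex.exp (-ε * u) = Complex.exp (y * t * Complex.I) * Complex.exp (-(ε + t * Complex.I) * u) := by
    rw [← Complex.exp_add, ← Complex.exp_add]; congr 1; push_cast; ring
  linear_combination (vkTri t : ℂ) * (g u : ℂ) * this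

theorem vk_W1b (g : ℝ → ℝ) (hgm : Measurable g) (C : ℝ) (hgC : ∀ u, |g u| ≤ C) (hg0 : ∀ u ≤ 0, g u = 0) (H : ℂ → ℂ)
    (hH : ContinuousOn H {z | 0 ≤ z.re})
    (hHg : ∀ z : ℂ, 0 < z.re → H z = ∫ u : ℝ, (g u : ℂ) * Complex.exp (-z * u)) (y : ℝ) :
    ((∫ u : ℝ, g u * vkK (y - u) : ℝ) : ℂ) =
      ∫ t in Set.Ioc (-1 : ℝ) 1, (vkTri t : ℂ) * Complex.exp (y * t * Complex.I) * H (t * Complex.I) := by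
  have hC : 0 ≤ C := (abs_nonneg _).trans (hgC 0)
  set e : ℕ → ℝ := fun n => 1 / ((n : ℝ) + 1) with he
  have he0 : ∀ n, 0 < e n := fun n => by positivity
  have he1 : ∀ n, e n ≤ 1 := fun n => by
    simp only [he]
    rw [div_le_one (by positivity)]
    have : (0 : ℝ) ≤ n := Nat.cast_nonneg n
    linarith
  have helim : Tendsto e atTop (nhds 0) := tendsto_one_div_add_atTop_nhds_zero_nat
  have hKm := vkK_measurable
  have hL : Tendsto (fun n => ∫ u : ℝ, (g u : ℂ) * Complex.exp (-e n * u) * (vkK (y - u) : ℂ)) atTop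
      (nhds (∫ u : ℝ, (g u : ℂ) * (vkK (y - u) : ℂ))) := by
    refine tendsto_integral_of_dominated_convergence (fun u => C * vkK (y - u)) ?_ ?_ ?_ ?_
    · intro n; apply Measurable.aestronglyMeasurable; fun_prop
    · exact (vkK_integrable.comp_sub_left y).const_mul C
    · intro n
      filter_upwards with u
      rw [norm_mul, norm_mul, Complex.norm_real, Complex.norm_real, Complex.norm_exp, Real.norm_of_nonneg (vkK_nonneg _)]
      refine mul_le_mul_of_nonneg_right ?_ (vkK_nonneg _)
      have e2 : (-(e n : ℂ) * u).re = -e n * u := by simp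
      rw [e2]
      by_cases hu : 0 < u
      · calc _ ≤ C * 1 := by
              gcongr
              · exact (Real.norm_eq_abs _).le.trans (hgC u)
              · rw [Real.exp_le_one_iff]; nlinarith [he0 n]
          _ = C := mul_one C
      · rw [hg0 u (not_lt.1 hu)]; simpa using hC
    · filter_upwards with u
      have h1 : Tendsto (fun n => Complex.exp (-(e n : ℂ) * u)) atTop (nhds (Complex.exp (-((0 : ℝ) : ℂ) * u))) := by
        have hc : Continuous fun x : ℝ => Complex.exp (-(x : ℂ) * u) := by fun_prop
        exact (hc.tendsto 0).comp helim
      simp only [Complex.ofReal_zero, neg_zero, zero_mul, Complex.exp_zero] at h1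
      have := (h1.const_mul (g u : ℂ)).mul_const (vkK (y - u) : ℂ)
      simpa using this
  have hcpt : IsCompact (Set.Icc (0 : ℝ) 1 ×ℂ Set.Icc (-1 : ℝ) 1) := isCompact_Icc.reProdIm isCompact_Icc
  obtain ⟨M, hM⟩ := hcpt.exists_bound_of_continuousOn (hH.mono (fun z hz => (Complex.mem_reProdIm.1 hz).1.1))
  have hR : Tendsto (fun n => ∫ t in Set.Ioc (-1 : ℝ) 1, (vkTri t : ℂ) * Complex.exp (y * t * Complex.I) * H (e n + t * Complex.I)) atTop
      (nhds (∫ t in Set.Ioc (-1 : ℝ) 1, (vkTri t : ℂ) * Complex.exp (y * t * Complex.I) * H (t * Complex.I))) := by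
    refine tendsto_integral_of_dominated_convergence (fun _ => M) ?_ ?_ ?_ ?_
    · intro n
      apply Continuous.aestronglyMeasurable
      have h1 : Continuous fun t : ℝ => H (e n + t * Complex.I) := by
        refine hH.comp_continuous (by fun_prop) fun t => ?_
        simpa using (he0 n).le
      have := vkTri_cont
      have h2 : Continuous fun t : ℝ => (vkTri t : ℂ) * Complex.exp (y * t * Complex.I) := by fun_prop
      exact h2.mul h1
    · exact integrable_const _
    · intro n
      filter_upwards [ae_restrict_mem measurableSet_Ioc] with t ht
      have hb := hM (e n + t * Complex.I) (by
        rw [Complex.mem_reProdIm]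
        simp only [Complex.add_re, Complex.ofReal_re, Complex.mul_re, Complex.I_re, mul_zero, Complex.ofReal_im, Complex.I_im, sub_self, add_zero,
          Complex.add_im, Complex.mul_im, mul_one, zero_add]
        exact ⟨⟨(he0 n).le, he1 n⟩, ⟨ht.1.le, ht.2⟩⟩)
      rw [norm_mul, norm_mul, Complex.norm_real, Complex.norm_exp, Real.norm_of_nonneg (vkTri_nonneg _)]
      have e1 : ((y : ℂ) * t * Complex.I).re = 0 := by simp
      rw [e1, Real.exp_zero, mul_one]
      exact (mul_le_of_le_one_left (norm_nonneg _) (vkTri_le t)).trans hb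
    · filter_upwards with t
      refine Tendsto.const_mul _ ?_
      have hc : ContinuousOn (fun x : ℝ => H (x + t * Complex.I)) (Set.Ici 0) := by
        refine hH.comp (by fun_prop) fun x hx => ?_
        simpa using hx
      have h0 := (hc 0 (Set.mem_Ici.2 le_rfl)).tendsto
      simp only [Complex.ofReal_zero, zero_add] at h0
      refine h0.comp (tendsto_nhdsWithin_iff.2 ⟨helim, Eventually.of_forall fun n => (he0 n).le⟩)
  have heq : ∀ n, _ := fun n => vk_W1a g hgm C hgC hg0 H hHg (e n) y (he0 n)
  simp only [heq] at hL
  rw [← tendsto_nhds_unique hL hR, ← integral_complex_ofReal]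
  simp only [Complex.ofReal_mul]

theorem vk_W1 (g : ℝ → ℝ) (hgm : Measurable g) (C : ℝ) (hgC : ∀ u, |g u| ≤ C) (hg0 : ∀ u ≤ 0, g u = 0) (H : ℂ → ℂ)
    (hH : ContinuousOn H {z | 0 ≤ z.re})
    (hHg : ∀ z : ℂ, 0 < z.re → H z = ∫ u : ℝ, (g u : ℂ) * Complex.exp (-z * u)) :
    Tendsto (fun y : ℝ => ∫ x, g (y - x) * vkK x) atTop (nhds 0) := by
  set f : ℝ → ℂ := (Set.Ioc (-1 : ℝ) 1).indicator (fun t => (vkTri t : ℂ) * H (t * Complex.I)) with hf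
  have hRL := Real.tendsto_integral_exp_smul_cocompact f
  have hlin : Tendsto (fun y : ℝ => -y / (2 * Real.pi)) atTop (cocompact ℝ) := by
    have h1 : Tendsto (fun y : ℝ => -y / (2 * Real.pi)) atTop atBot := by
      apply Tendsto.atBot_div_const (by positivity)
      exact tendsto_neg_atTop_atBot
    exact h1.mono_right atBot_le_cocompact
  have h2 := hRL.comp hlin
  have h3 : ∀ y : ℝ, ((∫ x, g (y - x) * vkK x : ℝ) : ℂ) = ((fun w : ℝ => ∫ v : ℝ, Real.fourierChar (-(v * w)) • f v) ∘ fun y : ℝ => -y / (2 * Real.pi)) y := by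
    intro y
    have e1 : ∫ x, g (y - x) * vkK x = ∫ u, g u * vkK (y - u) := by
      rw [← integral_sub_left_eq_self (fun u => g u * vkK (y - u)) volume y]
      simp
    rw [e1, vk_W1b g hgm C hgC hg0 H hH hHg y, ← integral_indicator measurableSet_Ioc]
    simp only [Function.comp]
    refine integral_congr_ae (Eventually.of_forall fun t => ?_)
    simp only [hf]
    by_cases ht : t ∈ Set.Ioc (-1 : ℝ) 1
    · rw [Set.indicator_of_mem ht, Set.indicator_of_mem ht, Circle.smul_def, Real.fourierChar_apply, smul_eq_mul]
      have : (((2 * Real.pi * -(t * (-y / (2 * Real.pi))) : ℝ) : ℂ) * Complex.I) = y * t * Complex.I := by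
        congr 1
        have : 2 * Real.pi * -(t * (-y / (2 * Real.pi))) = y * t := by
          have := Real.pi_pos
          field_simp
        rw [this]; push_cast; rfl
      rw [this]; ring
    · rw [Set.indicator_of_notMem ht, Set.indicator_of_notMem ht, smul_zero]
  rw [← funext h3] at h2
  have h4 := (Complex.continuous_re.tendsto 0).comp h2
  simpa [Function.comp_def] using h4
end PartA17

section PartA18
open MeasureTheory

theorem vk_W1s (g : ℝ → ℝ) (hgm : Measurable g) (C : ℝ) (hgC : ∀ u, |g u| ≤ C) (hg0 : ∀ u ≤ 0, g u = 0) (H : ℂ → ℂ)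
    (hH : ContinuousOn H {z | 0 ≤ z.re})
    (hHg : ∀ z : ℂ, 0 < z.re → H z = ∫ u : ℝ, (g u : ℂ) * Complex.exp (-z * u)) (T : ℝ) (hT : 0 < T) :
    Tendsto (fun y : ℝ => ∫ x, g (y - x / T) * vkK x) atTop (nhds 0) := by
  have h := vk_W1 (fun v => g (v / T)) (by fun_prop) C (fun u => hgC _)
    (fun u hu => hg0 _ (div_nonpos_of_nonpos_of_nonneg hu hT.le)) (fun z => T * H (T * z)) ?_ ?_
  · have h2 := h.comp (tendsto_id.const_mul_atTop hT)
    refine h2.congr fun y => ?_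
    simp only [Function.comp, id]
    refine integral_congr_ae (Eventually.of_forall fun x => ?_)
    simp only
    congr 2
    field_simp
  · refine continuousOn_const.mul (hH.comp (by fun_prop) fun z hz => ?_)
    have hz' : 0 ≤ z.re := hz
    simp only [Set.mem_ofPred_eq, Complex.re_ofReal_mul]
    positivity
  · intro z hz
    have h1 := Measure.integral_comp_div (fun u : ℝ => (g u : ℂ) * Complex.exp (-(T * z) * u)) T
    rw [← hHg _ (by simpa using mul_pos hT hz), abs_of_pos hT] at h1
    rw [Complex.real_smul] at h1
    rw [← h1]
    refine integral_congr_ae (Eventually.of_forall fun x => ?_)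
    simp only
    congr 2
    have : (T : ℂ) ≠ 0 := by exact_mod_cast hT.ne'
    push_cast
    field_simp

theorem vk_J_tendsto : Tendsto (fun R : ℝ => ∫ x in Set.Icc (-R) R, vkK x) atTop (nhds (∫ x, vkK x)) := by
  have : AECover (volume : Measure ℝ) atTop (fun R : ℝ => Set.Icc (-R) R) :=
    aecover_Icc tendsto_neg_atTop_atBot tendsto_id
  exact this.integral_tendsto_of_countably_generated vkK_integrable

theorem vk_W2 (B : ℝ → ℝ) (A : ℝ) (hA : 0 ≤ A) (hB : ∀ u, 0 ≤ B u) (hmono : ∀ u v, u ≤ v → B u ≤ B v * Real.exp (v - u))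
    (g : ℝ → ℝ) (hgm : Measurable g) (C : ℝ) (hgC : ∀ u, |g u| ≤ C) (hg0 : ∀ u ≤ 0, g u = 0) (hgB : ∀ u, 0 < u → g u = B u - A)
    (H : ℂ → ℂ) (hH : ContinuousOn H {z | 0 ≤ z.re})
    (hHg : ∀ z : ℂ, 0 < z.re → H z = ∫ u : ℝ, (g u : ℂ) * Complex.exp (-z * u)) :
    Tendsto B atTop (nhds A) := by
  have hC : 0 ≤ C := (abs_nonneg _).trans (hgC 0)
  set I := ∫ x, vkK x with hI
  have hIpos : 0 < I := vkK_integral_pos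
  have key : ∀ η : ℝ, 0 < η → η < 1 → ∀ᶠ y in atTop, B y ≤ (1 + η) * (A + η) / (1 - η) ∧ (A - (C + 1) * η / (1 - η)) / (1 + η) ≤ B y := by
    intro η hη hη1
    obtain ⟨R, hR, hR0⟩ : ∃ R : ℝ, I * (1 - η) < ∫ x in Set.Icc (-R) R, vkK x ∧ 0 < R := by
      have h1 := vk_J_tendsto.eventually (lt_mem_nhds (show I * (1 - η) < I by nlinarith))
      obtain ⟨R, hR⟩ := (h1.and (eventually_gt_atTop 0)).exists
      exact ⟨R, hR.1, hR.2⟩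
    set J := ∫ x in Set.Icc (-R) R, vkK x with hJ
    have hJI : J ≤ I := setIntegral_le_integral vkK_integrable (Eventually.of_forall vkK_nonneg)
    have hJpos : 0 < J := lt_of_le_of_lt (by nlinarith) hR
    set δ := Real.log (1 + η) / 2 with hδ
    have hδ0 : 0 < δ := by have := Real.log_pos (show 1 < 1 + η by linarith); positivity
    have hexp : Real.exp (2 * δ) = 1 + η := by
      rw [hδ, mul_div_cancel₀ _ (two_ne_zero), Real.exp_log (by linarith)]
    set T := R / δ with hT
    have hT0 : 0 < T := by positivity
    have hxT : ∀ x ∈ Set.Icc (-R) R, -δ ≤ x / T ∧ x / T ≤ δ := by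
      intro x hx
      have hTd : T * δ = R := by rw [hT]; field_simp
      constructor
      · rw [le_div_iff₀ hT0]; nlinarith [hx.1]
      · rw [div_le_iff₀ hT0]; nlinarith [hx.2]
    have hW := vk_W1s g hgm C hgC hg0 H hH hHg T hT0
    have hKm := vkK_measurable
    have hgi : ∀ y : ℝ, Integrable fun x => g (y - x / T) * vkK x := by
      intro y
      refine (vkK_integrable.const_mul C).mono' (by apply Measurable.aestronglyMeasurable; fun_prop) ?_
      filter_upwards with x
      rw [norm_mul, Real.norm_of_nonneg (vkK_nonneg _)]
      exact mul_le_mul_of_nonneg_right (hgC _) (vkK_nonneg _)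
    have hind : Integrable ((Set.Icc (-R) R).indicator vkK) := vkK_integrable.indicator measurableSet_Icc
    have hindJ : ∫ x, (Set.Icc (-R) R).indicator vkK x = J := integral_indicator measurableSet_Icc
    have hup := (hW.comp (tendsto_atTop_add_const_right atTop δ tendsto_id)).eventually (gt_mem_nhds (show 0 < η * I by positivity))
    have hlow := (hW.comp (tendsto_atTop_add_const_right atTop (-δ) tendsto_id)).eventually (lt_mem_nhds (show -(η * I) < 0 by nlinarith))
    filter_upwards [hup, hlow, eventually_gt_atTop (2 * δ)] with y h1 h2 hy
    simp only [Function.comp, id] at h1 h2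
    constructor
    · have hle : B y / (1 + η) * J - A * I ≤ ∫ x, g (y + δ - x / T) * vkK x := by
        have e : B y / (1 + η) * J - A * I = ∫ x, (B y / (1 + η) * (Set.Icc (-R) R).indicator vkK x - A * vkK x) := by
          rw [integral_sub (hind.const_mul _) (vkK_integrable.const_mul _), integral_const_mul, integral_const_mul, hindJ]
        rw [e]
        refine integral_mono ((hind.const_mul _).sub (vkK_integrable.const_mul _)) (hgi _) fun x => ?_
        simp only
        by_cases hx : x ∈ Set.Icc (-R) R
        · rw [Set.indicator_of_mem hx, ← sub_mul]
          refine mul_le_mul_of_nonneg_right ?_ (vkK_nonneg _)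
          have hx2 := hxT x hx
          rw [hgB _ (by linarith [hx2.2])]
          refine sub_le_sub_right ?_ _
          rw [div_le_iff₀ (by linarith), ← hexp]
          refine (hmono y (y + δ - x / T) (by linarith [hx2.2])).trans ?_
          refine mul_le_mul_of_nonneg_left (Real.exp_le_exp.2 (by linarith [hx2.1])) (hB _)
        · rw [Set.indicator_of_notMem hx, mul_zero, zero_sub, ← neg_mul]
          refine mul_le_mul_of_nonneg_right ?_ (vkK_nonneg _)
          rcases le_or_gt (y + δ - x / T) 0 with h | h
          · rw [hg0 _ h]; linarith
          · rw [hgB _ h]; linarith [hB (y + δ - x / T)]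
      have h3 : B y / (1 + η) * (I * (1 - η)) ≤ (A + η) * I := by
        have : B y / (1 + η) * (I * (1 - η)) ≤ B y / (1 + η) * J :=
          mul_le_mul_of_nonneg_left hR.le (div_nonneg (hB y) (by linarith))
        nlinarith
      have h4 : B y / (1 + η) * (1 - η) ≤ A + η := by
        refine le_of_mul_le_mul_right ?_ hIpos
        linarith
      rw [le_div_iff₀ (by linarith)]
      rw [div_mul_eq_mul_div, div_le_iff₀ (by linarith)] at h4
      linarith
    · have hle : ∫ x, g (y + -δ - x / T) * vkK x ≤ (B y * (1 + η) - A - C) * J + C * I := by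
        have e : (B y * (1 + η) - A - C) * J + C * I = ∫ x, ((B y * (1 + η) - A - C) * (Set.Icc (-R) R).indicator vkK x + C * vkK x) := by
          rw [integral_add (hind.const_mul _) (vkK_integrable.const_mul _), integral_const_mul, integral_const_mul, hindJ]
        rw [e]
        refine integral_mono (hgi _) ((hind.const_mul _).add (vkK_integrable.const_mul _)) fun x => ?_
        simp only
        by_cases hx : x ∈ Set.Icc (-R) R
        · rw [Set.indicator_of_mem hx, ← add_mul]
          refine mul_le_mul_of_nonneg_right ?_ (vkK_nonneg _)
          have hx2 := hxT x hx
          rw [hgB _ (by linarith [hx2.2])]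
          rw [sub_add_cancel]
          refine sub_le_sub_right ?_ _
          rw [← hexp]
          refine (hmono (y + -δ - x / T) y (by linarith [hx2.1])).trans ?_
          refine mul_le_mul_of_nonneg_left (Real.exp_le_exp.2 (by linarith [hx2.2])) (hB _)
        · rw [Set.indicator_of_notMem hx, mul_zero, zero_add]
          exact mul_le_mul_of_nonneg_right ((le_abs_self _).trans (hgC _)) (vkK_nonneg _)
      have h3 : (A - B y * (1 + η)) * J ≤ (C + 1) * η * I := by nlinarith
      rw [div_le_iff₀ (by linarith), sub_le_iff_le_add, ← sub_le_iff_le_add', le_div_iff₀ (by linarith)]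
      rcases le_or_gt (A - B y * (1 + η)) 0 with h | h
      · have : 0 ≤ (C + 1) * η := by positivity
        nlinarith
      · refine le_of_mul_le_mul_right ?_ hIpos
        nlinarith
  have c1 : Tendsto (fun η : ℝ => (1 + η) * (A + η) / (1 - η)) (nhds 0) (nhds A) := by
    have : ContinuousAt (fun η : ℝ => (1 + η) * (A + η) / (1 - η)) 0 := by
      apply ContinuousAt.div (by fun_prop) (by fun_prop); norm_num
    simpa [ContinuousAt] using this
  have c2 : Tendsto (fun η : ℝ => (A - (C + 1) * η / (1 - η)) / (1 + η)) (nhds 0) (nhds A) := by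
    have : ContinuousAt (fun η : ℝ => (A - (C + 1) * η / (1 - η)) / (1 + η)) 0 := by
      apply ContinuousAt.div _ (by fun_prop) (by norm_num)
      apply ContinuousAt.sub (by fun_prop)
      apply ContinuousAt.div (by fun_prop) (by fun_prop); norm_num
    simpa [ContinuousAt] using this
  rw [tendsto_order]
  constructor
  · intro a ha
    have e := ((c2.eventually (lt_mem_nhds ha)).filter_mono nhdsWithin_le_nhds).and
      ((eventually_mem_nhdsWithin (s := Set.Ioi (0 : ℝ))).and (nhdsWithin_le_nhds (gt_mem_nhds (show (0 : ℝ) < 1 by norm_num))))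
    obtain ⟨η, h1, h2, h3⟩ := e.exists
    filter_upwards [key η h2 h3] with y hy
    exact h1.trans_le hy.2
  · intro a ha
    have e := ((c1.eventually (gt_mem_nhds ha)).filter_mono nhdsWithin_le_nhds).and
      ((eventually_mem_nhdsWithin (s := Set.Ioi (0 : ℝ))).and (nhdsWithin_le_nhds (gt_mem_nhds (show (0 : ℝ) < 1 by norm_num))))
    obtain ⟨η, h1, h2, h3⟩ := e.exists
    filter_upwards [key η h2 h3] with y hy
    exact hy.1.trans_lt h1
end PartA18

section PartA19
open MeasureTheory

theorem vk_pnt_ap {q : ℕ} [NeZero q] (b : ZMod q) (hb : IsUnit b) :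
    Tendsto (fun N : ℕ => (N : ℝ)⁻¹ * ∑ k ∈ Icc 1 N, ArithmeticFunction.vonMangoldt.residueClass b k) atTop
      (nhds ((q.totient : ℝ)⁻¹)) := by
  set f := ArithmeticFunction.vonMangoldt.residueClass b with hf
  have hf0 : ∀ n, 0 ≤ f n := ArithmeticFunction.vonMangoldt.residueClass_nonneg b
  set S : ℕ → ℝ := fun n => ∑ k ∈ Icc 1 n, f k with hS
  have hS0 : ∀ n, 0 ≤ S n := fun n => sum_nonneg fun k _ => hf0 k
  have hSm : ∀ m n, m ≤ n → S m ≤ S n := fun m n h =>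
    sum_le_sum_of_subset_of_nonneg (Icc_subset_Icc_right h) fun k _ _ => hf0 k
  have hS6 : ∀ n, S n ≤ 6 * n := by
    intro n
    refine le_trans ?_ (vk_psi n)
    simp only [hS]
    have : Icc 1 n = Ioc 0 n := by ext; simp [Nat.succ_le_iff]
    rw [this]
    exact sum_le_sum fun k _ => ArithmeticFunction.vonMangoldt.residueClass_le b k
  set B : ℝ → ℝ := fun u => Real.exp (-u) * S ⌊Real.exp u⌋₊ with hBdef
  set A : ℝ := (q.totient : ℝ)⁻¹ with hAdef
  have hA : 0 ≤ A := by positivity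
  have hB0 : ∀ u, 0 ≤ B u := fun u => mul_nonneg (Real.exp_pos _).le (hS0 _)
  have hB6 : ∀ u, B u ≤ 6 := by
    intro u
    have h1 : S ⌊Real.exp u⌋₊ ≤ 6 * Real.exp u := (hS6 _).trans (by gcongr; exact Nat.floor_le (Real.exp_pos _).le)
    calc B u ≤ Real.exp (-u) * (6 * Real.exp u) := mul_le_mul_of_nonneg_left h1 (Real.exp_pos _).le
      _ = 6 * (Real.exp (-u) * Real.exp u) := by ring
      _ = 6 := by rw [← Real.exp_add]; simp
  have hBm : Measurable B := by
    have h1 : Measurable S := measurable_from_nat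
    have h2 : Measurable fun u : ℝ => S ⌊Real.exp u⌋₊ := h1.comp (Nat.measurable_floor.comp Real.measurable_exp)
    have h3 : Measurable fun u : ℝ => Real.exp (-u) := by fun_prop
    exact h3.mul h2
  set g : ℝ → ℝ := (Set.Ioi (0 : ℝ)).indicator (fun u => B u - A) with hg
  have hW : Tendsto B atTop (nhds A) := by
    refine vk_W2 B A hA hB0 ?_ g ((hBm.sub_const A).indicator measurableSet_Ioi) (6 + A) ?_ ?_ ?_
      (fun z => (ArithmeticFunction.vonMangoldt.LFunctionResidueClassAux b (1 + z) - A) / (1 + z)) ?_ ?_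
    · intro u v huv
      have : B v * Real.exp (v - u) = Real.exp (-u) * S ⌊Real.exp v⌋₊ := by
        simp only [hBdef]
        rw [mul_right_comm, ← Real.exp_add]; congr 2; ring
      rw [this]
      exact mul_le_mul_of_nonneg_left (hSm _ _ (Nat.floor_le_floor (Real.exp_le_exp.2 huv))) (Real.exp_pos _).le
    · intro u
      simp only [hg]
      by_cases hu : u ∈ Set.Ioi (0 : ℝ)
      · rw [Set.indicator_of_mem hu, abs_le]
        constructor <;> linarith [hB0 u, hB6 u]
      · rw [Set.indicator_of_notMem hu, abs_zero]; positivity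
    · intro u hu
      exact Set.indicator_of_notMem (by simpa using hu) _
    · intro u hu
      exact Set.indicator_of_mem (Set.mem_Ioi.2 hu) _
    · refine ContinuousOn.div ?_ (by fun_prop) ?_
      · refine ContinuousOn.sub ?_ continuousOn_const
        refine (ArithmeticFunction.vonMangoldt.continuousOn_LFunctionResidueClassAux b).comp (by fun_prop) fun z hz => ?_
        have hz' : 0 ≤ z.re := hz
        simpa using hz'
      · intro z hz h0
        have hz' : 0 ≤ z.re := hz
        have := congrArg Complex.re h0
        simp at this
        linarith
    · intro z hz
      have hs : 1 < (1 + z).re := by simpa using hz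
      have hz0 : z ≠ 0 := by rintro rfl; simp at hz
      have hs0 : 1 + z ≠ 0 := by intro h; rw [h] at hs; norm_num at hs
      have hO : (fun n ↦ ∑ k ∈ Icc 1 n, f k) =O[atTop] fun n : ℕ ↦ (n : ℝ) ^ (1 : ℝ) := by
        refine Asymptotics.IsBigO.of_bound 6 (Eventually.of_forall fun n => ?_)
        rw [Real.rpow_one, Real.norm_of_nonneg (hS0 n), Real.norm_of_nonneg (Nat.cast_nonneg n)]
        exact hS6 n
      have hL := LSeries_eq_mul_integral_of_nonneg f zero_le_one hs hO hf0
      have haux := ArithmeticFunction.vonMangoldt.eqOn_LFunctionResidueClassAux hb hs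
      simp only at haux
      have hint : ∫ t in Set.Ioi (1 : ℝ), (∑ k ∈ Icc 1 ⌊t⌋₊, (f k : ℂ)) * (t : ℂ) ^ (-((1 + z) + 1)) =
          ∫ u in Set.Ioi (0 : ℝ), (B u : ℂ) * Complex.exp (-z * u) := by
        rw [← Real.exp_zero, ← integral_comp_exp_Ioi]
        refine integral_congr_ae (Eventually.of_forall fun u => ?_)
        simp only [hBdef, hS]
        rw [Complex.real_smul, Complex.ofReal_mul, Complex.ofReal_sum]
        have hne : ((Real.exp u : ℝ) : ℂ) ≠ 0 := by exact_mod_cast (Real.exp_pos u).ne'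
        rw [Complex.cpow_def_of_ne_zero hne, ← Complex.ofReal_log (Real.exp_pos u).le, Real.log_exp, Complex.ofReal_exp, Complex.ofReal_exp]
        have : Complex.exp (u : ℂ) * Complex.exp (u * -(1 + z + 1)) = Complex.exp ((-u : ℝ) : ℂ) * Complex.exp (-z * u) := by
          rw [← Complex.exp_add, ← Complex.exp_add]; congr 1; push_cast; ring
        linear_combination (∑ k ∈ Icc 1 ⌊Real.exp u⌋₊, (f k : ℂ)) * this
      have hre : (-z).re < 0 := by simpa using hz
      have hiA : IntegrableOn (fun u : ℝ => (A : ℂ) * Complex.exp (-z * u)) (Set.Ioi 0) :=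
        (integrableOn_exp_mul_complex_Ioi hre 0).const_mul _
      have hiB : IntegrableOn (fun u : ℝ => (B u : ℂ) * Complex.exp (-z * u)) (Set.Ioi 0) := by
        refine ((integrableOn_exp_mul_complex_Ioi hre 0).norm.const_mul 6).mono' ?_ ?_
        · apply Measurable.aestronglyMeasurable; fun_prop
        · filter_upwards with u
          rw [norm_mul, Complex.norm_real, Real.norm_of_nonneg (hB0 u)]
          exact mul_le_mul_of_nonneg_right (hB6 u) (norm_nonneg _)
      have hG : ∫ u : ℝ, (g u : ℂ) * Complex.exp (-z * u) =
          (∫ u in Set.Ioi (0 : ℝ), (B u : ℂ) * Complex.exp (-z * u)) - ∫ u in Set.Ioi (0 : ℝ), (A : ℂ) * Complex.exp (-z * u) := by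
        rw [← integral_sub hiB hiA, ← integral_indicator measurableSet_Ioi]
        refine integral_congr_ae (Eventually.of_forall fun u => ?_)
        simp only [hg]
        by_cases hu : u ∈ Set.Ioi (0 : ℝ)
        · rw [Set.indicator_of_mem hu, Set.indicator_of_mem hu]; push_cast; ring
        · rw [Set.indicator_of_notMem hu, Set.indicator_of_notMem hu]; simp
      have hAi : ∫ u in Set.Ioi (0 : ℝ), (A : ℂ) * Complex.exp (-z * u) = A / z := by
        rw [integral_const_mul, integral_exp_mul_complex_Ioi hre]
        simp [div_eq_mul_inv]
      rw [hint] at hL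
      rw [hG, hAi, haux]
      have hL2 : ∫ u in Set.Ioi (0 : ℝ), (B u : ℂ) * Complex.exp (-z * u) = LSeries (fun n => (f n : ℂ)) (1 + z) / (1 + z) := by
        rw [hL]; field_simp
      rw [hL2]
      have hAc : ((q.totient : ℂ))⁻¹ = (A : ℂ) := by simp [hAdef]
      rw [hAc, add_sub_cancel_left]
      field_simp
      ring
  have h1 := hW.comp (Real.tendsto_log_atTop.comp tendsto_natCast_atTop_atTop)
  refine h1.congr' ?_
  filter_upwards [eventually_gt_atTop 0] with N hN
  simp only [Function.comp, hBdef]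
  have hN' : (0 : ℝ) < N := Nat.cast_pos.2 hN
  rw [Real.exp_neg, Real.exp_log hN', Nat.floor_natCast]
end PartA19

section PartA20

theorem vk_nonunit {q : ℕ} [NeZero q] (b : ZMod q) (hb : ¬ IsUnit b) :
    Tendsto (fun N : ℕ => (N : ℝ)⁻¹ * ∑ k ∈ Icc 1 N, ArithmeticFunction.vonMangoldt.residueClass b k) atTop (nhds 0) := by
  have hup : Tendsto (fun N : ℕ => (N : ℝ)⁻¹ * ((q : ℝ) * (2 * Real.log N + 1) * Real.log N)) atTop (nhds 0) := by
    have h1 : Tendsto (fun x : ℝ => Real.log x ^ 2 / x) atTop (nhds 0) := by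
      simpa using Real.tendsto_pow_log_div_mul_add_atTop 1 0 2 one_ne_zero
    have h2 : Tendsto (fun x : ℝ => Real.log x ^ 1 / x) atTop (nhds 0) := by
      simpa using Real.tendsto_pow_log_div_mul_add_atTop 1 0 1 one_ne_zero
    have h3 := ((h1.const_mul (2 * (q : ℝ))).add (h2.const_mul (q : ℝ))).comp (tendsto_natCast_atTop_atTop (R := ℝ))
    simp only [mul_zero, add_zero] at h3
    refine h3.congr fun N => ?_
    simp only [Function.comp]
    ring
  refine squeeze_zero (fun N => ?_) (fun N => ?_) hup
  · exact mul_nonneg (by positivity) (sum_nonneg fun k _ => ArithmeticFunction.vonMangoldt.residueClass_nonneg b k)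
  · refine mul_le_mul_of_nonneg_left ?_ (by positivity)
    refine le_trans ?_ (vk_nc_mass q N (Nat.pos_of_ne_zero (NeZero.ne q)))
    have e : Icc 1 N = Ioc 0 N := by ext; simp [Nat.succ_le_iff]
    rw [e, sum_filter]
    refine sum_le_sum fun k _ => ?_
    unfold ArithmeticFunction.vonMangoldt.residueClass
    by_cases hk : (k : ZMod q) = b
    · have : ¬ k.Coprime q := by
        intro h
        exact hb (hk ▸ (ZMod.isUnit_iff_coprime k q).2 h)
      rw [if_pos this]
      exact Set.indicator_le_self' (fun _ _ => ArithmeticFunction.vonMangoldt_nonneg) _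
    · rw [Set.indicator_of_notMem (by simpa using hk)]
      split_ifs
      · exact le_rfl
      · exact ArithmeticFunction.vonMangoldt_nonneg

theorem vk_rational (l : ℂ) (q : ℕ) (hq : 0 < q) (hl : l ^ q = 1) :
    ∃ c : ℂ, Tendsto (fun N : ℕ => (N : ℂ)⁻¹ * ∑ k ∈ Icc 1 N, ((ArithmeticFunction.vonMangoldt k : ℝ) : ℂ) * l ^ k) atTop (nhds c) := by
  haveI : NeZero q := ⟨hq.ne'⟩
  have h : ∀ b : ZMod q, ∃ c : ℝ, Tendsto (fun N : ℕ => (N : ℝ)⁻¹ * ∑ k ∈ Icc 1 N, ArithmeticFunction.vonMangoldt.residueClass b k) atTop (nhds c) := by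
    intro b
    by_cases hb : IsUnit b
    · exact ⟨_, vk_pnt_ap b hb⟩
    · exact ⟨_, vk_nonunit b hb⟩
  choose c hc using h
  refine ⟨∑ b : ZMod q, l ^ b.val * (c b : ℂ), ?_⟩
  have h1 := tendsto_finsetSum (univ : Finset (ZMod q)) fun b _ =>
    (((Complex.continuous_ofReal.tendsto _).comp (hc b)).const_mul (l ^ b.val))
  refine h1.congr fun N => ?_
  simp only [Function.comp]
  push_cast
  have hk : ∀ k : ℕ, ((ArithmeticFunction.vonMangoldt k : ℝ) : ℂ) * l ^ k = ∑ b : ZMod q, l ^ b.val * (ArithmeticFunction.vonMangoldt.residueClass b k : ℂ) := by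
    intro k
    rw [sum_eq_single (k : ZMod q)]
    · unfold ArithmeticFunction.vonMangoldt.residueClass
      rw [Set.indicator_of_mem (by simp), ZMod.val_natCast, ← pow_mod_orderOf l k, ← pow_mod_orderOf l (k % q),
        Nat.mod_mod_of_dvd _ (orderOf_dvd_of_pow_eq_one hl), mul_comm]
    · intro b _ hb
      unfold ArithmeticFunction.vonMangoldt.residueClass
      rw [Set.indicator_of_notMem (by simpa using hb.symm)]
      simp
    · simp
  simp only [hk]
  rw [sum_comm, mul_sum]
  refine sum_congr rfl fun b _ => ?_
  rw [← mul_sum]; ring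
end PartA20

section PartA21

theorem vk_prime_diff (l : ℂ) (hl : ‖l‖ = 1) :
    Tendsto (fun N : ℕ => (N : ℂ)⁻¹ * ∑ k ∈ Icc 1 N, (LambdaPrime k : ℂ) * l ^ k -
      (N : ℂ)⁻¹ * ∑ k ∈ Icc 1 N, ((ArithmeticFunction.vonMangoldt k : ℝ) : ℂ) * l ^ k) atTop (nhds 0) := by
  obtain ⟨C, hC⟩ := Chebyshev.psi_sub_theta_le_mul_sqrt
  have hlim : Tendsto (fun N : ℕ => C * (Real.sqrt N)⁻¹) atTop (nhds 0) := by
    have h1 : Tendsto (fun N : ℕ => Real.sqrt (N : ℝ)) atTop atTop :=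
      Real.tendsto_sqrt_atTop.comp tendsto_natCast_atTop_atTop
    simpa using h1.inv_tendsto_atTop.const_mul C
  refine squeeze_zero_norm' ?_ hlim
  filter_upwards [eventually_gt_atTop 0] with N hN
  have hN' : (0 : ℝ) < N := Nat.cast_pos.2 hN
  have e : Icc 1 N = Ioc 0 N := by ext; simp [Nat.succ_le_iff]
  rw [← mul_sub, ← sum_sub_distrib, norm_mul, norm_inv, Complex.norm_natCast, e]
  have h1 : ‖∑ k ∈ Ioc 0 N, ((LambdaPrime k : ℂ) * l ^ k - ((ArithmeticFunction.vonMangoldt k : ℝ) : ℂ) * l ^ k)‖ ≤ C * Real.sqrt N := by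
    refine le_trans ?_ (hC N)
    rw [Chebyshev.psi_sub_theta_eq_sum_not_prime, Nat.floor_natCast, sum_filter]
    refine norm_sum_le_of_le _ fun k _ => ?_
    rw [← sub_mul, norm_mul, norm_pow, hl, one_pow, mul_one, LambdaPrime]
    by_cases hk : k.Prime
    · simp [hk, ArithmeticFunction.vonMangoldt_apply_prime hk]
    · simp [hk, abs_of_nonneg ArithmeticFunction.vonMangoldt_nonneg]
  calc (N : ℝ)⁻¹ * _ ≤ (N : ℝ)⁻¹ * (C * Real.sqrt N) := mul_le_mul_of_nonneg_left h1 (by positivity)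
    _ = C * (Real.sqrt N)⁻¹ := by
      have hs : 0 < Real.sqrt N := Real.sqrt_pos.2 hN'
      have h2 : Real.sqrt N * Real.sqrt N = N := Real.mul_self_sqrt hN'.le
      nth_rewrite 1 [← h2]
      field_simp

theorem vk_irr_limit (l : ℂ) (hl : ‖l‖ = 1) (hn : ¬ ∃ m : ℕ, 0 < m ∧ l ^ m = 1) :
    Tendsto (fun N : ℕ => (N : ℂ)⁻¹ * ∑ k ∈ Icc 1 N, ((ArithmeticFunction.vonMangoldt k : ℝ) : ℂ) * l ^ k) atTop (nhds 0) := by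
  set α := l.arg / (2 * Real.pi) with hα
  have hlα : vke α = l := by
    rw [vke, hα, mul_div_cancel₀ _ (by have := Real.pi_pos; positivity)]
    have := Complex.norm_mul_exp_arg_mul_I l
    rw [hl, Complex.ofReal_one, one_mul, mul_comm] at this
    exact this
  have hirr : Irrational α := by
    rintro ⟨r, hr⟩
    refine hn ⟨r.den, r.den_pos, ?_⟩
    rw [← hlα, ← vke_nat_mul, ← hr]
    have : ((r.den : ℕ) : ℝ) * (r : ℝ) = ((r.num : ℤ) : ℝ) := by
      have := Rat.den_mul_eq_num r
      exact_mod_cast this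
    rw [this, vke_int]
  rw [Metric.tendsto_atTop']
  intro ε hε
  have h := vk_irr hirr (ε / 2) (half_pos hε)
  obtain ⟨N₀, hN₀⟩ := (h.and (eventually_gt_atTop 0)).exists_forall_of_atTop
  refine ⟨N₀, fun N hN => ?_⟩
  obtain ⟨h1, h2⟩ := hN₀ N hN.le
  have hN' : (0 : ℝ) < N := Nat.cast_pos.2 h2
  have e : Icc 1 N = Ioc 0 N := by ext; simp [Nat.succ_le_iff]
  have e2 : ∑ k ∈ Icc 1 N, ((ArithmeticFunction.vonMangoldt k : ℝ) : ℂ) * l ^ k =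
      ∑ k ∈ Ioc 0 N, ((ArithmeticFunction.vonMangoldt k : ℝ) : ℂ) * vke (k * α) := by
    rw [e]
    refine sum_congr rfl fun k _ => ?_
    rw [vke_nat_mul, hlα]
  rw [dist_zero_right, e2, norm_mul, norm_inv, Complex.norm_natCast, inv_mul_lt_iff₀ hN']
  refine h1.trans_lt ?_
  nlinarith

end PartA21

/-- For every `λ ∈ ℂ` with `|λ| = 1`, the limit
`c(λ) = lim_N (1/N) ∑_{k=1}^N Λ'(k) λ^k` exists; the limit `lim_N (1/N) ∑_{k=1}^N Λ(k) λ^k`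
also exists and equals `c(λ)`; and `c(λ) = 0` whenever `λ` is not a root of unity.
In particular `(Λ(n))` and `(Λ'(n))` are Hartman sequences with the same Fourier–Bohr
coefficients. -/
theorem stmt12 (l : ℂ) (hl : ‖l‖ = 1) :
    ∃ c : ℂ,
      Tendsto (fun N : ℕ => (N : ℂ)⁻¹ * ∑ k ∈ Icc 1 N, (LambdaPrime k : ℂ) * l ^ k)
        atTop (nhds c) ∧
      Tendsto (fun N : ℕ =>
          (N : ℂ)⁻¹ * ∑ k ∈ Icc 1 N, ((ArithmeticFunction.vonMangoldt k : ℝ) : ℂ) * l ^ k)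
        atTop (nhds c) ∧
      ((¬ ∃ m : ℕ, 0 < m ∧ l ^ m = 1) → c = 0) := by
  have hd := vk_prime_diff l hl
  by_cases h : ∃ m : ℕ, 0 < m ∧ l ^ m = 1
  · obtain ⟨m, hm, hlm⟩ := h
    obtain ⟨c, hc⟩ := vk_rational l m hm hlm
    refine ⟨c, ?_, hc, fun h => absurd ⟨m, hm, hlm⟩ h⟩
    have := hd.add hc
    simpa using this
  · have hc := vk_irr_limit l hl h
    refine ⟨0, ?_, hc, fun _ => rfl⟩
    have := hd.add hc
    simpa using this
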